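/- Every set of 17 points in the plane ℝ² in general position contains a 6-gon, i.e., six points in convex position. (The Erdős–Szekeres bound g(6) ≤ 17, recomputed in the paper.) -/

import Mathlib

/-- Orientation determinant of three points in the plane:
`det [[1,1,1],[pₓ,qₓ,rₓ],[p_y,q_y,r_y]]`.
The triple `(p,q,r)` is positively oriented iff `det3 p q r > 0`,
and negatively oriented iff `det3 p q r < 0`. -/
noncomputable def det3 (p q r : ℝ × ℝ) : ℝ :=
  Matrix.det !![(1:ℝ), 1, 1; p.1, q.1, r.1; p.2, q.2, r.2]

/-- A set of points in the plane is in general position if no three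
distinct points of it are collinear. -/
def InGenPos (S : Set (ℝ × ℝ)) : Prop :=
  ∀ p ∈ S, ∀ q ∈ S, ∀ r ∈ S, p ≠ q → p ≠ r → q ≠ r →
    ¬ Collinear ℝ ({p, q, r} : Set (ℝ × ℝ))

/-- `P` is a `k`-gon of `S`: a `k`-element subset of `S` in convex position,
i.e. every point of `P` is an extreme point of the convex hull of `P`. -/
def IsGon (k : ℕ) (S P : Set (ℝ × ℝ)) : Prop :=
  P ⊆ S ∧ P.Finite ∧ P.ncard = k ∧
    ∀ p ∈ P, p ∈ Set.extremePoints ℝ (convexHull ℝ P)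

/-- `P` is a `k`-hole of `S`: a `k`-gon of `S` whose convex hull contains
no point of `S` other than the `k` points of `P`. -/
def IsHole (k : ℕ) (S P : Set (ℝ × ℝ)) : Prop :=
  IsGon k S P ∧ ∀ q ∈ S, q ∈ convexHull ℝ P → q ∈ P


namespace K6
noncomputable section
/-- `n`-ary boolean functions on naturals -/
@[reducible] def Arr (n : Nat) : Type := Nat.rec Bool (fun _ ih => Nat → ih) n
def hd (l : List Nat) : Nat := List.rec 0 (fun x _ _ => x) l
def tl (l : List Nat) : List Nat := List.rec [] (fun _ xs _ => xs) l
def lam (n : Nat) : (List Nat → Bool) → Arr n :=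
  Nat.rec (fun F => F []) (fun _ ih F => fun x => ih (fun l => F (x :: l))) n
def app (n : Nat) : Arr n → List Nat → Bool :=
  Nat.rec (fun k _ => k) (fun _ ih k l => ih (k (hd l)) (tl l)) n
def drp (n : Nat) : List Nat → List Nat := Nat.rec (fun l => l) (fun _ ih l => ih (tl l)) n
def nth (n : Nat) : List Nat → Nat := Nat.rec (fun l => hd l) (fun _ ih l => ih (tl l)) n
def orA (x : Nat) : Nat → (Nat → Nat) → Nat
  | 0, _ => x
  | n+1, f => Nat.lor (orA x n f) (f n)
def orU : Nat → (Nat → Nat) → Nat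
  | 0, _ => 0
  | n+1, f => orA (f 0) n (fun i => f (i+1))
def rowT (f : Nat → Nat) : Nat → Nat → List Nat → List Nat
  | 0, _, r => r
  | n+1, s, r => f s :: rowT f n (s+1) r
def tabT (f : Nat → Nat → Nat) : Nat → Nat → List Nat → List Nat
  | 0, _, r => r
  | n+1, g, r => rowT (f g) (n+1) 1 (tabT f n (g+1) r)
/-- read entry `(g,h)` of a table of size `M` -/
def rdT : Nat → Nat → List Nat → Nat → Nat
  | _, 0, _, _ => 0
  | _, 1, l, h => nth (h-1) l
  | M, g+2, l, h => rdT (M-1) (g+1) (drp M l) h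

section
variable (x y n s M g h : Nat) (f : Nat → Nat) (F : Nat → Nat → Nat) (l r xs : List Nat)
theorem hd_c : hd (x :: xs) = x := rfl
theorem tl_c : tl (x :: xs) = xs := rfl
theorem lam_z (F) : lam 0 F = F [] := rfl
theorem lam_s (F) : lam (n+1) F = fun x => lam n (fun l => F (x :: l)) := rfl
theorem app_z (k l) : app 0 k l = k := rfl
theorem app_s (k l) : app (n+1) k l = app n (k (hd l)) (tl l) := rfl
theorem drp_z : drp 0 xs = xs := rfl
theorem drp_s : drp (n+1) xs = drp n (tl xs) := rfl
theorem nth_z : nth 0 xs = hd xs := rfl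
theorem nth_s : nth (n+1) xs = nth n (tl xs) := rfl
theorem orA_z : orA x 0 f = x := rfl
theorem orA_s : orA x (n+1) f = Nat.lor (orA x n f) (f n) := rfl
theorem orU_z : orU 0 f = 0 := rfl
theorem orU_s : orU (n+1) f = orA (f 0) n (fun i => f (i+1)) := rfl
theorem rowT_z : rowT f 0 s r = r := rfl
theorem rowT_s : rowT f (n+1) s r = f s :: rowT f n (s+1) r := rfl
theorem tabT_z : tabT F 0 s r = r := rfl
theorem tabT_s : tabT F (n+1) g r = rowT (F g) (n+1) 1 (tabT F n (g+1) r) := rfl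
theorem rdT_o : rdT M 1 l h = nth (h-1) l := rfl
theorem rdT_s : rdT M (g+2) l h = rdT (M-1) (g+1) (drp M l) h := rfl
end

/-- shift right by `g` fields -/
def sR (W g x : Nat) : Nat := Nat.shiftRight x (Nat.mul g W)
def sL (W g x : Nat) : Nat := Nat.shiftLeft x (Nat.mul g W)

abbrev rP (l : List Nat) (g h : Nat) : Nat := rdT 11 g l h
abbrev rN (l : List Nat) (g h : Nat) : Nat := rdT 11 g (drp 66 l) h

/-- signotope propagation, stage 1 -/
def s1 (W : Nat) (P : Nat → Nat → Nat) (g m : Nat) : Nat :=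
  orA (P g m) (((m-1) - 2*(m-5)) * (1-(g-4))) (fun i =>
    Nat.land (P g (i+1+(m-5))) (Nat.lor (P (g+(i+1+(m-5))) (m-(i+1+(m-5)))) (sR W g (P (i+1+(m-5)) (m-(i+1+(m-5)))))))
def s2 (W : Nat) (P : Nat → Nat → Nat) (m k : Nat) : Nat :=
  orA (P m k) (((m-1) - 2*(m-5)) * (1-(k-4))) (fun i =>
    Nat.land (Nat.lor (P (i+1+(m-5)) (m-(i+1+(m-5)))) (P (i+1+(m-5)) (m-(i+1+(m-5))+k)))
      (sR W (i+1+(m-5)) (P (m-(i+1+(m-5))) k)))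
def spS1 (W : Nat) (l : List Nat) : List Nat :=
  tabT (s1 W (rP l)) 11 1 (tabT (s1 W (rN l)) 11 1 (drp 132 l))
def spS2 (W : Nat) (l : List Nat) : List Nat :=
  tabT (s2 W (rP l)) 11 1 (tabT (s2 W (rN l)) 11 1 (drp 132 l))

/-- chains -/
def c3E (W : Nat) (P : Nat → Nat → Nat) (h : Nat) : Nat := orU (12-h) (fun i => sL W (i+1) (P (i+1) h))
def c3S (P : Nat → Nat → Nat) (g : Nat) : Nat := orU (12-g) (fun i => P g (i+1))
def cE (W : Nat) (P : Nat → Nat → Nat) (E : Nat → Nat) (h : Nat) : Nat :=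
  orU (12-h) (fun i => sL W (i+1) (Nat.land (P (i+1) h) (E (i+1))))
def cS (W : Nat) (P : Nat → Nat → Nat) (S : Nat → Nat) (g : Nat) : Nat :=
  orU (12-g) (fun i => Nat.land (P g (i+1)) (sR W g (S (i+1))))
abbrev row1 (l : List Nat) (o i : Nat) : Nat := nth (i-1) (drp o l)
def cpPN (l r : List Nat) : List Nat := tabT (rP l) 11 1 (tabT (rN l) 11 1 r)
def spEa (W : Nat) (l : List Nat) : List Nat :=
  rowT (c3E W (rP l)) 11 1 (rowT (c3S (rP l)) 11 1 (rowT (c3E W (rN l)) 11 1 (rowT (c3S (rN l)) 11 1 l)))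
def spEb (W : Nat) (l : List Nat) : List Nat :=
  rowT (cE W (rP (drp 44 l)) (row1 l 0)) 11 1 (rowT (cS W (rP (drp 44 l)) (row1 l 11)) 11 1
    (rowT (cE W (rN (drp 44 l)) (row1 l 22)) 11 1 (rowT (cS W (rN (drp 44 l)) (row1 l 33)) 11 1 l)))
def spEd (W : Nat) (l : List Nat) : List Nat :=
  rowT (cE W (rP (drp 88 l)) (row1 l 0)) 11 1 (rowT (cS W (rP (drp 88 l)) (row1 l 11)) 11 1 l)
def rm (W D : Nat) : Nat := Nat.sub (Nat.shiftLeft 1 (Nat.mul (16-D) W)) 1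
def fN (W : Nat) (N : Nat → Nat → Nat) (E3 E4 E5 S3 S4 S5 : Nat → Nat) (g h : Nat) : Nat :=
  Nat.lor (N g h) (Nat.lor (Nat.lor (Nat.land (E5 g) (rm W (g+h))) (Nat.land (E4 g) (sR W g (S3 h))))
    (Nat.lor (Nat.land (E3 g) (sR W g (S4 h))) (sR W g (S5 h))))
def fP (W : Nat) (P : Nat → Nat → Nat) (e3 e4 s3 s4 : Nat → Nat) (g h : Nat) : Nat :=
  Nat.lor (P g h) (Nat.lor (Nat.land (e4 g) (rm W (g+h)))
    (Nat.lor (Nat.land (e3 g) (sR W g (s3 h))) (sR W g (s4 h))))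
def spEc (W : Nat) (l : List Nat) : List Nat :=
  tabT (fP W (rP (drp 110 l)) (row1 l 88) (row1 l 44) (row1 l 99) (row1 l 55)) 11 1
    (tabT (fN W (rN (drp 110 l)) (row1 l 66) (row1 l 22) (row1 l 0)
      (row1 l 77) (row1 l 33) (row1 l 11)) 11 1 (drp 242 l))

/-- four-chains -/
def q4 (W : Nat) (P : Nat → Nat → Nat) (s k : Nat) : Nat :=
  orU (s-1) (fun i => Nat.land (P (i+1) (s-(i+1))) (sR W (i+1) (P (s-(i+1)) k)))
def dO (W : Nat) (N : Nat → Nat → Nat) (D : Nat) : Nat := orU (D-2) (fun i => q4 W N (i+2) (D-(i+2)))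
def dNI (N : Nat → Nat → Nat) (D : Nat) : Nat := orU (D-1) (fun i => N (i+1) (D-(i+1)))
/-- layout: u4 (45), O (9, D=3..11), NI (11, D=2..12), state -/
def spAa (W : Nat) (l : List Nat) : List Nat :=
  tabT (fun i k => q4 W (rP l) (i+1) k) 9 1 (rowT (dO W (rN l)) 9 3 (rowT (dNI (rN l)) 11 2 l))
abbrev ru (l : List Nat) (s k : Nat) : Nat := rdT 9 (s-1) l k
def dU (u : Nat → Nat → Nat) (D : Nat) : Nat := orU (D-2) (fun i => u (i+2) (D-(i+2)))
def dV (W : Nat) (P u : Nat → Nat → Nat) (D : Nat) : Nat :=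
  orU (D-3) (fun i => orU (D-3-i) (fun j => Nat.land (u (i+2) (j+1)) (sR W (i+2) (P (j+1) (D-(i+2)-(j+1))))))
def duf (W : Nat) (P : Nat → Nat → Nat) (O NI : Nat → Nat) (s k : Nat) : Nat :=
  orA (O (s+k)) (12-(s+k)) (fun i => Nat.land (sR W s (P k (i+1))) (NI (s+k+(i+1))))
def spAb (W : Nat) (l : List Nat) : List Nat :=
  tabT (fun i k => duf W (rP (drp 65 l)) (fun D => nth (D-3) (drp 45 l)) (fun D => nth (D-2) (drp 54 l)) (i+1) k) 9 1
    (rowT (dU (ru l)) 9 3 (rowT (dV W (rP (drp 65 l)) (ru l)) 9 4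
      (tabT (fun i k => ru l (i+1) k) 9 1 (drp 45 l))))
/-- layout: uf 45, U 9, V 9, u4 45, O 9, NI 11, state -/
def fAN (W : Nat) (P N : Nat → Nat → Nat) (u uf : Nat → Nat → Nat) (NI : Nat → Nat) (x y : Nat) : Nat :=
  orA (orA (orA (N x y) (11-(x+y)) (fun i => sL W (i+2) (Nat.land (u (i+2) x) (NI (i+2+(x+y))))))
    (11-(x+y)) (fun i => Nat.land (sR W x (P y (i+1))) (uf (x+y) (i+1))))
    (11-(x+y)) (fun i => sL W (i+1) (Nat.land (P (i+1) x) (uf (i+1+x) y)))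
def fAP (W : Nat) (P N : Nat → Nat → Nat) (U V : Nat → Nat) (x y : Nat) : Nat :=
  orA (orA (orA (P x y) ((x+y-3) * (1-(x+y-12)) - (x+y-4)) (fun _ => V (x+y)))
    (11-(x+y)) (fun i => Nat.land (sR W x (N y (i+1))) (U (x+y+(i+1)))))
    (11-(x+y)) (fun i => sL W (i+1) (Nat.land (N (i+1) x) (U (i+1+(x+y)))))
def spAc (W : Nat) (l : List Nat) : List Nat :=
  tabT (fAP W (rP (drp 128 l)) (rN (drp 128 l)) (fun D => nth (D-3) (drp 45 l)) (fun D => nth (D-4) (drp 54 l))) 11 1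
    (tabT (fAN W (rP (drp 128 l)) (rN (drp 128 l)) (ru (drp 63 l)) (ru l) (fun D => nth (D-2) (drp 117 l))) 11 1
      (orA (nth 260 l) 9 (fun i => Nat.land (nth i (drp 45 l)) (nth i (drp 108 l))) :: drp 261 l))

/-- finish: dead lanes -/
def rep (W m : Nat) : Nat → Nat
  | 0 => m
  | n+1 => Nat.lor m (Nat.shiftLeft (rep W m n) W)
def ddA (P N : Nat → Nat → Nat) (x : Nat) : Nat :=
  orA x 11 (fun i => orU (11-i) (fun j => Nat.land (P (i+1) (j+1)) (N (i+1) (j+1))))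
def spFa (l : List Nat) : List Nat := ddA (rP l) (rN l) (nth 132 l) :: l
def spFb (W : Nat) (l : List Nat) : List Nat :=
  Nat.xor (nth 134 l) (Nat.land (nth 134 l) (orU 14 (fun i => sR W i (nth 0 l)))) :: drp 1 l
/-- branching order: (16 g + h, a) -/
def ord : List (Nat × Nat) := [
  (17,6), (17,7), (17,5), (17,8), (17,4), (17,9), (17,3), (17,10), (18,6), (33,6), (18,5), (33,5),
  (18,7), (33,7), (18,4), (33,4), (18,8), (33,8), (17,2), (17,11), (18,3), (33,3), (18,9), (33,9),
  (19,5), (34,5), (49,5), (19,6), (34,6), (49,6), (17,1), (17,12), (18,2), (33,2), (18,10), (33,10),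
  (19,4), (34,4), (49,4), (19,7), (34,7), (49,7), (19,3), (34,3), (49,3), (19,8), (34,8), (49,8),
  (18,1), (33,1), (18,11), (33,11), (19,2), (34,2), (49,2), (19,9), (34,9), (49,9), (17,0), (17,13),
  (20,5), (35,5), (50,5), (65,5), (20,4), (35,4), (50,4), (65,4), (20,6), (35,6), (50,6), (65,6),
  (20,3), (35,3), (50,3), (65,3), (20,7), (35,7), (50,7), (65,7), (19,1), (34,1), (49,1), (19,10),
  (34,10), (49,10), (18,0), (33,0), (18,12), (33,12), (20,2), (35,2), (50,2), (65,2), (20,8), (35,8),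
  (50,8), (65,8), (21,4), (36,4), (51,4), (66,4), (81,4), (21,5), (36,5), (51,5), (66,5), (81,5),
  (19,0), (34,0), (49,0), (19,11), (34,11), (49,11), (20,1), (35,1), (50,1), (65,1), (20,9), (35,9),
  (50,9), (65,9), (21,3), (36,3), (51,3), (66,3), (81,3), (21,6), (36,6), (51,6), (66,6), (81,6),
  (21,2), (36,2), (51,2), (66,2), (81,2), (21,7), (36,7), (51,7), (66,7), (81,7), (20,0), (35,0),
  (50,0), (65,0), (20,10), (35,10), (50,10), (65,10), (21,1), (36,1), (51,1), (66,1), (81,1), (21,8),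
  (36,8), (51,8), (66,8), (81,8), (22,4), (37,4), (52,4), (67,4), (82,4), (97,4), (22,3), (37,3),
  (52,3), (67,3), (82,3), (97,3), (22,5), (37,5), (52,5), (67,5), (82,5), (97,5), (22,2), (37,2),
  (52,2), (67,2), (82,2), (97,2), (22,6), (37,6), (52,6), (67,6), (82,6), (97,6), (21,0), (36,0),
  (51,0), (66,0), (81,0), (21,9), (36,9), (51,9), (66,9), (81,9), (22,1), (37,1), (52,1), (67,1),
  (82,1), (97,1), (22,7), (37,7), (52,7), (67,7), (82,7), (97,7), (23,3), (38,3), (53,3), (68,3),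
  (83,3), (98,3), (113,3), (23,4), (38,4), (53,4), (68,4), (83,4), (98,4), (113,4), (22,0), (37,0),
  (52,0), (67,0), (82,0), (97,0), (22,8), (37,8), (52,8), (67,8), (82,8), (97,8), (23,2), (38,2),
  (53,2), (68,2), (83,2), (98,2), (113,2), (23,5), (38,5), (53,5), (68,5), (83,5), (98,5), (113,5),
  (23,1), (38,1)]
def decV (W : Nat) (P N : Nat → Nat → Nat) (v : Nat × Nat) : Nat :=
  sR W v.2 (Nat.lor (P (v.1/16) (v.1%16)) (N (v.1/16) (v.1%16)))
def selL (W : Nat) (P N : Nat → Nat → Nat) (al : Nat) (vs : List (Nat × Nat)) : List Nat :=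
  List.rec [] (fun v _ ih => Nat.land al (decV W P N v) :: ih) vs
def cln (R : Nat) (P : Nat → Nat → Nat) (g h : Nat) : Nat := Nat.land (P g h) R
/-- fc : al' :: state -/
def spFc (W j : Nat) (l : List Nat) : List Nat :=
  tabT (cln (rep W (hd l) 13) (rP (drp 1 l))) 11 1 (tabT (cln (rep W (hd l) 13) (rN (drp 1 l))) 11 1
    [hd l, nth j (hd l :: selL W (rP (drp 1 l)) (rN (drp 1 l)) (hd l) ord), Nat.xor (rm W 15) (hd l), 0, 0])
def spC1L (W s : Nat) (l : List Nat) : List Nat :=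
  rep W (Nat.land (nth 133 l) (Nat.shiftRight (nth 134 l) s)) 13 ::
  Nat.land (nth 133 l) (Nat.shiftRight (nth 134 l) s) ::
  Nat.shiftLeft (Nat.land (nth 133 l) (Nat.shiftRight (nth 134 l) s)) s :: l
def spC1R (W s : Nat) (l : List Nat) : List Nat :=
  rep W (Nat.land (nth 133 l) (Nat.shiftLeft (nth 134 l) s)) 13 ::
  Nat.land (nth 133 l) (Nat.shiftLeft (nth 134 l) s) ::
  Nat.shiftRight (Nat.land (nth 133 l) (Nat.shiftLeft (nth 134 l) s)) s :: l
def cpy (sh : Nat → Nat) (R : Nat) (P : Nat → Nat → Nat) (g h : Nat) : Nat :=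
  Nat.lor (P g h) (sh (Nat.land (P g h) R))
def spC2 (sh : Nat → Nat) (l : List Nat) : List Nat :=
  tabT (cpy sh (nth 0 l) (rP (drp 3 l))) 11 1 (tabT (cpy sh (nth 0 l) (rN (drp 3 l))) 11 1
    [Nat.lor (nth 135 l) (nth 2 l), Nat.xor (nth 136 l) (nth 1 l), Nat.xor (nth 137 l) (nth 2 l),
     Nat.lor (nth 138 l) (nth 1 l), Nat.lor (nth 139 l) (nth 2 l)])
/-- first undecided variable -/
def mss (dec : Nat × Nat → Nat) : List (Nat × Nat) → Nat → List Nat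
  | [], _ => []
  | v :: vs, r => Nat.xor r (Nat.land r (dec v)) :: mss dec vs (Nat.land r (dec v))
/-- positions of the variables of each shape in the branching order: (index, a) -/
def okT : List (List (List (Nat × Nat))) := [
  [
    [(0,6), (1,7), (2,5), (3,8), (4,4), (5,9), (6,3), (7,10), (18,2), (19,11), (30,1), (31,12), (58,0), (59,13)],
    [(8,6), (10,5), (12,7), (14,4), (16,8), (20,3), (22,9), (32,2), (34,10), (48,1), (50,11), (86,0), (88,12)],
    [(24,5), (27,6), (36,4), (39,7), (42,3), (45,8), (52,2), (55,9), (80,1), (83,10), (108,0), (111,11)],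
    [(60,5), (64,4), (68,6), (72,3), (76,7), (90,2), (94,8), (114,1), (118,9), (142,0), (146,10)],
    [(98,4), (103,5), (122,3), (127,6), (132,2), (137,7), (150,1), (155,8), (190,0), (195,9)],
    [(160,4), (166,3), (172,5), (178,2), (184,6), (200,1), (206,7), (226,0), (232,8)],
    [(212,3), (219,4), (238,2), (245,5), (252,1)]],
  [
    [(9,6), (11,5), (13,7), (15,4), (17,8), (21,3), (23,9), (33,2), (35,10), (49,1), (51,11), (87,0), (89,12)],
    [(25,5), (28,6), (37,4), (40,7), (43,3), (46,8), (53,2), (56,9), (81,1), (84,10), (109,0), (112,11)],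
    [(61,5), (65,4), (69,6), (73,3), (77,7), (91,2), (95,8), (115,1), (119,9), (143,0), (147,10)],
    [(99,4), (104,5), (123,3), (128,6), (133,2), (138,7), (151,1), (156,8), (191,0), (196,9)],
    [(161,4), (167,3), (173,5), (179,2), (185,6), (201,1), (207,7), (227,0), (233,8)],
    [(213,3), (220,4), (239,2), (246,5), (253,1)]],
  [
    [(26,5), (29,6), (38,4), (41,7), (44,3), (47,8), (54,2), (57,9), (82,1), (85,10), (110,0), (113,11)],
    [(62,5), (66,4), (70,6), (74,3), (78,7), (92,2), (96,8), (116,1), (120,9), (144,0), (148,10)],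
    [(100,4), (105,5), (124,3), (129,6), (134,2), (139,7), (152,1), (157,8), (192,0), (197,9)],
    [(162,4), (168,3), (174,5), (180,2), (186,6), (202,1), (208,7), (228,0), (234,8)],
    [(214,3), (221,4), (240,2), (247,5)]],
  [
    [(63,5), (67,4), (71,6), (75,3), (79,7), (93,2), (97,8), (117,1), (121,9), (145,0), (149,10)],
    [(101,4), (106,5), (125,3), (130,6), (135,2), (140,7), (153,1), (158,8), (193,0), (198,9)],
    [(163,4), (169,3), (175,5), (181,2), (187,6), (203,1), (209,7), (229,0), (235,8)],
    [(215,3), (222,4), (241,2), (248,5)]],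
  [
    [(102,4), (107,5), (126,3), (131,6), (136,2), (141,7), (154,1), (159,8), (194,0), (199,9)],
    [(164,4), (170,3), (176,5), (182,2), (188,6), (204,1), (210,7), (230,0), (236,8)],
    [(216,3), (223,4), (242,2), (249,5)]],
  [
    [(165,4), (171,3), (177,5), (183,2), (189,6), (205,1), (211,7), (231,0), (237,8)],
    [(217,3), (224,4), (243,2), (250,5)]],
  [
    [(218,3), (225,4), (244,2), (251,5)]]]
def gt {α : Type} : List (List α) → Nat → List α
  | [], _ => []
  | x :: _, 0 => x
  | _ :: xs, n+1 => gt xs n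
def ups (W : Nat) (l : List Nat) (vs : List (Nat × Nat)) : Nat :=
  List.rec 0 (fun v vs ih => List.rec (sL W v.2 (nth v.1 l)) (fun _ _ _ => Nat.lor ih (sL W v.2 (nth v.1 l))) vs) vs
def spSa (W : Nat) (l : List Nat) : List Nat :=
  rowT (fun i => nth i (mss (decV W (rP l) (rN l)) ord (Nat.lor (nth 135 l) (nth 136 l)))) 254 0 l
def spSb (W : Nat) (l : List Nat) : List Nat :=
  tabT (fun g h => ups W l (gt (gt okT (g-1)) (h-1))) 7 1
    (rep W (nth 389 l) 13 :: rep W (nth 390 l) 13 :: drp 254 l)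
def upd (R : Nat) (P T : Nat → Nat → Nat) (g h : Nat) : Nat :=
  orA (P g h) (1-(g+h-8)) (fun _ => Nat.land (T g h) R)
def spSc (l : List Nat) : List Nat :=
  tabT (upd (nth 28 l) (rP (drp 30 l)) (rdT 7 · l ·)) 11 1
   (tabT (upd (nth 29 l) (rN (drp 30 l)) (rdT 7 · l ·)) 11 1 [0, nth 162 l])
section
variable (x y n s M g h W m og key r : Nat) (ms : List Nat) (v : Nat × Nat) (vs : List (Nat × Nat))
variable (P N : Nat → Nat → Nat) (dec : Nat × Nat → Nat)
theorem rep_z : rep W m 0 = m := rfl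
theorem rep_s : rep W m (n+1) = Nat.lor m (Nat.shiftLeft (rep W m n) W) := rfl
theorem selL_z : selL W P N x [] = [] := rfl
theorem selL_s : selL W P N x (v :: vs) = Nat.land x (decV W P N v) :: selL W P N x vs := rfl
theorem mss_z : mss dec [] r = [] := rfl
theorem mss_s : mss dec (v :: vs) r = Nat.xor r (Nat.land r (dec v)) :: mss dec vs (Nat.land r (dec v)) := rfl
theorem ups_z : ups W ms [] = 0 := rfl
theorem ups_o : ups W ms [v] = sL W v.2 (nth v.1 ms) := rfl
theorem ups_s (v' : Nat × Nat) : ups W ms (v :: v' :: vs) =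
  Nat.lor (ups W ms (v' :: vs)) (sL W v.2 (nth v.1 ms)) := rfl
theorem gt_z {α : Type} : gt ([] : List (List α)) n = [] := rfl
theorem gt_o {α : Type} (a : List α) (b : List (List α)) : gt (a :: b) 0 = a := rfl
theorem gt_s {α : Type} (a : List α) (b : List (List α)) : gt (a :: b) (n+1) = gt b n := rfl
theorem cond_t {α} (a b : α) : cond true a b = a := rfl
theorem cond_f {α} (a b : α) : cond false a b = b := rfl
end
set_option maxRecDepth 100000
set_option maxHeartbeats 0
set_option linter.all false
def uS1 : {f : Nat → Arr 134 → Arr 134 // f = fun W k => lam 134 (fun l => app 134 k (spS1 W l))} := by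
  refine ⟨?f, ?h⟩
  case h =>
    dsimp only [Nat.reduceAdd, Nat.reduceSub, Nat.reduceMul, Nat.reduceDiv, Nat.reduceMod, hd_c, tl_c, ↓lam_z, ↓lam_s, ↓app_z, ↓app_s, drp_z, drp_s, nth_z, nth_s, orA_z, orA_s, orU_z, orU_s, ↓rowT_z, ↓rowT_s, ↓tabT_z, ↓tabT_s, rdT_o, rdT_s, sR, sL, rP, rN, row1, ru, spS1, s1]
    exact rfl

def uS2 : {f : Nat → Arr 134 → Arr 134 // f = fun W k => lam 134 (fun l => app 134 k (spS2 W l))} := by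
  refine ⟨?f, ?h⟩
  case h =>
    dsimp only [Nat.reduceAdd, Nat.reduceSub, Nat.reduceMul, Nat.reduceDiv, Nat.reduceMod, hd_c, tl_c, ↓lam_z, ↓lam_s, ↓app_z, ↓app_s, drp_z, drp_s, nth_z, nth_s, orA_z, orA_s, orU_z, orU_s, ↓rowT_z, ↓rowT_s, ↓tabT_z, ↓tabT_s, rdT_o, rdT_s, sR, sL, rP, rN, row1, ru, spS2, s2]
    exact rfl

def uEa : {f : Nat → Arr 178 → Arr 134 // f = fun W k => lam 134 (fun l => app 178 k (spEa W l))} := by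
  refine ⟨?f, ?h⟩
  case h =>
    dsimp only [Nat.reduceAdd, Nat.reduceSub, Nat.reduceMul, Nat.reduceDiv, Nat.reduceMod, hd_c, tl_c, ↓lam_z, ↓lam_s, ↓app_z, ↓app_s, drp_z, drp_s, nth_z, nth_s, orA_z, orA_s, orU_z, orU_s, ↓rowT_z, ↓rowT_s, ↓tabT_z, ↓tabT_s, rdT_o, rdT_s, sR, sL, rP, rN, row1, ru, spEa, c3E, c3S]
    exact rfl

def uEb : {f : Nat → Arr 222 → Arr 178 // f = fun W k => lam 178 (fun l => app 222 k (spEb W l))} := by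
  refine ⟨?f, ?h⟩
  case h =>
    dsimp only [Nat.reduceAdd, Nat.reduceSub, Nat.reduceMul, Nat.reduceDiv, Nat.reduceMod, hd_c, tl_c, ↓lam_z, ↓lam_s, ↓app_z, ↓app_s, drp_z, drp_s, nth_z, nth_s, orA_z, orA_s, orU_z, orU_s, ↓rowT_z, ↓rowT_s, ↓tabT_z, ↓tabT_s, rdT_o, rdT_s, sR, sL, rP, rN, row1, ru, spEb, cE, cS]
    exact rfl

def uEd : {f : Nat → Arr 244 → Arr 222 // f = fun W k => lam 222 (fun l => app 244 k (spEd W l))} := by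
  refine ⟨?f, ?h⟩
  case h =>
    dsimp only [Nat.reduceAdd, Nat.reduceSub, Nat.reduceMul, Nat.reduceDiv, Nat.reduceMod, hd_c, tl_c, ↓lam_z, ↓lam_s, ↓app_z, ↓app_s, drp_z, drp_s, nth_z, nth_s, orA_z, orA_s, orU_z, orU_s, ↓rowT_z, ↓rowT_s, ↓tabT_z, ↓tabT_s, rdT_o, rdT_s, sR, sL, rP, rN, row1, ru, spEd, cE, cS]
    exact rfl

def uEc : {f : Nat → Arr 134 → Arr 244 // f = fun W k => lam 244 (fun l => app 134 k (spEc W l))} := by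
  refine ⟨?f, ?h⟩
  case h =>
    dsimp only [Nat.reduceAdd, Nat.reduceSub, Nat.reduceMul, Nat.reduceDiv, Nat.reduceMod, hd_c, tl_c, ↓lam_z, ↓lam_s, ↓app_z, ↓app_s, drp_z, drp_s, nth_z, nth_s, orA_z, orA_s, orU_z, orU_s, ↓rowT_z, ↓rowT_s, ↓tabT_z, ↓tabT_s, rdT_o, rdT_s, sR, sL, rP, rN, row1, ru, spEc, fN, fP, rm]
    exact rfl

def uAa : {f : Nat → Arr 199 → Arr 134 // f = fun W k => lam 134 (fun l => app 199 k (spAa W l))} := by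
  refine ⟨?f, ?h⟩
  case h =>
    dsimp only [Nat.reduceAdd, Nat.reduceSub, Nat.reduceMul, Nat.reduceDiv, Nat.reduceMod, hd_c, tl_c, ↓lam_z, ↓lam_s, ↓app_z, ↓app_s, drp_z, drp_s, nth_z, nth_s, orA_z, orA_s, orU_z, orU_s, ↓rowT_z, ↓rowT_s, ↓tabT_z, ↓tabT_s, rdT_o, rdT_s, sR, sL, rP, rN, row1, ru, spAa, q4, dO, dNI]
    exact rfl

def uAb : {f : Nat → Arr 262 → Arr 199 // f = fun W k => lam 199 (fun l => app 262 k (spAb W l))} := by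
  refine ⟨?f, ?h⟩
  case h =>
    dsimp only [Nat.reduceAdd, Nat.reduceSub, Nat.reduceMul, Nat.reduceDiv, Nat.reduceMod, hd_c, tl_c, ↓lam_z, ↓lam_s, ↓app_z, ↓app_s, drp_z, drp_s, nth_z, nth_s, orA_z, orA_s, orU_z, orU_s, ↓rowT_z, ↓rowT_s, ↓tabT_z, ↓tabT_s, rdT_o, rdT_s, sR, sL, rP, rN, row1, ru, spAb, dU, dV, duf]
    exact rfl

def uAc : {f : Nat → Arr 134 → Arr 262 // f = fun W k => lam 262 (fun l => app 134 k (spAc W l))} := by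
  refine ⟨?f, ?h⟩
  case h =>
    dsimp only [Nat.reduceAdd, Nat.reduceSub, Nat.reduceMul, Nat.reduceDiv, Nat.reduceMod, hd_c, tl_c, ↓lam_z, ↓lam_s, ↓app_z, ↓app_s, drp_z, drp_s, nth_z, nth_s, orA_z, orA_s, orU_z, orU_s, ↓rowT_z, ↓rowT_s, ↓tabT_z, ↓tabT_s, rdT_o, rdT_s, sR, sL, rP, rN, row1, ru, spAc, fAN, fAP]
    exact rfl

def uFa : {f : Arr 135 → Arr 134 // f = fun  k => lam 134 (fun l => app 135 k (spFa l))} := by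
  refine ⟨?f, ?h⟩
  case h =>
    dsimp only [Nat.reduceAdd, Nat.reduceSub, Nat.reduceMul, Nat.reduceDiv, Nat.reduceMod, hd_c, tl_c, ↓lam_z, ↓lam_s, ↓app_z, ↓app_s, drp_z, drp_s, nth_z, nth_s, orA_z, orA_s, orU_z, orU_s, ↓rowT_z, ↓rowT_s, ↓tabT_z, ↓tabT_s, rdT_o, rdT_s, sR, sL, rP, rN, row1, ru, spFa, ddA]
    exact rfl

def uFb : {f : Nat → Arr 135 → Arr 135 // f = fun W k => lam 135 (fun l => app 135 k (spFb W l))} := by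
  refine ⟨?f, ?h⟩
  case h =>
    dsimp only [Nat.reduceAdd, Nat.reduceSub, Nat.reduceMul, Nat.reduceDiv, Nat.reduceMod, hd_c, tl_c, ↓lam_z, ↓lam_s, ↓app_z, ↓app_s, drp_z, drp_s, nth_z, nth_s, orA_z, orA_s, orU_z, orU_s, ↓rowT_z, ↓rowT_s, ↓tabT_z, ↓tabT_s, rdT_o, rdT_s, sR, sL, rP, rN, row1, ru, spFb]
    exact rfl

def uFc : {f : Nat → Nat → Arr 137 → Arr 135 // f = fun W j k => lam 135 (fun l => cond (Nat.beq (hd l) 0) true (app 137 k (spFc W j l)))} := by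
  refine ⟨?f, ?h⟩
  case h =>
    dsimp only [Nat.reduceAdd, Nat.reduceSub, Nat.reduceMul, Nat.reduceDiv, Nat.reduceMod, hd_c, tl_c, ↓lam_z, ↓lam_s, ↓app_z, ↓app_s, drp_z, drp_s, nth_z, nth_s, orA_z, orA_s, orU_z, orU_s, ↓rowT_z, ↓rowT_s, ↓tabT_z, ↓tabT_s, rdT_o, rdT_s, sR, sL, rP, rN, row1, ru, spFc, cln, rep_z, rep_s, selL_z, selL_s, decV, ord, rm]
    exact rfl

def uC1L : {f : Nat → Nat → Arr 140 → Arr 137 // f = fun W s k => lam 137 (fun l => app 140 k (spC1L W s l))} := by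
  refine ⟨?f, ?h⟩
  case h =>
    dsimp only [Nat.reduceAdd, Nat.reduceSub, Nat.reduceMul, Nat.reduceDiv, Nat.reduceMod, hd_c, tl_c, ↓lam_z, ↓lam_s, ↓app_z, ↓app_s, drp_z, drp_s, nth_z, nth_s, orA_z, orA_s, orU_z, orU_s, ↓rowT_z, ↓rowT_s, ↓tabT_z, ↓tabT_s, rdT_o, rdT_s, sR, sL, rP, rN, row1, ru, spC1L, rep_z, rep_s]
    exact rfl

def uC1R : {f : Nat → Nat → Arr 140 → Arr 137 // f = fun W s k => lam 137 (fun l => app 140 k (spC1R W s l))} := by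
  refine ⟨?f, ?h⟩
  case h =>
    dsimp only [Nat.reduceAdd, Nat.reduceSub, Nat.reduceMul, Nat.reduceDiv, Nat.reduceMod, hd_c, tl_c, ↓lam_z, ↓lam_s, ↓app_z, ↓app_s, drp_z, drp_s, nth_z, nth_s, orA_z, orA_s, orU_z, orU_s, ↓rowT_z, ↓rowT_s, ↓tabT_z, ↓tabT_s, rdT_o, rdT_s, sR, sL, rP, rN, row1, ru, spC1R, rep_z, rep_s]
    exact rfl

def uC2L : {f : Nat → Arr 137 → Arr 140 // f = fun s k => lam 140 (fun l => app 137 k (spC2 (fun x => Nat.shiftLeft x s) l))} := by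
  refine ⟨?f, ?h⟩
  case h =>
    dsimp only [Nat.reduceAdd, Nat.reduceSub, Nat.reduceMul, Nat.reduceDiv, Nat.reduceMod, hd_c, tl_c, ↓lam_z, ↓lam_s, ↓app_z, ↓app_s, drp_z, drp_s, nth_z, nth_s, orA_z, orA_s, orU_z, orU_s, ↓rowT_z, ↓rowT_s, ↓tabT_z, ↓tabT_s, rdT_o, rdT_s, sR, sL, rP, rN, row1, ru, spC2, cpy]
    exact rfl

def uC2R : {f : Nat → Arr 137 → Arr 140 // f = fun s k => lam 140 (fun l => app 137 k (spC2 (fun x => Nat.shiftRight x s) l))} := by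
  refine ⟨?f, ?h⟩
  case h =>
    dsimp only [Nat.reduceAdd, Nat.reduceSub, Nat.reduceMul, Nat.reduceDiv, Nat.reduceMod, hd_c, tl_c, ↓lam_z, ↓lam_s, ↓app_z, ↓app_s, drp_z, drp_s, nth_z, nth_s, orA_z, orA_s, orU_z, orU_s, ↓rowT_z, ↓rowT_s, ↓tabT_z, ↓tabT_s, rdT_o, rdT_s, sR, sL, rP, rN, row1, ru, spC2, cpy]
    exact rfl

def uSa : {f : Nat → Arr 391 → Arr 137 // f = fun W k => lam 137 (fun l => app 391 k (spSa W l))} := by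
  refine ⟨?f, ?h⟩
  case h =>
    dsimp only [Nat.reduceAdd, Nat.reduceSub, Nat.reduceMul, Nat.reduceDiv, Nat.reduceMod, hd_c, tl_c, ↓lam_z, ↓lam_s, ↓app_z, ↓app_s, drp_z, drp_s, nth_z, nth_s, orA_z, orA_s, orU_z, orU_s, ↓rowT_z, ↓rowT_s, ↓tabT_z, ↓tabT_s, rdT_o, rdT_s, sR, sL, rP, rN, row1, ru, spSa, mss_z, mss_s, decV, ord]
    exact rfl

def uSb : {f : Nat → Arr 167 → Arr 391 // f = fun W k => lam 391 (fun l => app 167 k (spSb W l))} := by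
  refine ⟨?f, ?h⟩
  case h =>
    dsimp only [Nat.reduceAdd, Nat.reduceSub, Nat.reduceMul, Nat.reduceDiv, Nat.reduceMod, hd_c, tl_c, ↓lam_z, ↓lam_s, ↓app_z, ↓app_s, drp_z, drp_s, nth_z, nth_s, orA_z, orA_s, orU_z, orU_s, ↓rowT_z, ↓rowT_s, ↓tabT_z, ↓tabT_s, rdT_o, rdT_s, sR, sL, rP, rN, row1, ru, spSb, ups_z, ups_o, ups_s, gt_z, gt_o, gt_s, okT, rep_z, rep_s]
    exact rfl

def uSc : {f : Arr 134 → Arr 167 // f = fun  k => lam 167 (fun l => app 134 k (spSc l))} := by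
  refine ⟨?f, ?h⟩
  case h =>
    dsimp only [Nat.reduceAdd, Nat.reduceSub, Nat.reduceMul, Nat.reduceDiv, Nat.reduceMod, hd_c, tl_c, ↓lam_z, ↓lam_s, ↓app_z, ↓app_s, drp_z, drp_s, nth_z, nth_s, orA_z, orA_s, orU_z, orU_s, ↓rowT_z, ↓rowT_s, ↓tabT_z, ↓tabT_s, rdT_o, rdT_s, sR, sL, rP, rN, row1, ru, spSc, upd]
    exact rfl


def copies (W : Nat) (k : Arr 137) (ss : List Nat) : Arr 137 :=
  List.rec k (fun s _ ih => cond (Nat.ble W s) (uC1R.1 W (Nat.sub s W) (uC2R.1 (Nat.sub s W) ih))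
    (uC1L.1 W s (uC2L.1 s ih))) ss
def grow (W j : Nat) (ss : List Nat) (k : Arr 134) : Arr 134 :=
  uFa.1 (uFb.1 W (uFc.1 W j (copies W (uSa.1 W (uSb.1 W (uSc.1 k))) ss)))
def pass (W : Nat) (k : Arr 134) : Arr 134 :=
  uS1.1 W (uS2.1 W (uEa.1 W (uEb.1 W (uEd.1 W (uEc.1 W (uAa.1 W (uAb.1 W (uAc.1 W k))))))))
/-- a round is `flag :: filter :: shifts`; a nonzero flag asks for a propagation pass -/
def run (W : Nat) (k : Arr 134) (rs : List (List Nat)) : Arr 134 :=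
  List.rec k (fun r _ ih => cond (Nat.beq (hd r) 0) (grow W (hd (tl r)) (tl (tl r)) ih)
    (pass W (grow W (hd (tl r)) (tl (tl r)) ih))) rs
def ini (W : Nat) (pb : List Nat) (vs : List (Nat × Nat)) : Nat :=
  List.rec 0 (fun v _ ih => Nat.lor ih (sL W v.2 (nth v.1 pb))) vs
def initL (W : Nat) (pb nb : List Nat) : List Nat :=
  tabT (fun g h => ini W pb (gt (gt okT (g-1)) (h-1))) 11 1
    (tabT (fun g h => ini W nb (gt (gt okT (g-1)) (h-1))) 11 1 [0, 1])
def check (W : Nat) (pb nb : List Nat) (rs : List (List Nat)) : Bool :=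
  app 134 (run W (lam 134 (fun _ => false)) rs) (initL W pb nb)
end
end K6
namespace K6
def pad (n : Nat) : List Nat → List Nat := Nat.rec (fun _ => []) (fun _ ih l => hd l :: ih (tl l)) n
theorem app_lam (n : Nat) (F : List Nat → Bool) (l : List Nat) : app n (lam n F) l = F (pad n l) := by
  induction n generalizing F l with
  | zero => rfl
  | succ n ih => exact ih (fun l' => F (hd l :: l')) (tl l)
theorem pad_eq (n : Nat) (l : List Nat) (h : l.length = n) : pad n l = l := by
  induction n generalizing l with
  | zero => cases l with
    | nil => rfl
    | cons => simp at h
  | succ n ih => cases l with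
    | nil => simp at h
    | cons x xs =>
      have := ih xs (by simpa using h)
      show x :: pad n xs = x :: xs
      rw [this]
theorem app_lam' {n : Nat} (F : List Nat → Bool) {l : List Nat} (h : l.length = n) :
    app n (lam n F) l = F l := by rw [app_lam, pad_eq n l h]
theorem drp_len (n : Nat) (l : List Nat) : (drp n l).length = l.length - n := by
  induction n generalizing l with
  | zero => rfl
  | succ n ih =>
    rw [drp_s, ih]
    cases l with
    | nil => simp [tl]
    | cons x xs => simp [tl_c]
theorem rowT_len (f : Nat → Nat) (n s : Nat) (r : List Nat) : (rowT f n s r).length = n + r.length := by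
  induction n generalizing s with
  | zero => simp [rowT]
  | succ n ih => simp only [rowT, List.length_cons, ih]; omega
def tri : Nat → Nat
  | 0 => 0
  | n+1 => n + 1 + tri n
theorem tabT_len (f : Nat → Nat → Nat) (n g : Nat) (r : List Nat) : (tabT f n g r).length = tri n + r.length := by
  induction n generalizing g with
  | zero => simp [tabT, tri]
  | succ n ih => simp only [tabT, rowT_len, ih, tri]; omega
theorem drp_add (m n : Nat) (l : List Nat) : drp (m + n) l = drp n (drp m l) := by
  induction m generalizing l with
  | zero => simp [drp_z]
  | succ m ih => rw [Nat.succ_add, drp_s, drp_s, ih]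
theorem nth_drp (m n : Nat) (l : List Nat) : nth n (drp m l) = nth (m + n) l := by
  induction m generalizing l with
  | zero => simp [drp_z]
  | succ m ih => rw [Nat.succ_add, drp_s, nth_s, ih]
theorem drp_rowT (f : Nat → Nat) (n s : Nat) (r : List Nat) : drp n (rowT f n s r) = r := by
  induction n generalizing s with
  | zero => rfl
  | succ n ih => rw [rowT_s, drp_s, tl_c, ih]
theorem nth_rowT (f : Nat → Nat) (n s i : Nat) (r : List Nat) (h : i < n) : nth i (rowT f n s r) = f (s + i) := by
  induction n generalizing s i with
  | zero => omega
  | succ n ih =>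
    rw [rowT_s]
    cases i with
    | zero => rfl
    | succ i => rw [nth_s, tl_c, ih _ _ (by omega)]; congr 1; omega
theorem drp_tabT (f : Nat → Nat → Nat) (n g : Nat) (r : List Nat) : drp (tri n) (tabT f n g r) = r := by
  induction n generalizing g with
  | zero => rfl
  | succ n ih => rw [tabT_s, tri, drp_add, drp_rowT, ih]
theorem rdT_tabT (f : Nat → Nat → Nat) (M g0 g h : Nat) (r : List Nat) (hg : 1 ≤ g) (hh : 1 ≤ h) (hs : g + h ≤ M + 1) :
    rdT M g (tabT f M g0 r) h = f (g0 + (g - 1)) h := by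
  induction g generalizing M g0 with
  | zero => omega
  | succ g ih =>
    obtain ⟨M, rfl⟩ : ∃ m, M = m + 1 := ⟨M - 1, by omega⟩
    cases g with
    | zero =>
      rw [rdT_o, tabT_s, nth_rowT _ _ _ _ _ (by omega)]
      congr 1; omega
    | succ g =>
      rw [rdT_s, tabT_s, drp_rowT, Nat.add_sub_cancel, ih M (g0+1) (by omega) (by omega)]
      congr 1; omega
/-! ### lanes -/
def Ok (W ℓ : Nat) (φ : Nat → Prop) (x : Nat) : Prop := ∀ a, x.testBit (a * W + ℓ) = true → φ a
section
variable {W ℓ : Nat} {φ ψ : Nat → Prop} {x y : Nat}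
theorem Ok.mono (h : Ok W ℓ φ x) (H : ∀ a, φ a → ψ a) : Ok W ℓ ψ x := fun a ha => H a (h a ha)
theorem Ok.and (h : Ok W ℓ φ x) (h' : Ok W ℓ ψ y) : Ok W ℓ (fun a => φ a ∧ ψ a) (Nat.land x y) := by
  intro a ha
  have ha : (x &&& y).testBit (a * W + ℓ) = true := ha
  rw [Nat.testBit_and, Bool.and_eq_true] at ha
  exact ⟨h a ha.1, h' a ha.2⟩
theorem Ok.or (h : Ok W ℓ φ x) (h' : Ok W ℓ φ y) : Ok W ℓ φ (Nat.lor x y) := by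
  intro a ha
  have ha : (x ||| y).testBit (a * W + ℓ) = true := ha
  rw [Nat.testBit_or, Bool.or_eq_true] at ha
  exact ha.elim (h a) (h' a)
theorem Ok.or' (h : Ok W ℓ φ x) (h' : Ok W ℓ ψ y) : Ok W ℓ (fun a => φ a ∨ ψ a) (Nat.lor x y) :=
  Ok.or (h.mono fun _ => Or.inl) (h'.mono fun _ => Or.inr)
theorem Ok.zero : Ok W ℓ φ 0 := by intro a ha; simp at ha
theorem Ok.orA {n : Nat} {f : Nat → Nat} (h : Ok W ℓ φ x) (h' : ∀ i, i < n → Ok W ℓ φ (f i)) :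
    Ok W ℓ φ (orA x n f) := by
  induction n with
  | zero => exact h
  | succ n ih => exact (ih fun i hi => h' i (by omega)).or (h' n (by omega))
theorem Ok.orU {n : Nat} {f : Nat → Nat} (h' : ∀ i, i < n → Ok W ℓ φ (f i)) :
    Ok W ℓ φ (orU n f) := by
  cases n with
  | zero => exact Ok.zero
  | succ n => exact (h' 0 (by omega)).orA fun i hi => h' (i+1) (by omega)
theorem Ok.sR (g : Nat) (h : Ok W ℓ φ x) : Ok W ℓ (fun a => φ (a + g)) (sR W g x) := by
  intro a ha
  have ha : (x >>> (g * W)).testBit (a * W + ℓ) = true := ha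
  rw [Nat.testBit_shiftRight] at ha
  apply h; rw [← ha]; congr 1; ring
theorem Ok.sL (hℓ : ℓ < W) (g : Nat) (h : Ok W ℓ φ x) : Ok W ℓ (fun a => g ≤ a ∧ φ (a - g)) (sL W g x) := by
  intro a ha
  have ha : (x <<< (g * W)).testBit (a * W + ℓ) = true := ha
  rw [Nat.testBit_shiftLeft, Bool.and_eq_true, decide_eq_true_eq] at ha
  have hg : g ≤ a := by
    by_contra hc
    have : (a + 1) * W ≤ g * W := Nat.mul_le_mul_right _ (by omega)
    have h2 : (a + 1) * W = a * W + W := by ring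
    omega
  refine ⟨hg, h _ ?_⟩
  rw [← ha.2]; congr 1
  rw [Nat.sub_mul]
  have : g * W ≤ a * W := Nat.mul_le_mul_right _ hg
  omega
theorem Ok.rm (hℓ : ℓ < W) (D : Nat) : Ok W ℓ (fun a => a < 16 - D) (rm W D) := by
  intro a ha
  have ha : ((1 <<< ((16 - D) * W)) - 1).testBit (a * W + ℓ) = true := ha
  rw [Nat.one_shiftLeft, Nat.testBit_two_pow_sub_one, decide_eq_true_eq] at ha
  by_contra hc
  have : (16 - D) * W ≤ a * W := Nat.mul_le_mul_right _ (by omega)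
  omega
end
end K6

namespace K6
structure Cls (t : Nat → Nat → Nat → Bool) : Prop where
  s1 : ∀ v a b c d, a < b → b < c → c < d → d ≤ 15 → t a b c = v → t a c d = v → t a b d = v
  s2 : ∀ v a b c d, a < b → b < c → c < d → d ≤ 15 → t a b c = v → t b c d = v → t a b d = v
  s3 : ∀ v a b c d, a < b → b < c → c < d → d ≤ 15 → t a b c = v → t b c d = v → t a c d = v
  s4 : ∀ v a b c d, a < b → b < c → c < d → d ≤ 15 → t a b d = v → t b c d = v → t a c d = v
  cap5 : ∀ a b c d e, a < b → b < c → c < d → d < e → e ≤ 15 →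
    t a b c = false → t b c d = false → t c d e = false → False
  cup6 : ∀ a b c d e f, a < b → b < c → c < d → d < e → e < f → f ≤ 15 →
    t a b c = true → t b c d = true → t c d e = true → t d e f = true → False
  c44 : ∀ a b c b' c' d, a < b → b < c → c < d → a < b' → b' < c' → c' < d → d ≤ 15 →
    t a b c = false → t b c d = false → t a b' c' = true → t b' c' d = true → False
  c53 : ∀ a b c d x e, a < b → b < c → c < d → d < e → a < x → x < e → e ≤ 15 →
    t a b c = true → t b c d = true → t c d e = true → t a x e = false → False

/-- the triple `a, a+g, a+g+h` has value `v` -/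
def Cup (t : Nat → Nat → Nat → Bool) (v : Bool) (g h a : Nat) : Prop :=
  a + g + h ≤ 15 ∧ t a (a + g) (a + g + h) = v
theorem Cup.at {t v g h a} (b c : Nat) (H : Cup t v g h a) (hb : a + g = b) (hc : b + h = c) :
    c ≤ 15 ∧ t a b c = v := by subst hb hc; exact H
theorem Cup.of {t v g h a} (b c : Nat) (hb : a + g = b) (hc : b + h = c) (h1 : c ≤ 15) (h2 : t a b c = v) :
    Cup t v g h a := by subst hb hc; exact ⟨h1, h2⟩
def Tab (W ℓ M : Nat) (Φ : Nat → Nat → Nat → Prop) (P : Nat → Nat → Nat) : Prop :=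
  ∀ g h, 1 ≤ g → 1 ≤ h → g + h ≤ M → Ok W ℓ (Φ g h) (P g h)
def Row (W ℓ lo hi : Nat) (Φ : Nat → Nat → Prop) (P : Nat → Nat) : Prop :=
  ∀ h, lo ≤ h → h ≤ hi → Ok W ℓ (Φ h) (P h)
structure Stt (W ℓ : Nat) (t : Nat → Nat → Nat → Bool) (l : List Nat) : Prop where
  len : l.length = 134
  p : Tab W ℓ 12 (Cup t true) (rP l)
  n : Tab W ℓ 12 (Cup t false) (rN l)
  f : Ok W ℓ (fun _ => False) (nth 132 l)
  a : (nth 133 l).testBit ℓ = true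
  al : nth 133 l < 2 ^ W

theorem drp_tab2 (f f' : Nat → Nat → Nat) (r : List Nat) : drp 132 (tabT f 11 1 (tabT f' 11 1 r)) = r := by
  rw [show 132 = tri 11 + tri 11 from rfl, drp_add, drp_tabT, drp_tabT]
theorem rP_tab {f : Nat → Nat → Nat} {r : List Nat} {g h : Nat} (hg : 1 ≤ g) (hh : 1 ≤ h) (hs : g + h ≤ 12) :
    rP (tabT f 11 1 r) g h = f g h := by
  rw [rP, rdT_tabT _ _ _ _ _ _ hg hh hs]; congr 1; omega
theorem rN_tab {f f' : Nat → Nat → Nat} {r : List Nat} {g h : Nat} (hg : 1 ≤ g) (hh : 1 ≤ h) (hs : g + h ≤ 12) :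
    rN (tabT f 11 1 (tabT f' 11 1 r)) g h = f' g h := by
  rw [rN, show 66 = tri 11 from rfl, drp_tabT]; exact rP_tab hg hh hs
theorem Stt.mk' {W ℓ : Nat} {t : Nat → Nat → Nat → Bool} {f f' : Nat → Nat → Nat} {r : List Nat}
    (hr : r.length = 2) (hp : Tab W ℓ 12 (Cup t true) f) (hn : Tab W ℓ 12 (Cup t false) f')
    (hf : Ok W ℓ (fun _ => False) (nth 0 r)) (ha : (nth 1 r).testBit ℓ = true) (hal : nth 1 r < 2 ^ W) :
    Stt W ℓ t (tabT f 11 1 (tabT f' 11 1 r)) where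
  len := by simp [tabT_len, tri, hr]
  p g h hg hh hs := by rw [rP_tab hg hh hs]; exact hp g h hg hh hs
  n g h hg hh hs := by rw [rN_tab hg hh hs]; exact hn g h hg hh hs
  f := by rw [show 132 = 132 + 0 from rfl, ← nth_drp, drp_tab2]; exact hf
  a := by rw [show 133 = 132 + 1 from rfl, ← nth_drp, drp_tab2]; exact ha
  al := by rw [show 133 = 132 + 1 from rfl, ← nth_drp, drp_tab2]; exact hal
theorem lt_of_lt_mul {i A B : Nat} (h : i < A * B) (hB : B ≤ 1) : i < A :=
  lt_of_lt_of_le h (by nlinarith)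

section
variable {W ℓ : Nat} {t : Nat → Nat → Nat → Bool} {P N : Nat → Nat → Nat}
theorem Tab.s1 {v : Bool} (C : Cls t) (hP : Tab W ℓ 12 (Cup t v) P) : Tab W ℓ 12 (Cup t v) (K6.s1 W P) := by
  intro g m hg hm hs
  refine Ok.orA (hP g m hg hm hs) fun i hi => ?_
  have hi := lt_of_lt_mul hi (by omega)
  generalize hj : i + 1 + (m - 5) = j
  refine ((hP g j hg (by omega) (by omega)).and ((hP (g + j) (m - j) (by omega) (by omega) (by omega)).or'
    ((hP j (m - j) (by omega) (by omega) (by omega)).sR g))).mono ?_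
  rintro a ⟨h1, h2⟩
  have h1 := h1.at (a+g) (a+g+j) rfl rfl
  rcases h2 with h2 | h2
  · have h2 := h2.at (a+g+j) (a+g+m) (by omega) (by omega)
    exact ⟨h2.1, C.s1 _ a (a+g) (a+g+j) (a+g+m) (by omega) (by omega) (by omega) h2.1 h1.2 h2.2⟩
  · have h2 := h2.at (a+g+j) (a+g+m) (by omega) (by omega)
    exact ⟨h2.1, C.s2 _ a (a+g) (a+g+j) (a+g+m) (by omega) (by omega) (by omega) h2.1 h1.2 h2.2⟩
theorem Tab.s2 {v : Bool} (C : Cls t) (hP : Tab W ℓ 12 (Cup t v) P) : Tab W ℓ 12 (Cup t v) (K6.s2 W P) := by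
  intro m k hm hk hs
  refine Ok.orA (hP m k hm hk hs) fun i hi => ?_
  have hi := lt_of_lt_mul hi (by omega)
  generalize hj : i + 1 + (m - 5) = j
  refine (((hP j (m - j) (by omega) (by omega) (by omega)).or' (hP j (m - j + k) (by omega) (by omega) (by omega))).and
    ((hP (m - j) k (by omega) (by omega) (by omega)).sR j)).mono ?_
  rintro a ⟨h1, h2⟩
  have h2 := h2.at (a+m) (a+m+k) (by omega) (by omega)
  rcases h1 with h1 | h1
  · have h1 := h1.at (a+j) (a+m) (by omega) (by omega)
    exact ⟨h2.1, C.s3 _ a (a+j) (a+m) (a+m+k) (by omega) (by omega) (by omega) h2.1 h1.2 h2.2⟩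
  · have h1 := h1.at (a+j) (a+m+k) (by omega) (by omega)
    exact ⟨h2.1, C.s4 _ a (a+j) (a+m) (a+m+k) (by omega) (by omega) (by omega) h2.1 h1.2 h2.2⟩
theorem drp_nth (m n : Nat) (l : List Nat) : nth n (drp m l) = nth (m + n) l := nth_drp m n l
theorem Stt.S1 {l} (C : Cls t) (h : Stt W ℓ t l) : Stt W ℓ t (spS1 W l) :=
  Stt.mk' (by rw [drp_len, h.len]) (h.p.s1 C) (h.n.s1 C) (by rw [nth_drp]; exact h.f)
    (by rw [nth_drp]; exact h.a) (by rw [nth_drp]; exact h.al)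
theorem Stt.S2 {l} (C : Cls t) (h : Stt W ℓ t l) : Stt W ℓ t (spS2 W l) :=
  Stt.mk' (by rw [drp_len, h.len]) (h.p.s2 C) (h.n.s2 C) (by rw [nth_drp]; exact h.f)
    (by rw [nth_drp]; exact h.a) (by rw [nth_drp]; exact h.al)

/-! chains: a `v`-chain of `n+2` points ending (starting) with the pair `b, b+h` -/
def En (t : Nat → Nat → Nat → Bool) (v : Bool) : Nat → Nat → Nat → Prop
  | 0, h, b => b + h ≤ 15
  | n+1, h, b => b + h ≤ 15 ∧ ∃ a, a < b ∧ t a b (b + h) = v ∧ En t v n (b - a) a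
def Sn (t : Nat → Nat → Nat → Bool) (v : Bool) : Nat → Nat → Nat → Prop
  | 0, h, b => b + h ≤ 15
  | n+1, h, b => ∃ k, 1 ≤ k ∧ b + h + k ≤ 15 ∧ t b (b + h) (b + h + k) = v ∧ Sn t v n k (b + h)
theorem row_c3E {v} (hℓ : ℓ < W) (hP : Tab W ℓ 12 (Cup t v) P) : Row W ℓ 1 11 (En t v 1) (c3E W P) := by
  intro h h1 h2
  refine Ok.orU fun i hi => ((hP (i+1) h (by omega) h1 (by omega)).sL hℓ (i+1)).mono ?_
  rintro b ⟨h3, h4⟩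
  have h4 := h4.at b (b+h) (by omega) rfl
  exact ⟨h4.1, b - (i+1), by omega, h4.2, by show b - (i+1) + (b - (b - (i+1))) ≤ 15; omega⟩
theorem row_c3S {v} (hP : Tab W ℓ 12 (Cup t v) P) : Row W ℓ 1 11 (Sn t v 1) (c3S P) := by
  intro g h1 h2
  refine Ok.orU fun i hi => (hP g (i+1) h1 (by omega) (by omega)).mono ?_
  intro b h4
  exact ⟨i+1, by omega, h4.1, h4.2, by show b + g + (i+1) ≤ 15; exact h4.1⟩
theorem row_cE {v n E} (hℓ : ℓ < W) (hP : Tab W ℓ 12 (Cup t v) P) (hE : Row W ℓ 1 11 (En t v n) E) :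
    Row W ℓ 1 11 (En t v (n+1)) (cE W P E) := by
  intro h h1 h2
  refine Ok.orU fun i hi => (((hP (i+1) h (by omega) h1 (by omega)).and (hE (i+1) (by omega) (by omega))).sL hℓ (i+1)).mono ?_
  rintro b ⟨h3, h4, h5⟩
  have h4 := h4.at b (b+h) (by omega) rfl
  refine ⟨h4.1, b - (i+1), by omega, h4.2, ?_⟩
  rwa [show b - (b - (i+1)) = i+1 by omega]
theorem row_cS {v n S} (hP : Tab W ℓ 12 (Cup t v) P) (hS : Row W ℓ 1 11 (Sn t v n) S) :
    Row W ℓ 1 11 (Sn t v (n+1)) (cS W P S) := by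
  intro g h1 h2
  refine Ok.orU fun i hi => ((hP g (i+1) h1 (by omega) (by omega)).and ((hS (i+1) (by omega) (by omega)).sR g)).mono ?_
  rintro b ⟨h4, h5⟩
  exact ⟨i+1, by omega, h4.1, h4.2, h5⟩
theorem En.out {v n h b} (H : En t v (n+1) h b) : b + h ≤ 15 ∧ ∃ a, a < b ∧ t a b (b+h) = v ∧ En t v n (b-a) a := H
theorem tab_fN {E3 E4 E5 S3 S4 S5 : Nat → Nat} (C : Cls t) (hℓ : ℓ < W) (hN : Tab W ℓ 12 (Cup t false) N)
    (e3 : Row W ℓ 1 11 (En t true 1) E3) (e4 : Row W ℓ 1 11 (En t true 2) E4) (e5 : Row W ℓ 1 11 (En t true 3) E5)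
    (s3 : Row W ℓ 1 11 (Sn t true 1) S3) (s4 : Row W ℓ 1 11 (Sn t true 2) S4) (s5 : Row W ℓ 1 11 (Sn t true 3) S5) :
    Tab W ℓ 12 (Cup t false) (fN W N E3 E4 E5 S3 S4 S5) := by
  intro g h hg hh hs
  refine (hN g h hg hh hs).or (.or (.or ?_ ?_) (.or ?_ ?_))
  · refine ((e5 g hg (by omega)).and (Ok.rm hℓ (g+h))).mono ?_
    rintro a ⟨⟨-, b, hb, hb', -, c, hc, hc', -, d, hd, hd', -⟩, hr⟩
    refine ⟨by omega, Bool.eq_false_iff.2 fun H => ?_⟩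
    rw [show b + (a - b) = a by omega] at hc'; rw [show c + (b - c) = b by omega] at hd'
    exact C.cup6 d c b a (a+g) (a+g+h) (by omega) (by omega) (by omega) (by omega) (by omega) (by omega) hd' hc' hb' H
  · refine ((e4 g hg (by omega)).and ((s3 h hh (by omega)).sR g)).mono ?_
    rintro a ⟨⟨-, b, hb, hb', -, c, hc, hc', -⟩, k, hk, hk1, hk2, -⟩
    refine ⟨by omega, Bool.eq_false_iff.2 fun H => ?_⟩
    rw [show b + (a - b) = a by omega] at hc'
    exact C.cup6 c b a (a+g) (a+g+h) (a+g+h+k) (by omega) (by omega) (by omega) (by omega) (by omega) (by omega) hc' hb' H hk2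
  · refine ((e3 g hg (by omega)).and ((s4 h hh (by omega)).sR g)).mono ?_
    rintro a ⟨⟨-, b, hb, hb', -⟩, k, hk, hk1, hk2, m, hm, hm1, hm2, -⟩
    refine ⟨by omega, Bool.eq_false_iff.2 fun H => ?_⟩
    exact C.cup6 b a (a+g) (a+g+h) (a+g+h+k) (a+g+h+k+m) (by omega) (by omega) (by omega) (by omega) (by omega) (by omega) hb' H hk2 hm2
  · refine ((s5 h hh (by omega)).sR g).mono ?_
    rintro a ⟨k, hk, hk1, hk2, m, hm, hm1, hm2, n, hn, hn1, hn2, -⟩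
    refine ⟨by omega, Bool.eq_false_iff.2 fun H => ?_⟩
    exact C.cup6 a (a+g) (a+g+h) (a+g+h+k) (a+g+h+k+m) (a+g+h+k+m+n) (by omega) (by omega) (by omega) (by omega) (by omega) (by omega) H hk2 hm2 hn2
theorem tab_fP {E3 E4 S3 S4 : Nat → Nat} (C : Cls t) (hℓ : ℓ < W) (hP : Tab W ℓ 12 (Cup t true) P)
    (e3 : Row W ℓ 1 11 (En t false 1) E3) (e4 : Row W ℓ 1 11 (En t false 2) E4)
    (s3 : Row W ℓ 1 11 (Sn t false 1) S3) (s4 : Row W ℓ 1 11 (Sn t false 2) S4) :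
    Tab W ℓ 12 (Cup t true) (fP W P E3 E4 S3 S4) := by
  intro g h hg hh hs
  refine (hP g h hg hh hs).or (.or ?_ (.or ?_ ?_))
  · refine ((e4 g hg (by omega)).and (Ok.rm hℓ (g+h))).mono ?_
    rintro a ⟨⟨-, b, hb, hb', -, c, hc, hc', -⟩, hr⟩
    refine ⟨by omega, of_not_not fun H => ?_⟩
    rw [Bool.not_eq_true] at H
    rw [show b + (a - b) = a by omega] at hc'
    exact C.cap5 c b a (a+g) (a+g+h) (by omega) (by omega) (by omega) (by omega) (by omega) hc' hb' H
  · refine ((e3 g hg (by omega)).and ((s3 h hh (by omega)).sR g)).mono ?_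
    rintro a ⟨⟨-, b, hb, hb', -⟩, k, hk, hk1, hk2, -⟩
    refine ⟨by omega, of_not_not fun H => ?_⟩
    rw [Bool.not_eq_true] at H
    exact C.cap5 b a (a+g) (a+g+h) (a+g+h+k) (by omega) (by omega) (by omega) (by omega) (by omega) hb' H hk2
  · refine ((s4 h hh (by omega)).sR g).mono ?_
    rintro a ⟨k, hk, hk1, hk2, m, hm, hm1, hm2, -⟩
    refine ⟨by omega, of_not_not fun H => ?_⟩
    rw [Bool.not_eq_true] at H
    exact C.cap5 a (a+g) (a+g+h) (a+g+h+k) (a+g+h+k+m) (by omega) (by omega) (by omega) (by omega) (by omega) H hk2 hm2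

theorem row1_at {f : Nat → Nat} {r l : List Nat} {o : Nat} (h : drp o l = rowT f 11 1 r) {i : Nat} (h1 : 1 ≤ i) (h2 : i ≤ 11) :
    row1 l o i = f i := by
  rw [row1, h, nth_rowT _ _ _ _ _ (by omega)]; congr 1; omega
theorem Row.row1 {Φ} {f : Nat → Nat} {r l : List Nat} {o : Nat} (H : Row W ℓ 1 11 Φ f) (h : drp o l = rowT f 11 1 r) :
    Row W ℓ 1 11 Φ (row1 l o) := by
  intro i h1 h2; rw [row1_at h h1 h2]; exact H i h1 h2
theorem Stt.E {l} (C : Cls t) (hℓ : ℓ < W) (h : Stt W ℓ t l) : Stt W ℓ t (spEc W (spEd W (spEb W (spEa W l)))) := by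
  have dr (f : Nat → Nat) (o : Nat) (r : List Nat) : drp (11 + o) (rowT f 11 1 r) = drp o r := by rw [drp_add, drp_rowT]
  have a0 := row_c3E hℓ h.p
  have a1 := row_c3S h.p
  have a2 := row_c3E hℓ h.n
  have a3 := row_c3S h.n
  generalize hA : spEa W l = A
  have A44 : drp 44 A = l := by subst hA; rw [spEa, dr _ 33, dr _ 22, dr _ 11, dr _ 0, drp_z]
  have A0 := a0.row1 (l := A) (o := 0) (by rw [← hA, spEa, drp_z])
  have A1 := a1.row1 (l := A) (o := 11) (by rw [← hA, spEa, dr _ 0, drp_z])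
  have A2 := a2.row1 (l := A) (o := 22) (by rw [← hA, spEa, dr _ 11, dr _ 0, drp_z])
  have A3 := a3.row1 (l := A) (o := 33) (by rw [← hA, spEa, dr _ 22, dr _ 11, dr _ 0, drp_z])
  have b0 := row_cE hℓ h.p A0
  have b1 := row_cS h.p A1
  have b2 := row_cE hℓ h.n A2
  have b3 := row_cS h.n A3
  generalize hB : spEb W A = B
  rw [spEb, A44] at hB
  have B44 : drp 44 B = A := by rw [← hB, dr _ 33, dr _ 22, dr _ 11, dr _ 0, drp_z]
  have B88 : drp 88 B = l := by rw [show 88 = 44 + 44 from rfl, drp_add, B44, A44]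
  have B0 := b0.row1 (l := B) (o := 0) (by rw [← hB, drp_z])
  have B1 := b1.row1 (l := B) (o := 11) (by rw [← hB, dr _ 0, drp_z])
  have B2 := b2.row1 (l := B) (o := 22) (by rw [← hB, dr _ 11, dr _ 0, drp_z])
  have B3 := b3.row1 (l := B) (o := 33) (by rw [← hB, dr _ 22, dr _ 11, dr _ 0, drp_z])
  have d0 := row_cE hℓ h.p B0
  have d1 := row_cS h.p B1
  generalize hD : spEd W B = D
  rw [spEd, B88] at hD
  have D22 : drp 22 D = B := by rw [← hD, dr _ 11, dr _ 0, drp_z]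
  have Dx (o : Nat) : drp (22 + o) D = drp o B := by rw [drp_add, D22]
  have Bx (o : Nat) : drp (44 + o) B = drp o A := by rw [drp_add, B44]
  have D0 := d0.row1 (l := D) (o := 0) (by rw [← hD, drp_z])
  have D1 := d1.row1 (l := D) (o := 11) (by rw [← hD, dr _ 0, drp_z])
  have D2 := b0.row1 (l := D) (o := 22) (by rw [Dx 0, ← hB, drp_z])
  have D3 := b1.row1 (l := D) (o := 33) (by rw [Dx 11, ← hB, dr _ 0, drp_z])
  have D4 := b2.row1 (l := D) (o := 44) (by rw [Dx 22, ← hB, dr _ 11, dr _ 0, drp_z])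
  have D5 := b3.row1 (l := D) (o := 55) (by rw [Dx 33, ← hB, dr _ 22, dr _ 11, dr _ 0, drp_z])
  have D6 := a0.row1 (l := D) (o := 66) (by rw [Dx 44, Bx 0, ← hA, spEa, drp_z])
  have D7 := a1.row1 (l := D) (o := 77) (by rw [Dx 55, Bx 11, ← hA, spEa, dr _ 0, drp_z])
  have D8 := a2.row1 (l := D) (o := 88) (by rw [Dx 66, Bx 22, ← hA, spEa, dr _ 11, dr _ 0, drp_z])
  have D9 := a3.row1 (l := D) (o := 99) (by rw [Dx 77, Bx 33, ← hA, spEa, dr _ 22, dr _ 11, dr _ 0, drp_z])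
  have D110 : drp 110 D = l := by rw [Dx 88, Bx 44, A44]
  have D242 : drp 242 D = drp 132 l := by rw [show 242 = 110 + 132 from rfl, drp_add, D110]
  rw [spEc, D110, D242]
  exact Stt.mk' (by rw [drp_len, h.len]) (tab_fP C hℓ h.p D8 D4 D9 D5) (tab_fN C hℓ h.n D6 D2 D0 D7 D3 D1)
    (by rw [nth_drp]; exact h.f) (by rw [nth_drp]; exact h.a) (by rw [nth_drp]; exact h.al)
end
end K6

namespace K6
section
variable {W ℓ : Nat} {t : Nat → Nat → Nat → Bool} {P N : Nat → Nat → Nat}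
/-- chain of four points `a, x, a+s, a+s+k` -/
def Q4 (t : Nat → Nat → Nat → Bool) (v : Bool) (s k a : Nat) : Prop :=
  a + s + k ≤ 15 ∧ ∃ x, a < x ∧ x < a + s ∧ t a x (a + s) = v ∧ t x (a + s) (a + s + k) = v
def D4 (t : Nat → Nat → Nat → Bool) (v : Bool) (D a : Nat) : Prop :=
  a + D ≤ 15 ∧ ∃ x y, a < x ∧ x < y ∧ y < a + D ∧ t a x y = v ∧ t x y (a + D) = v
def D3 (t : Nat → Nat → Nat → Bool) (v : Bool) (D a : Nat) : Prop :=
  a + D ≤ 15 ∧ ∃ x, a < x ∧ x < a + D ∧ t a x (a + D) = v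
def D5 (t : Nat → Nat → Nat → Bool) (v : Bool) (D a : Nat) : Prop :=
  a + D ≤ 15 ∧ ∃ x y z, a < x ∧ x < y ∧ y < z ∧ z < a + D ∧ t a x y = v ∧ t x y z = v ∧ t y z (a + D) = v
def UF (t : Nat → Nat → Nat → Bool) (s k a : Nat) : Prop :=
  a + s + k ≤ 15 ∧ ∀ x, a < x → x < a + s → t a x (a + s) = true → t x (a + s) (a + s + k) = true → False
theorem ok_q4 {v} (hP : Tab W ℓ 12 (Cup t v) P) {s k : Nat} (hs : 2 ≤ s) (hk : 1 ≤ k) (hsk : s + k ≤ 12) :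
    Ok W ℓ (Q4 t v s k) (q4 W P s k) := by
  refine Ok.orU fun i hi => ((hP (i+1) (s-(i+1)) (by omega) (by omega) (by omega)).and
    ((hP (s-(i+1)) k (by omega) (by omega) (by omega)).sR (i+1))).mono ?_
  rintro a ⟨h1, h2⟩
  have h1 := h1.at (a+(i+1)) (a+s) (by omega) (by omega)
  have h2 := h2.at (a+s) (a+s+k) (by omega) (by omega)
  exact ⟨h2.1, a+(i+1), by omega, by omega, h1.2, h2.2⟩
theorem row_dO {v} (hP : Tab W ℓ 12 (Cup t v) P) : Row W ℓ 3 11 (D4 t v) (dO W P) := by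
  intro D h1 h2
  refine Ok.orU fun i hi => (ok_q4 hP (s := i+2) (k := D-(i+2)) (by omega) (by omega) (by omega)).mono ?_
  rintro a ⟨h3, x, h4, h5, h6, h7⟩
  rw [show a + (i+2) + (D - (i+2)) = a + D by omega] at h7
  exact ⟨by omega, x, a+(i+2), h4, h5, by omega, h6, h7⟩
theorem row_dNI {v} (hP : Tab W ℓ 12 (Cup t v) P) : Row W ℓ 2 12 (D3 t v) (dNI P) := by
  intro D h1 h2
  refine Ok.orU fun i hi => (hP (i+1) (D-(i+1)) (by omega) (by omega) (by omega)).mono ?_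
  intro a h3
  have h3 := h3.at (a+(i+1)) (a+D) (by omega) (by omega)
  exact ⟨h3.1, a+(i+1), by omega, by omega, h3.2⟩
def Tab4 (W ℓ : Nat) (Φ : Nat → Nat → Nat → Prop) (u : Nat → Nat → Nat) : Prop :=
  ∀ s k, 2 ≤ s → 1 ≤ k → s + k ≤ 11 → Ok W ℓ (Φ s k) (u s k)
theorem row_dU {v u} (hu : Tab4 W ℓ (Q4 t v) u) : Row W ℓ 3 11 (D4 t v) (dU u) := by
  intro D h1 h2
  refine Ok.orU fun i hi => (hu (i+2) (D-(i+2)) (by omega) (by omega) (by omega)).mono ?_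
  rintro a ⟨h3, x, h4, h5, h6, h7⟩
  rw [show a + (i+2) + (D - (i+2)) = a + D by omega] at h7
  exact ⟨by omega, x, a+(i+2), h4, h5, by omega, h6, h7⟩
theorem row_dV {v u} (hP : Tab W ℓ 12 (Cup t v) P) (hu : Tab4 W ℓ (Q4 t v) u) : Row W ℓ 4 12 (D5 t v) (dV W P u) := by
  intro D h1 h2
  refine Ok.orU fun i hi => Ok.orU fun j hj => ((hu (i+2) (j+1) (by omega) (by omega) (by omega)).and
    ((hP (j+1) (D-(i+2)-(j+1)) (by omega) (by omega) (by omega)).sR (i+2))).mono ?_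
  rintro a ⟨⟨h3, x, h4, h5, h6, h7⟩, h8⟩
  have h8 := h8.at (a+(i+2)+(j+1)) (a+D) (by omega) (by omega)
  exact ⟨by omega, x, a+(i+2), a+(i+2)+(j+1), h4, h5, by omega, by omega, h6, h7, h8.2⟩
theorem tab_duf {O NI : Nat → Nat} (C : Cls t) (hP : Tab W ℓ 12 (Cup t true) P) (hO : Row W ℓ 3 11 (D4 t false) O)
    (hN : Row W ℓ 2 12 (D3 t false) NI) : Tab4 W ℓ (UF t) (duf W P O NI) := by
  intro s k hs hk hsk
  refine Ok.orA ((hO (s+k) (by omega) (by omega)).mono ?_) fun i hi =>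
    (((hP k (i+1) (by omega) (by omega) (by omega)).sR s).and (hN (s+k+(i+1)) (by omega) (by omega))).mono ?_
  · rintro a ⟨h1, x, y, h2, h3, h4, h5, h6⟩
    rw [← Nat.add_assoc] at h6
    refine ⟨by omega, fun z h7 h8 h9 h10 => C.c44 a x y z (a+s) (a+s+k) h2 h3 (by omega) h7 h8 (by omega) (by omega) h5 h6 h9 h10⟩
  · rintro a ⟨h0, h1, x, h2, h3, h4⟩
    have h0 := h0.at (a+s+k) (a+(s+k+(i+1))) (by omega) (by omega)
    exact ⟨by omega, fun z h7 h8 h9 h10 => C.c53 a z (a+s) (a+s+k) x (a+(s+k+(i+1))) h7 h8 (by omega) (by omega) h2 h3 h0.1 h9 h10 h0.2 h4⟩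
theorem tab_fAN {u uf : Nat → Nat → Nat} {NI : Nat → Nat} (C : Cls t) (hℓ : ℓ < W) (hP : Tab W ℓ 12 (Cup t true) P)
    (hN : Tab W ℓ 12 (Cup t false) N) (hu : Tab4 W ℓ (Q4 t true) u) (huf : Tab4 W ℓ (UF t) uf)
    (hNI : Row W ℓ 2 12 (D3 t false) NI) : Tab W ℓ 12 (Cup t false) (fAN W P N u uf NI) := by
  intro x y hx hy hs
  refine Ok.orA (Ok.orA (Ok.orA (hN x y hx hy hs) fun i hi => ?_) fun i hi => ?_) fun i hi => ?_
  · refine (((hu (i+2) x (by omega) (by omega) (by omega)).and (hNI (i+2+(x+y)) (by omega) (by omega))).sL hℓ (i+2)).mono ?_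
    rintro p ⟨hp, ⟨h1, b, h2, h3, h4, h5⟩, h6, c, h7, h8, h9⟩
    rw [show p - (i+2) + (i+2) = p by omega] at h3 h4 h5
    rw [show p - (i+2) + (i+2+(x+y)) = p+x+y by omega] at h6 h8 h9
    exact ⟨h6, Bool.eq_false_iff.2 fun H => C.c53 (p-(i+2)) b p (p+x) c (p+x+y) h2 h3 (by omega) (by omega) h7 h8 h6 h4 h5 H h9⟩
  · refine (((hP y (i+1) (by omega) (by omega) (by omega)).sR x).and (huf (x+y) (i+1) (by omega) (by omega) (by omega))).mono ?_
    rintro p ⟨h1, h2, h3⟩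
    have h1 := h1.at (p+x+y) (p+x+y+(i+1)) rfl rfl
    rw [← Nat.add_assoc p x y] at h3
    exact ⟨by omega, Bool.eq_false_iff.2 fun H => h3 (p+x) (by omega) (by omega) H h1.2⟩
  · refine (((hP (i+1) x (by omega) (by omega) (by omega)).and (huf (i+1+x) y (by omega) (by omega) (by omega))).sL hℓ (i+1)).mono ?_
    rintro p ⟨hp, h1, h2, h3⟩
    have h1 := h1.at p (p+x) (by omega) rfl
    rw [show p - (i+1) + (i+1+x) = p + x by omega] at h2 h3
    exact ⟨h2, Bool.eq_false_iff.2 fun H => h3 p (by omega) (by omega) h1.2 H⟩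
theorem tab_fAP {U V : Nat → Nat} (C : Cls t) (hℓ : ℓ < W) (hP : Tab W ℓ 12 (Cup t true) P)
    (hN : Tab W ℓ 12 (Cup t false) N) (hU : Row W ℓ 3 11 (D4 t true) U) (hV : Row W ℓ 4 12 (D5 t true) V) :
    Tab W ℓ 12 (Cup t true) (fAP W P N U V) := by
  intro x y hx hy hs
  refine Ok.orA (Ok.orA (Ok.orA (hP x y hx hy hs) fun i hi => ?_) fun i hi => ?_) fun i hi => ?_
  · have hi : i < x + y - 3 := lt_of_lt_mul (lt_of_lt_of_le hi (Nat.sub_le _ _)) (by omega)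
    refine (hV (x+y) (by omega) (by omega)).mono ?_
    rintro a ⟨h1, b, c, d, h2, h3, h4, h5, h6, h7, h8⟩
    rw [← Nat.add_assoc a x y] at h1 h5 h8
    exact ⟨h1, of_not_not fun H => C.c53 a b c d (a+x) (a+x+y) h2 h3 h4 h5 (by omega) (by omega) h1 h6 h7 h8 (by simpa using H)⟩
  · refine (((hN y (i+1) (by omega) (by omega) (by omega)).sR x).and (hU (x+y+(i+1)) (by omega) (by omega))).mono ?_
    rintro p ⟨h1, h2, b, c, h3, h4, h5, h6, h7⟩
    have h1 := h1.at (p+x+y) (p+(x+y+(i+1))) rfl (by omega)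
    exact ⟨by omega, of_not_not fun H => C.c44 p (p+x) (p+x+y) b c _ (by omega) (by omega) (by omega) h3 h4 h5 h2 (by simpa using H) h1.2 h6 h7⟩
  · refine (((hN (i+1) x (by omega) (by omega) (by omega)).and (hU (i+1+(x+y)) (by omega) (by omega))).sL hℓ (i+1)).mono ?_
    rintro p ⟨hp, h1, h2, b, c, h3, h4, h5, h6, h7⟩
    have h1 := h1.at p (p+x) (by omega) rfl
    rw [show p - (i+1) + (i+1+(x+y)) = p+x+y by omega] at h2 h5 h7
    exact ⟨h2, of_not_not fun H => C.c44 (p-(i+1)) p (p+x) b c _ (by omega) (by omega) (by omega) h3 h4 h5 h2 h1.2 (by simpa using H) h6 h7⟩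
theorem Row.nth {Φ} {f : Nat → Nat} {r l : List Nat} {o n lo hi : Nat} (H : Row W ℓ lo hi Φ f) (h : drp o l = rowT f n lo r) (hn : hi + 1 = lo + n) :
    Row W ℓ lo hi Φ (fun D => nth (D - lo) (drp o l)) := by
  intro i h1 h2
  show Ok W ℓ (Φ i) (K6.nth (i - lo) (drp o l))
  rw [h, nth_rowT _ _ _ _ _ (by omega), show lo + (i - lo) = i by omega]; exact H i h1 h2
theorem Tab4.ru {Φ} {f : Nat → Nat → Nat} {l r : List Nat} (H : Tab4 W ℓ Φ f) (h : l = tabT (fun i k => f (i+1) k) 9 1 r) :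
    Tab4 W ℓ Φ (ru l) := by
  intro s k hs hk hsk
  rw [K6.ru, h, rdT_tabT _ _ _ _ _ _ (by omega) hk (by omega), show 1 + (s - 1 - 1) + 1 = s by omega]; exact H s k hs hk hsk
theorem Stt.A {l} (C : Cls t) (hℓ : ℓ < W) (h : Stt W ℓ t l) : Stt W ℓ t (spAc W (spAb W (spAa W l))) := by
  have dt (f : Nat → Nat → Nat) (o : Nat) (r : List Nat) : drp (45 + o) (tabT f 9 1 r) = drp o r := by
    rw [drp_add, show 45 = tri 9 from rfl, drp_tabT]
  have dr (f : Nat → Nat) (n s o : Nat) (r : List Nat) : drp (n + o) (rowT f n s r) = drp o r := by rw [drp_add, drp_rowT]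
  have u4 : Tab4 W ℓ (Q4 t true) (q4 W (rP l)) := fun s k hs hk hsk => ok_q4 h.p hs hk (by omega)
  have o4 := row_dO h.n
  have ni := row_dNI h.n
  generalize hA : spAa W l = A
  rw [spAa] at hA
  have uA := u4.ru (l := A) hA.symm
  have A45 : drp 45 A = rowT (dO W (rN l)) 9 3 (rowT (dNI (rN l)) 11 2 l) := by rw [← hA, dt _ 0, drp_z]
  have A54 : drp 54 A = (rowT (dNI (rN l)) 11 2 l) := by rw [← hA, dt _ 9, dr _ 9 _ 0, drp_z]
  have A65 : drp 65 A = l := by rw [← hA, dt _ 20, dr _ 9 _ 11, dr _ 11 _ 0, drp_z]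
  have uf := tab_duf C h.p (o4.nth A45 rfl) (ni.nth A54 rfl)
  have U := row_dU uA
  have V := row_dV h.p uA
  generalize hB : spAb W A = B
  rw [spAb, A65] at hB
  have ufB := uf.ru (l := B) hB.symm
  have B63 : drp 63 B = tabT (fun i k => ru A (i + 1) k) 9 1 (drp 45 A) := by
    rw [← hB, dt _ 18, dr _ 9 _ 9, dr _ 9 _ 0, drp_z]
  have B54 : drp 54 B = rowT (dV W (rP l) (ru A)) 9 4 (drp 63 B) := by rw [B63, ← hB, dt _ 9, dr _ 9 _ 0, drp_z]
  have B45 : drp 45 B = rowT (dU (ru A)) 9 3 (drp 54 B) := by rw [B54, B63, ← hB, dt _ 0, drp_z]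
  have B108 : drp 108 B = drp 45 A := by rw [← hB, dt _ 63, dr _ 9 _ 54, dr _ 9 _ 45, dt _ 0, drp_z]
  have B117 : drp 117 B = drp 54 A := by
    rw [show 117 = 108 + 9 from rfl, drp_add, B108, ← drp_add]
  have B128 : drp 128 B = l := by rw [show 128 = 108 + 20 from rfl, drp_add, B108, ← drp_add, A65]
  have B260 : nth 260 B = nth 132 l := by rw [show 260 = 128 + 132 from rfl, ← nth_drp, B128]
  have B261 : drp 261 B = drp 133 l := by rw [show 261 = 128 + 133 from rfl, drp_add, B128]
  have UB := U.nth B45 rfl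
  have VB := V.nth B54 rfl
  have uB := uA.ru B63
  have niB := ni.nth (B117.trans A54) rfl
  have oB := o4.nth (B108.trans A45) rfl
  rw [spAc, B128, B260, B261]
  refine Stt.mk' (by rw [List.length_cons, drp_len, h.len]) (tab_fAP C hℓ h.p h.n UB VB) (tab_fAN C hℓ h.p h.n uB ufB niB) ?_ ?_ ?_
  · refine Ok.orA h.f fun i hi => ?_
    have h1 := UB (i+3) (by omega) (by omega)
    have h2 := oB (i+3) (by omega) (by omega)
    refine (h1.and h2).mono ?_
    rintro a ⟨⟨h3, b, c, h4, h5, h6, h7, h8⟩, -, b', c', h4', h5', h6', h7', h8'⟩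
    exact C.c44 a b' c' b c _ h4' h5' h6' h4 h5 h6 h3 h7' h8' h7 h8
  · rw [nth_s, tl_c, nth_drp]; exact h.a
  · rw [nth_s, tl_c, nth_drp]; exact h.al
theorem app_pass (k : Arr 134) (l : List Nat) (hl : l.length = 134) :
    app 134 (pass W k) l = app 134 k (spAc W (spAb W (spAa W (spEc W (spEd W (spEb W (spEa W (spS2 W (spS1 W l))))))))) := by
  have t12 (a b r) : (tabT a 11 1 (tabT b 11 1 r)).length = 132 + r.length := by
    rw [tabT_len, tabT_len, show tri 11 = 66 from rfl]; omega
  unfold pass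
  rw [uS1.2, uS2.2, uEa.2, uEb.2, uEd.2, uEc.2, uAa.2, uAb.2, uAc.2]
  beta_reduce
  have l1 : (spS1 W l).length = 134 := by rw [spS1, t12, drp_len, hl]
  rw [app_lam' _ hl]; generalize spS1 W l = l at *
  have l2 : (spS2 W l).length = 134 := by rw [spS2, t12, drp_len, l1]
  rw [app_lam' _ l1]; generalize spS2 W l = l at *
  have l3 : (spEa W l).length = 178 := by simp only [spEa, rowT_len, l2]
  rw [app_lam' _ l2]; generalize spEa W l = l at *
  have l4 : (spEb W l).length = 222 := by simp only [spEb, rowT_len, l3]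
  rw [app_lam' _ l3]; generalize spEb W l = l at *
  have l5 : (spEd W l).length = 244 := by simp only [spEd, rowT_len, l4]
  rw [app_lam' _ l4]; generalize spEd W l = l at *
  have l6 : (spEc W l).length = 134 := by rw [spEc, t12, drp_len, l5]
  rw [app_lam' _ l5]; generalize spEc W l = l at *
  have l7 : (spAa W l).length = 199 := by simp only [spAa, tabT_len, rowT_len, l6]; rfl
  rw [app_lam' _ l6]; generalize spAa W l = l at *
  have l8 : (spAb W l).length = 262 := by simp only [spAb, tabT_len, rowT_len, drp_len, l7]; rfl
  rw [app_lam' _ l7]; generalize spAb W l = l at *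
  rw [app_lam' _ l8]
/-- a state containing a lane consistent with `t` -/
def Good (W : Nat) (t : Nat → Nat → Nat → Bool) (l : List Nat) : Prop := ∃ ℓ, ℓ < W ∧ Stt W ℓ t l
def Bad (W : Nat) (t : Nat → Nat → Nat → Bool) (k : Arr 134) : Prop := ∀ l, Good W t l → app 134 k l = false
theorem bad_pass (C : Cls t) (k : Arr 134) (hk : Bad W t k) : Bad W t (pass W k) := by
  rintro l ⟨ℓ, hℓ, h⟩
  rw [app_pass k l h.len]
  exact hk _ ⟨ℓ, hℓ, ((((h.S1 C).S2 C).E C hℓ).A C hℓ)⟩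
end
end K6

namespace K6
theorem tb_land (x y i : Nat) : (Nat.land x y).testBit i = (x.testBit i && y.testBit i) := Nat.testBit_and x y i
theorem tb_lor (x y i : Nat) : (Nat.lor x y).testBit i = (x.testBit i || y.testBit i) := Nat.testBit_or x y i
theorem tb_xor (x y i : Nat) : (Nat.xor x y).testBit i = (x.testBit i ^^ y.testBit i) := Nat.testBit_xor x y i
theorem tb_shl (x s i : Nat) : (Nat.shiftLeft x s).testBit i = (decide (s ≤ i) && x.testBit (i - s)) :=
  Nat.testBit_shiftLeft x
theorem tb_shr (x s i : Nat) : (Nat.shiftRight x s).testBit i = x.testBit (s + i) := Nat.testBit_shiftRight x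
def Bd (W x : Nat) : Prop := ∀ i, x.testBit i = true → i < W
theorem Bd.lt {W x : Nat} (h : Bd W x) : x < 2 ^ W := Nat.lt_pow_two_of_testBit x fun i hi => by
  by_contra hc
  have := h i (by simpa using hc)
  omega
theorem bd_of_lt {W x : Nat} (h : x < 2 ^ W) : Bd W x := by
  intro i hi
  by_contra hc
  have h2 : x < 2 ^ i := lt_of_lt_of_le h (Nat.pow_le_pow_right (by omega) (by omega))
  rw [Nat.testBit_lt_two_pow h2] at hi
  cases hi
theorem lane_eq {W a b e f : Nat} (he : e < W) (hf : f < W) (h : a * W + e = b * W + f) : a = b ∧ e = f := by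
  have h1 : (a * W + e) / W = (b * W + f) / W := by rw [h]
  have hW : 0 < W := by omega
  rw [Nat.mul_comm a, Nat.mul_comm b, Nat.mul_add_div hW, Nat.mul_add_div hW, Nat.div_eq_of_lt he, Nat.div_eq_of_lt hf] at h1
  have h2 : a = b := by omega
  subst h2
  exact ⟨rfl, by omega⟩
theorem rep_bit {W m : Nat} (hm : Bd W m) (n a e : Nat) (he : e < W) :
    (rep W m n).testBit (a * W + e) = true ↔ (a ≤ n ∧ m.testBit e = true) := by
  induction n generalizing a with
  | zero =>
    rw [rep_z]
    constructor
    · intro h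
      have := hm _ h
      have h2 : a = 0 := by
        by_contra hc
        have : 1 * W ≤ a * W := Nat.mul_le_mul_right _ (by omega)
        omega
      subst h2
      simpa using h
    · rintro ⟨h1, h2⟩
      obtain rfl : a = 0 := by omega
      simpa using h2
  | succ n ih =>
    rw [rep_s, tb_lor, tb_shl, Bool.or_eq_true, Bool.and_eq_true, decide_eq_true_eq]
    cases a with
    | zero =>
      constructor
      · rintro (h | h)
        · exact ⟨by omega, by simpa using h⟩
        · omega
      · rintro ⟨h1, h2⟩; left; simpa using h2
    | succ a =>
      have h3 : (a + 1) * W = a * W + W := by ring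
      have h4 : (a + 1) * W + e - W = a * W + e := by omega
      rw [h4, ih]
      constructor
      · rintro (h | h)
        · have := hm _ h; omega
        · exact ⟨by omega, h.2.2⟩
      · rintro ⟨h1, h2⟩; right; exact ⟨by omega, by omega, h2⟩

/-- contents of the lanes `e` and `f` agree -/
def Same (W : Nat) (P : Nat → Nat → Nat) (e f : Nat) : Prop :=
  ∀ g h, 1 ≤ g → 1 ≤ h → g + h ≤ 12 → ∀ a, (P g h).testBit (a * W + e) = (P g h).testBit (a * W + f)
def Emp (W : Nat) (P : Nat → Nat → Nat) (e : Nat) : Prop :=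
  ∀ g h, 1 ≤ g → 1 ≤ h → g + h ≤ 12 → ∀ a, (P g h).testBit (a * W + e) = false
structure Inv (W ℓ : Nat) (t : Nat → Nat → Nat → Bool) (P N : Nat → Nat → Nat) (al want free orig cp : Nat) : Prop where
  bal : Bd W al
  bf : Bd W free
  bo : Bd W orig
  bc : Bd W cp
  bw : Bd W want
  fw : ∀ e, free.testBit e = true → want.testBit e = false
  fo : ∀ e, free.testBit e = true → orig.testBit e = false
  fc : ∀ e, free.testBit e = true → cp.testBit e = false
  fP : ∀ e, free.testBit e = true → Emp W P e
  fN : ∀ e, free.testBit e = true → Emp W N e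
  cw : ∀ e, cp.testBit e = true → want.testBit e = false
  hℓ : ℓ < W
  la : al.testBit ℓ = true
  lf : free.testBit ℓ = false
  lp : Tab W ℓ 12 (Cup t true) P
  ln : Tab W ℓ 12 (Cup t false) N
  lc : cp.testBit ℓ = false
  pair : orig.testBit ℓ = false ∨ (orig.testBit ℓ = true ∧ ∃ d, d < W ∧ al.testBit d = true ∧ cp.testBit d = true ∧
    orig.testBit d = false ∧ free.testBit d = false ∧ Same W P ℓ d ∧ Same W N ℓ d)
def Eqv (P P' : Nat → Nat → Nat) : Prop := ∀ g h, 1 ≤ g → 1 ≤ h → g + h ≤ 12 → P g h = P' g h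
section
variable {W ℓ : Nat} {t : Nat → Nat → Nat → Bool} {P N P' N' : Nat → Nat → Nat} {al want free orig cp : Nat}
theorem Same.ext {e f} (h : Same W P e f) (E : Eqv P P') : Same W P' e f := fun g k h1 h2 h3 a => by
  rw [← E g k h1 h2 h3]; exact h g k h1 h2 h3 a
theorem Emp.ext {e} (h : Emp W P e) (E : Eqv P P') : Emp W P' e := fun g k h1 h2 h3 a => by
  rw [← E g k h1 h2 h3]; exact h g k h1 h2 h3 a
theorem Tab.ext {Φ} (h : Tab W ℓ 12 Φ P) (E : Eqv P P') : Tab W ℓ 12 Φ P' := fun g k h1 h2 h3 => by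
  rw [← E g k h1 h2 h3]; exact h g k h1 h2 h3
theorem Inv.ext (h : Inv W ℓ t P N al want free orig cp) (E : Eqv P P') (E' : Eqv N N') :
    Inv W ℓ t P' N' al want free orig cp :=
  { h with
    fP := fun e he => (h.fP e he).ext E
    fN := fun e he => (h.fN e he).ext E'
    lp := h.lp.ext E
    ln := h.ln.ext E'
    pair := h.pair.imp id fun ⟨h1, d, h2, h3, h4, h5, h6, h7, h8⟩ => ⟨h1, d, h2, h3, h4, h5, h6, h7.ext E, h8.ext E'⟩ }
theorem Cup.le {v g h a} (hg : 1 ≤ g) (hh : 1 ≤ h) (H : Cup t v g h a) : a ≤ 13 := by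
  have := H.1; omega

/-- properties of one copying step: lanes of `m` are copied to the lanes `dd` -/
structure Shf (W : Nat) (sh : Nat → Nat) (m dd : Nat) (pr : Nat → Nat → Prop) : Prop where
  inj : ∀ a b e, pr a e → pr b e → a = b
  fn : ∀ a e f, pr a e → pr a f → e = f
  dd : ∀ e, dd.testBit e = true ↔ ∃ μ, pr μ e ∧ m.testBit μ = true
  sh : ∀ x a e, e < W → ((sh (Nat.land x (rep W m 13))).testBit (a * W + e) = true ↔
    ∃ μ, μ < W ∧ pr μ e ∧ m.testBit μ = true ∧ a ≤ 13 ∧ x.testBit (a * W + μ) = true)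
  ex : ∀ μ, m.testBit μ = true → ∃ e, pr μ e
theorem Shf.keep {sh m dd pr} (S : Shf W sh m dd pr) {e : Nat} (he : e < W) (hd : dd.testBit e = false) (Q : Nat → Nat → Nat)
    (g h a : Nat) : (cpy sh (rep W m 13) Q g h).testBit (a * W + e) = (Q g h).testBit (a * W + e) := by
  rw [cpy, tb_lor]
  have : (sh (Nat.land (Q g h) (rep W m 13))).testBit (a * W + e) = false := by
    rw [Bool.eq_false_iff]
    intro h1
    obtain ⟨μ, -, h2, h3, -⟩ := (S.sh _ _ _ he).1 h1
    rw [Bool.eq_false_iff] at hd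
    exact hd ((S.dd e).2 ⟨μ, h2, h3⟩)
  rw [this, Bool.or_false]
theorem Shf.tab {sh m dd pr} (S : Shf W sh m dd pr) {e : Nat} (he : e < W) (hd : dd.testBit e = false) {Q : Nat → Nat → Nat} {Φ}
    (H : Tab W e 12 Φ Q) : Tab W e 12 Φ (cpy sh (rep W m 13) Q) := by
  intro g h h1 h2 h3 a ha
  rw [S.keep he hd] at ha
  exact H g h h1 h2 h3 a ha
theorem Shf.emp {sh m dd pr} (S : Shf W sh m dd pr) {e : Nat} (he : e < W) (hd : dd.testBit e = false) {Q : Nat → Nat → Nat}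
    (H : Emp W Q e) : Emp W (cpy sh (rep W m 13) Q) e := by
  intro g h h1 h2 h3 a
  rw [S.keep he hd]
  exact H g h h1 h2 h3 a
theorem Shf.same {sh m dd pr} (S : Shf W sh m dd pr) {e f : Nat} (he : e < W) (hf : f < W) (hd : dd.testBit e = false)
    (hd' : dd.testBit f = false) {Q : Nat → Nat → Nat}
    (H : Same W Q e f) : Same W (cpy sh (rep W m 13) Q) e f := by
  intro g h h1 h2 h3 a
  rw [S.keep he hd, S.keep hf hd']
  exact H g h h1 h2 h3 a
theorem Shf.new {sh m dd pr} (S : Shf W sh m dd pr) {e f : Nat} (he : e < W) (hf : f < W) (hd : dd.testBit e = false)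
    (hm : m.testBit e = true) (hp : pr e f) {Q : Nat → Nat → Nat} {v : Bool} (H : Emp W Q f) (hT : Tab W e 12 (Cup t v) Q) :
    Same W (cpy sh (rep W m 13) Q) e f := by
  intro g h h1 h2 h3 a
  rw [S.keep he hd, cpy, tb_lor, H g h h1 h2 h3, Bool.false_or, Bool.eq_iff_iff, S.sh _ _ _ hf]
  constructor
  · intro h4
    exact ⟨e, he, hp, hm, (hT g h h1 h2 h3 a h4).le h1 h2, h4⟩
  · rintro ⟨μ, -, h4, -, -, h5⟩
    rwa [← S.inj _ _ _ h4 hp]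
theorem bd_lor {x y} (h : Bd W x) (h' : Bd W y) : Bd W (Nat.lor x y) := by
  intro i hi
  rw [tb_lor, Bool.or_eq_true] at hi
  exact hi.elim (h i) (h' i)
theorem Inv.copy {sh m dd pr} (I : Inv W ℓ t P N al want free orig cp) (S : Shf W sh m dd pr)
    (hm : ∀ e, m.testBit e = true → want.testBit e = true) (hdd : ∀ e, dd.testBit e = true → free.testBit e = true) :
    Inv W ℓ t (cpy sh (rep W m 13) P) (cpy sh (rep W m 13) N) (Nat.lor al dd) (Nat.xor want m) (Nat.xor free dd)
      (Nat.lor orig m) (Nat.lor cp dd) := by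
  have xw : ∀ e, (Nat.xor want m).testBit e = true → want.testBit e = true ∧ m.testBit e = false := by
    intro e he; rw [tb_xor] at he; have := hm e; revert he this
    cases want.testBit e <;> cases m.testBit e <;> simp
  have xf : ∀ e, (Nat.xor free dd).testBit e = true → free.testBit e = true ∧ dd.testBit e = false := by
    intro e he; rw [tb_xor] at he; have := hdd e; revert he this
    cases free.testBit e <;> cases dd.testBit e <;> simp
  have nd : ∀ e, free.testBit e = false → dd.testBit e = false := by
    intro e he; have := hdd e; revert he this
    cases free.testBit e <;> cases dd.testBit e <;> simp
  have nm : ∀ e, want.testBit e = false → m.testBit e = false := by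
    intro e he; have := hm e; revert he this
    cases want.testBit e <;> cases m.testBit e <;> simp
  have nxf : ∀ e, free.testBit e = false → (Nat.xor free dd).testBit e = false := by
    intro e he; rw [tb_xor, he, nd e he]; rfl
  have bdd : Bd W dd := fun e he => I.bf e (hdd e he)
  have bm : Bd W m := fun e he => I.bw e (hm e he)
  have dl := nd ℓ I.lf
  refine ⟨bd_lor I.bal bdd, fun e he => I.bf e (xf e he).1, bd_lor I.bo bm, bd_lor I.bc bdd, fun e he => I.bw e (xw e he).1,
    ?_, ?_, ?_, ?_, ?_, ?_, I.hℓ, ?_, nxf ℓ I.lf, S.tab I.hℓ dl I.lp, S.tab I.hℓ dl I.ln, ?_, ?_⟩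
  · intro e he
    have h1 := I.fw e (xf e he).1
    rw [Bool.eq_false_iff]; intro h2
    rw [(xw e h2).1] at h1; cases h1
  · intro e he
    have h1 := (xf e he).1
    rw [tb_lor, I.fo e h1, nm e (I.fw e h1)]; rfl
  · intro e he
    have h1 := xf e he
    rw [tb_lor, I.fc e h1.1, h1.2]; rfl
  · intro e he
    have h1 := xf e he
    exact S.emp (I.bf e h1.1) h1.2 (I.fP e h1.1)
  · intro e he
    have h1 := xf e he
    exact S.emp (I.bf e h1.1) h1.2 (I.fN e h1.1)
  · intro e he
    rw [tb_lor, Bool.or_eq_true] at he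
    rw [Bool.eq_false_iff]; intro h2
    have h3 := (xw e h2).1
    rcases he with he | he
    · rw [I.cw e he] at h3; cases h3
    · rw [I.fw e (hdd e he)] at h3; cases h3
  · rw [tb_lor, I.la]; rfl
  · rw [tb_lor, I.lc, dl]; rfl
  · rcases I.pair with h1 | ⟨h1, d, h2, h3, h4, h5, h6, h7, h8⟩
    · cases hml : m.testBit ℓ with
      | false => left; rw [tb_lor, h1, hml]; rfl
      | true =>
        right
        obtain ⟨d, hd⟩ := S.ex ℓ hml
        have d1 : dd.testBit d = true := (S.dd d).2 ⟨ℓ, hd, hml⟩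
        have d2 := hdd d d1
        have d3 := I.bf d d2
        refine ⟨by rw [tb_lor, hml, Bool.or_true], d, d3, by rw [tb_lor, d1, Bool.or_true], by rw [tb_lor, d1, Bool.or_true],
          by rw [tb_lor, I.fo d d2, nm d (I.fw d d2)]; rfl, by rw [tb_xor, d1, d2]; rfl, ?_, ?_⟩
        · exact S.new I.hℓ d3 dl hml hd (I.fP d d2) I.lp
        · exact S.new I.hℓ d3 dl hml hd (I.fN d d2) I.ln
    · right
      have d1 := nd d h6
      exact ⟨by rw [tb_lor, h1]; rfl, d, h2, by rw [tb_lor, h3]; rfl, by rw [tb_lor, h4]; rfl,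
        by rw [tb_lor, h5, nm d (I.cw d h4)]; rfl, nxf d h6, S.same I.hℓ h2 dl d1 h7, S.same I.hℓ h2 dl d1 h8⟩

theorem shf_left (bw : Bd W want) (bf : Bd W free) (s : Nat) {m : Nat} (hm : m = Nat.land want (Nat.shiftRight free s)) :
    Shf W (fun x => Nat.shiftLeft x s) m (Nat.shiftLeft m s) (fun a e => a + s = e) := by
  have bm : Bd W m := by
    intro i hi; rw [hm, tb_land, Bool.and_eq_true] at hi; exact bw i hi.1
  refine ⟨by omega, by omega, ?_, ?_, fun μ _ => ⟨_, rfl⟩⟩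
  · intro e
    rw [tb_shl, Bool.and_eq_true, decide_eq_true_eq]
    constructor
    · rintro ⟨h1, h2⟩; exact ⟨e - s, by omega, h2⟩
    · rintro ⟨μ, rfl, h⟩; exact ⟨by omega, by rwa [Nat.add_sub_cancel]⟩
  · intro x a e he
    rw [tb_shl, Bool.and_eq_true, decide_eq_true_eq, tb_land, Bool.and_eq_true]
    constructor
    · rintro ⟨h1, h2, h3⟩
      have hW : 0 < W := by omega
      obtain ⟨b, μ, hμ, hb⟩ : ∃ b μ, μ < W ∧ a * W + e - s = b * W + μ :=
        ⟨(a * W + e - s) / W, (a * W + e - s) % W, Nat.mod_lt _ hW, (Nat.div_add_mod' _ _).symm⟩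
      rw [hb] at h2 h3
      have h4 := (rep_bit bm _ _ _ hμ).1 h3
      have h5 : μ + s < W := by
        have h5 := h4.2
        rw [hm, tb_land, Bool.and_eq_true, tb_shr] at h5
        have := bf _ h5.2; omega
      have h6 := lane_eq (a := a) (b := b) he h5 (by omega)
      obtain ⟨rfl, rfl⟩ := h6
      exact ⟨μ, hμ, rfl, h4.2, h4.1, h2⟩
    · rintro ⟨μ, hμ, rfl, h1, h2, h3⟩
      rw [show a * W + (μ + s) - s = a * W + μ by omega]
      exact ⟨by omega, h3, (rep_bit bm _ _ _ hμ).2 ⟨h2, h1⟩⟩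
theorem shf_right (bw : Bd W want) (bf : Bd W free) (s : Nat) {m : Nat} (hm : m = Nat.land want (Nat.shiftLeft free s)) :
    Shf W (fun x => Nat.shiftRight x s) m (Nat.shiftRight m s) (fun a e => a = e + s) := by
  have bm : Bd W m := by
    intro i hi; rw [hm, tb_land, Bool.and_eq_true] at hi; exact bw i hi.1
  have ms : ∀ μ, m.testBit μ = true → s ≤ μ := by
    intro μ h; rw [hm, tb_land, Bool.and_eq_true, tb_shl, Bool.and_eq_true, decide_eq_true_eq] at h; exact h.2.1
  refine ⟨by omega, by omega, ?_, ?_, fun μ h => ⟨μ - s, by have := ms μ h; omega⟩⟩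
  · intro e
    rw [tb_shr]
    constructor
    · intro h; exact ⟨s + e, by omega, h⟩
    · rintro ⟨μ, rfl, h⟩; rwa [Nat.add_comm]
  · intro x a e he
    rw [tb_shr, tb_land, Bool.and_eq_true]
    constructor
    · rintro ⟨h2, h3⟩
      have hW : 0 < W := by omega
      obtain ⟨b, μ, hμ, hb⟩ : ∃ b μ, μ < W ∧ s + (a * W + e) = b * W + μ :=
        ⟨(s + (a * W + e)) / W, (s + (a * W + e)) % W, Nat.mod_lt _ hW, (Nat.div_add_mod' _ _).symm⟩
      rw [hb] at h2 h3
      have h4 := (rep_bit bm _ _ _ hμ).1 h3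
      have h5 := ms μ h4.2
      have h6 := lane_eq (a := a) (b := b) (f := μ - s) he (by omega) (by omega)
      obtain ⟨rfl, rfl⟩ := h6
      exact ⟨μ, hμ, by omega, h4.2, h4.1, h2⟩
    · rintro ⟨μ, hμ, rfl, h1, h2, h3⟩
      rw [show s + (a * W + e) = a * W + (e + s) by omega]
      exact ⟨h3, (rep_bit bm _ _ _ hμ).2 ⟨h2, h1⟩⟩
end
end K6

namespace K6
section
variable {W ℓ : Nat} {t : Nat → Nat → Nat → Bool}
structure InvL (W ℓ : Nat) (t : Nat → Nat → Nat → Bool) (l : List Nat) : Prop where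
  len : l.length = 137
  inv : Inv W ℓ t (rP l) (rN l) (nth 132 l) (nth 133 l) (nth 134 l) (nth 135 l) (nth 136 l)
theorem InvL.mk' {f f' : Nat → Nat → Nat} {a b c d e : Nat} (h : Inv W ℓ t f f' a b c d e) :
    InvL W ℓ t (tabT f 11 1 (tabT f' 11 1 [a, b, c, d, e])) := by
  constructor
  · rw [tabT_len, tabT_len]; rfl
  · rw [show 132 = 132 + 0 from rfl, show 133 = 132 + 1 from rfl, show 134 = 132 + 2 from rfl,
      show 135 = 132 + 3 from rfl, show 136 = 132 + 4 from rfl]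
    simp only [← nth_drp, drp_tab2]
    exact h.ext (fun g h h1 h2 h3 => (rP_tab h1 h2 h3).symm) (fun g h h1 h2 h3 => (rN_tab h1 h2 h3).symm)
theorem selL_sub (P N : Nat → Nat → Nat) (x e : Nat) (vs : List (Nat × Nat)) (j : Nat)
    (h : (nth j (selL W P N x vs)).testBit e = true) : x.testBit e = true := by
  induction vs generalizing j with
  | nil =>
    rw [selL_z] at h
    have : nth j [] = 0 := by
      clear h
      induction j with
      | zero => rfl
      | succ j ih => exact ih
    rw [this] at h; simp at h
  | cons v vs ih =>
    rw [selL_s] at h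
    cases j with
    | zero =>
      rw [nth_z, hd_c, tb_land, Bool.and_eq_true] at h; exact h.1
    | succ j => exact ih j h
theorem rm_bit (W e : Nat) : (rm W 15).testBit e = decide (e < W) := by
  have : rm W 15 = 2 ^ W - 1 := by
    show (1 <<< (1 * W)) - 1 = _
    rw [Nat.one_shiftLeft, Nat.one_mul]
  rw [this, Nat.testBit_two_pow_sub_one]
def alv (W : Nat) (l : List Nat) : Nat :=
  Nat.xor (nth 133 l) (Nat.land (nth 133 l) (orU 14 (fun i => sR W i (ddA (rP l) (rN l) (nth 132 l)))))
theorem Stt.dd {l} (h : Stt W ℓ t l) : Ok W ℓ (fun _ => False) (ddA (rP l) (rN l) (nth 132 l)) := by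
  refine Ok.orA h.f fun i hi => Ok.orU fun j hj => ?_
  refine ((h.p (i+1) (j+1) (by omega) (by omega) (by omega)).and (h.n (i+1) (j+1) (by omega) (by omega) (by omega))).mono ?_
  rintro a ⟨h1, h2⟩
  have := h1.2.symm.trans h2.2
  cases this
theorem Stt.alv {l} (h : Stt W ℓ t l) : (alv W l).testBit ℓ = true ∧ Bd W (alv W l) := by
  have h1 : Ok W ℓ (fun _ => False) (orU 14 (fun i => K6.sR W i (ddA (rP l) (rN l) (nth 132 l)))) :=
    Ok.orU fun i _ => (h.dd).sR i
  constructor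
  · rw [K6.alv, tb_xor, tb_land, h.a]
    have h2 := h1 0
    rw [Nat.zero_mul, Nat.zero_add] at h2
    rw [Bool.eq_false_iff.2 h2]; rfl
  · intro i hi
    rw [K6.alv, tb_xor, tb_land] at hi
    apply bd_of_lt h.al
    revert hi
    cases (nth 133 l).testBit i <;> simp
theorem Stt.Fc {l} (h : Stt W ℓ t l) (hℓ : ℓ < W) (j : Nat) : InvL W ℓ t (spFc W j (K6.alv W l :: l)) := by
  obtain ⟨h1, h2⟩ := h.alv
  have hw : ∀ e, (nth j (K6.alv W l :: selL W (rP l) (rN l) (K6.alv W l) ord)).testBit e = true →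
      (K6.alv W l).testBit e = true := by
    intro e he
    cases j with
    | zero => exact he
    | succ j =>
      rw [nth_s, tl_c] at he
      exact selL_sub _ _ _ _ _ j he
  have hf : ∀ e, (Nat.xor (rm W 15) (K6.alv W l)).testBit e = true → e < W ∧ (K6.alv W l).testBit e = false := by
    intro e he
    rw [tb_xor, rm_bit] at he
    have := h2 e
    revert he this
    by_cases h3 : e < W <;> cases (K6.alv W l).testBit e <;> simp [h3]
  have hE : ∀ Q : Nat → Nat → Nat, ∀ e, (Nat.xor (rm W 15) (K6.alv W l)).testBit e = true →
      Emp W (cln (rep W (K6.alv W l) 13) Q) e := by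
    intro Q e he g k _ _ _ a
    obtain ⟨h3, h4⟩ := hf e he
    rw [cln, tb_land]
    have : (rep W (K6.alv W l) 13).testBit (a * W + e) = false := by
      rw [Bool.eq_false_iff]; intro h5
      have := ((rep_bit h2 _ _ _ h3).1 h5).2
      rw [h4] at this; cases this
    rw [this, Bool.and_false]
  have hT : ∀ (Q : Nat → Nat → Nat) Φ, Tab W ℓ 12 Φ Q → Tab W ℓ 12 Φ (cln (rep W (K6.alv W l) 13) Q) := by
    intro Q Φ H g k q1 q2 q3 a ha
    rw [cln, tb_land, Bool.and_eq_true] at ha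
    exact H g k q1 q2 q3 a ha.1
  show InvL W ℓ t (tabT (cln (rep W (K6.alv W l) 13) (rP l)) 11 1 (tabT (cln (rep W (K6.alv W l) 13) (rN l)) 11 1
    [K6.alv W l, nth j (K6.alv W l :: selL W (rP l) (rN l) (K6.alv W l) ord), Nat.xor (rm W 15) (K6.alv W l), 0, 0]))
  apply InvL.mk'
  refine ⟨h2, fun e he => (hf e he).1, fun e he => ?_, fun e he => ?_, fun e he => h2 e (hw e he), ?_, ?_, ?_, hE _, hE _, ?_,
    hℓ, h1, ?_, hT _ _ h.p, hT _ _ h.n, Nat.zero_testBit _, Or.inl (Nat.zero_testBit _)⟩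
  · simp at he
  · simp at he
  · intro e he
    rw [Bool.eq_false_iff]; intro h3
    have h4 := hw e h3
    rw [(hf e he).2] at h4; cases h4
  · intros; simp
  · intros; simp
  · intro e he; simp at he
  · rw [Bool.eq_false_iff]; intro h3
    rw [(hf _ h3).2] at h1; cases h1
theorem InvL.left {l} (h : InvL W ℓ t l) (s : Nat) : InvL W ℓ t (spC2 (fun x => Nat.shiftLeft x s) (spC1L W s l)) := by
  apply InvL.mk'
  have S := shf_left h.inv.bw h.inv.bf s rfl
  refine h.inv.copy S ?_ ?_
  · intro e he; rw [tb_land, Bool.and_eq_true] at he; exact he.1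
  · intro e he
    obtain ⟨μ, rfl, h2⟩ := (S.dd e).1 he
    rw [tb_land, Bool.and_eq_true, tb_shr, Nat.add_comm] at h2; exact h2.2
theorem InvL.right {l} (h : InvL W ℓ t l) (s : Nat) : InvL W ℓ t (spC2 (fun x => Nat.shiftRight x s) (spC1R W s l)) := by
  apply InvL.mk'
  have S := shf_right h.inv.bw h.inv.bf s rfl
  refine h.inv.copy S ?_ ?_
  · intro e he; rw [tb_land, Bool.and_eq_true] at he; exact he.1
  · intro e he
    obtain ⟨μ, rfl, h2⟩ := (S.dd e).1 he
    rw [tb_land, Bool.and_eq_true, tb_shl, Nat.add_sub_cancel, Bool.and_eq_true] at h2; exact h2.2.2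
def BadC (W : Nat) (t : Nat → Nat → Nat → Bool) (k : Arr 137) : Prop :=
  ∀ l ℓ, InvL W ℓ t l → app 137 k l = false
theorem bad_copies (k : Arr 137) (hk : BadC W t k) (ss : List Nat) : BadC W t (copies W k ss) := by
  induction ss with
  | nil => exact hk
  | cons s ss ih =>
    intro l ℓ h
    show app 137 (cond (Nat.ble W s) (uC1R.1 W (Nat.sub s W) (uC2R.1 (Nat.sub s W) (copies W k ss)))
      (uC1L.1 W s (uC2L.1 s (copies W k ss)))) l = false
    cases Nat.ble W s with
    | true =>
      rw [cond_t, uC1R.2, uC2R.2]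
      beta_reduce
      rw [app_lam' _ h.len, app_lam' _ (by simp [spC1R, h.len])]
      exact ih _ _ (h.right _)
    | false =>
      rw [cond_f, uC1L.2, uC2L.2]
      beta_reduce
      rw [app_lam' _ h.len, app_lam' _ (by simp [spC1L, h.len])]
      exact ih _ _ (h.left _)

/-! splitting -/
theorem mss_bit (dec : Nat × Nat → Nat) (vs : List (Nat × Nat)) (r i e : Nat) :
    (nth i (mss dec vs r)).testBit e = true ↔
      i < vs.length ∧ r.testBit e = true ∧ (∀ j, j < i → (dec vs[j]!).testBit e = true) ∧ (dec vs[i]!).testBit e = false := by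
  induction vs generalizing r i with
  | nil =>
    have : nth i (mss dec [] r) = 0 := by
      rw [mss_z]
      induction i with
      | zero => rfl
      | succ j ih => exact ih
    rw [this]; simp
  | cons v vs ih =>
    rw [mss_s]
    cases i with
    | zero =>
      rw [nth_z, hd_c, tb_xor, tb_land]
      simp
    | succ i =>
      rw [nth_s, tl_c, ih, tb_land, Bool.and_eq_true]
      constructor
      · rintro ⟨h1, ⟨h2, h3⟩, h4, h5⟩
        refine ⟨by simpa using h1, h2, ?_, by simpa using h5⟩
        intro j hj
        cases j with
        | zero => simpa using h3
        | succ j => simpa using h4 j (by omega)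
      · rintro ⟨h1, h2, h3, h4⟩
        refine ⟨by simpa using h1, ⟨h2, by simpa using h3 0 (by omega)⟩, ?_, by simpa using h4⟩
        intro j hj
        simpa using h3 (j+1) (by omega)
theorem ups_bit (m : List Nat) (vs : List (Nat × Nat)) (x : Nat) (h : (ups W m vs).testBit x = true) :
    ∃ v, v ∈ vs ∧ (sL W v.2 (nth v.1 m)).testBit x = true := by
  induction vs with
  | nil => rw [ups_z] at h; simp at h
  | cons v vs ih =>
    cases vs with
    | nil => rw [ups_o] at h; exact ⟨v, by simp, h⟩
    | cons v' vs =>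
      rw [ups_s, tb_lor, Bool.or_eq_true] at h
      rcases h with h | h
      · obtain ⟨u, h1, h2⟩ := ih h
        exact ⟨u, List.mem_cons_of_mem _ h1, h2⟩
      · exact ⟨v, by simp, h⟩
theorem sL_bit {x a b e : Nat} (he : e < W) (hx : Bd W x) (h : (sL W b x).testBit (a * W + e) = true) :
    a = b ∧ x.testBit e = true := by
  rw [sL, show Nat.mul b W = b * W from rfl, tb_shl, Bool.and_eq_true, decide_eq_true_eq] at h
  have h1 := hx _ h.2
  have h2 := lane_eq (a := a) (b := b) he h1 (by omega)
  refine ⟨h2.1, ?_⟩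
  rw [h2.2]; exact h.2
theorem okT_ok : ∀ g, g < 12 → ∀ h, h < 12 → 1 ≤ g → 1 ≤ h → ∀ p ∈ gt (gt okT (g-1)) (h-1), p.1 < 254 ∧ ord[p.1]! = (16 * g + h, p.2) := by
  decide +kernel
theorem ord_len : ord.length = 254 := by decide +kernel
theorem ord_ok : ∀ i, i < 254 → 1 ≤ (ord[i]!).1 / 16 ∧ 1 ≤ (ord[i]!).1 % 16 ∧ (ord[i]!).1 / 16 + (ord[i]!).1 % 16 ≤ 12 ∧
    (ord[i]!).2 + (ord[i]!).1 / 16 + (ord[i]!).1 % 16 ≤ 15 := by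
  decide +kernel
/-- the value of the `i`-th branching variable -/
def vl (t : Nat → Nat → Nat → Bool) (i : Nat) : Bool :=
  t (ord[i]!).2 ((ord[i]!).2 + (ord[i]!).1 / 16) ((ord[i]!).2 + (ord[i]!).1 / 16 + (ord[i]!).1 % 16)
theorem cup_vl {v : Bool} {g h a i : Nat} (h2 : h < 12) (hi : i < 254) (e : ord[i]! = (16 * g + h, a)) (hv : vl t i = v) :
    Cup t v g h a := by
  have h1 := ord_ok i hi
  rw [vl] at hv
  rw [e] at h1 hv
  have e1 : (16 * g + h) / 16 = g := by omega
  have e2 : (16 * g + h) % 16 = h := by omega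
  simp only [e1, e2] at h1 hv
  exact ⟨h1.2.2.2, hv⟩
def Msk (W : Nat) (l : List Nat) : List Nat := mss (decV W (rP l) (rN l)) ord (Nat.lor (nth 135 l) (nth 136 l))
def T8 (W : Nat) (l : List Nat) (g h : Nat) : Nat := ups W (spSa W l) (gt (gt okT (g-1)) (h-1))
theorem T8_bit {l : List Nat} (bo : Bd W (nth 135 l)) (bc : Bd W (nth 136 l)) {g h a e : Nat} (he : e < W) (hg : 1 ≤ g) (hh : 1 ≤ h) (hs : g + h ≤ 12)
    (H : (T8 W l g h).testBit (a * W + e) = true) :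
    ∃ i, i < 254 ∧ ord[i]! = (16 * g + h, a) ∧ (nth i (Msk W l)).testBit e = true := by
  obtain ⟨v, h1, h2⟩ := ups_bit _ _ _ H
  obtain ⟨h3, h4⟩ := okT_ok g (by omega) h (by omega) hg hh v h1
  have h5 : nth v.1 (spSa W l) = nth v.1 (Msk W l) := by
    rw [spSa, nth_rowT _ _ _ _ _ h3, Nat.zero_add]; rfl
  rw [h5] at h2
  have h6 : Bd W (nth v.1 (Msk W l)) := by
    intro x hx
    have := ((mss_bit _ _ _ _ _).1 hx).2.1
    rw [tb_lor, Bool.or_eq_true] at this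
    exact this.elim (bo x) (bc x)
  obtain ⟨rfl, h7⟩ := sL_bit he h6 h2
  exact ⟨v.1, h3, h4, h7⟩
theorem decV_same {P N : Nat → Nat → Nat} {e f i : Nat} (hi : i < 254) (hP : Same W P e f) (hN : Same W N e f) :
    (decV W P N ord[i]!).testBit e = (decV W P N ord[i]!).testBit f := by
  obtain ⟨h1, h2, h3, -⟩ := ord_ok i hi
  rw [decV, sR, tb_shr, tb_shr, tb_lor, tb_lor]
  have := hP _ _ h1 h2 h3 (ord[i]!).2
  have h' := hN _ _ h1 h2 h3 (ord[i]!).2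
  rw [show Nat.mul (ord[i]!).2 W = (ord[i]!).2 * W from rfl, this, h']
def Tu (W R : Nat) (l : List Nat) (P : Nat → Nat → Nat) (g h : Nat) : Nat :=
  orA (P g h) (1-(g+h-8)) (fun _ => Nat.land (T8 W l g h) R)
theorem tab_Tu {l : List Nat} {m : Nat} {v : Bool} {P : Nat → Nat → Nat} (hℓ : ℓ < W) (bo : Bd W (nth 135 l)) (bc : Bd W (nth 136 l))
    (bm : Bd W m) (hP : Tab W ℓ 12 (Cup t v) P)
    (H : m.testBit ℓ = true → ∀ i, i < 254 → (nth i (Msk W l)).testBit ℓ = true → vl t i = v) :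
    Tab W ℓ 12 (Cup t v) (Tu W (rep W m 13) l P) := by
  intro g h h1 h2 h3
  refine Ok.orA (hP g h h1 h2 h3) fun _ _ a ha => ?_
  rw [tb_land, Bool.and_eq_true] at ha
  obtain ⟨i, h4, h5, h6⟩ := T8_bit bo bc hℓ h1 h2 h3 ha.1
  have h7 := ((rep_bit bm _ _ _ hℓ).1 ha.2).2
  exact cup_vl (by omega) h4 h5 (H h7 i h4 h6)
theorem spl_eq {l : List Nat} (W : Nat) : Eqv (upd (nth 28 (spSb W (spSa W l))) (rP (drp 30 (spSb W (spSa W l)))) (rdT 7 · (spSb W (spSa W l)) ·))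
      (Tu W (rep W (nth 135 l) 13) l (rP l)) ∧
    Eqv (upd (nth 29 (spSb W (spSa W l))) (rN (drp 30 (spSb W (spSa W l)))) (rdT 7 · (spSb W (spSa W l)) ·))
      (Tu W (rep W (nth 136 l) 13) l (rN l)) ∧ nth 162 (spSb W (spSa W l)) = nth 132 l := by
  have a1 : drp 254 (spSa W l) = l := drp_rowT _ _ _ _
  have a2 : nth 389 (spSa W l) = nth 135 l := by rw [show 389 = 254 + 135 from rfl, ← nth_drp, a1]
  have a3 : nth 390 (spSa W l) = nth 136 l := by rw [show 390 = 254 + 136 from rfl, ← nth_drp, a1]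
  have a4 : drp 28 (spSb W (spSa W l)) = rep W (nth 135 l) 13 :: rep W (nth 136 l) 13 :: l := by
    rw [spSb, a1, a2, a3]; exact drp_tabT _ 7 _ _
  have a5 : drp 30 (spSb W (spSa W l)) = l := by rw [show 30 = 28 + 2 from rfl, drp_add, a4]; rfl
  have a6 : nth 28 (spSb W (spSa W l)) = rep W (nth 135 l) 13 := by
    rw [show 28 = 28 + 0 from rfl, ← nth_drp, a4]; rfl
  have a7 : nth 29 (spSb W (spSa W l)) = rep W (nth 136 l) 13 := by
    rw [show 29 = 28 + 1 from rfl, ← nth_drp, a4]; rfl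
  have a8 : ∀ g h, 1 ≤ g → 1 ≤ h → g + h ≤ 8 → rdT 7 g (spSb W (spSa W l)) h = T8 W l g h := by
    intro g h h1 h2 h3
    rw [spSb, rdT_tabT _ _ _ _ _ _ h1 h2 h3, show 1 + (g - 1) = g by omega]; rfl
  have a9 : ∀ R P, Eqv (upd R P (rdT 7 · (spSb W (spSa W l)) ·)) (Tu W R l P) := by
    intro R P g h h1 h2 h3
    by_cases hs : g + h ≤ 8
    · rw [upd, Tu, a8 g h h1 h2 hs]
    · rw [upd, Tu, show 1 - (g + h - 8) = 0 by omega]; rfl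
  refine ⟨?_, ?_, ?_⟩
  · rw [a6, a5]; exact a9 _ _
  · rw [a7, a5]; exact a9 _ _
  · rw [show 162 = 30 + 132 from rfl, ← nth_drp, a5]
theorem InvL.split {l} (h : InvL W ℓ t l) : Good W t (spSc (spSb W (spSa W l))) := by
  have I := h.inv
  obtain ⟨e1, e2, e3⟩ := spl_eq (l := l) W
  have key : ∀ d, d < W → (nth 132 l).testBit d = true → Tab W d 12 (Cup t true) (rP l) → Tab W d 12 (Cup t false) (rN l) →
      ((nth 135 l).testBit d = true → ∀ i, i < 254 → (nth i (Msk W l)).testBit d = true → vl t i = true) →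
      ((nth 136 l).testBit d = true → ∀ i, i < 254 → (nth i (Msk W l)).testBit d = true → vl t i = false) →
      Good W t (spSc (spSb W (spSa W l))) := by
    intro d hd h1 h2 h3 h4 h5
    refine ⟨d, hd, Stt.mk' rfl ?_ ?_ ?_ ?_ ?_⟩
    · exact (tab_Tu hd I.bo I.bc I.bo h2 h4).ext (fun g k q1 q2 q3 => (e1 g k q1 q2 q3).symm)
    · exact (tab_Tu hd I.bo I.bc I.bc h3 h5).ext (fun g k q1 q2 q3 => (e2 g k q1 q2 q3).symm)
    · exact Ok.zero
    · rw [nth_s, tl_c, nth_z, hd_c, e3]; exact h1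
    · rw [nth_s, tl_c, nth_z, hd_c, e3]; exact I.bal.lt
  by_cases H : (nth 135 l).testBit ℓ = true → ∀ i, i < 254 → (nth i (Msk W l)).testBit ℓ = true → vl t i = true
  · exact key ℓ I.hℓ I.la I.lp I.ln H (fun h1 => by rw [I.lc] at h1; cases h1)
  · push Not at H
    obtain ⟨h1, i, h2, h3, h4⟩ := H
    rcases I.pair with p | ⟨-, d, p1, p2, p3, p4, p5, p6, p7⟩
    · rw [p] at h1; cases h1
    refine key d p1 p2 ?_ ?_ (fun h5 => by rw [p4] at h5; cases h5) ?_
    · intro g k q1 q2 q3 a ha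
      rw [← p6 g k q1 q2 q3] at ha
      exact I.lp g k q1 q2 q3 a ha
    · intro g k q1 q2 q3 a ha
      rw [← p7 g k q1 q2 q3] at ha
      exact I.ln g k q1 q2 q3 a ha
    · intro _ j hj h5
      rw [Msk, mss_bit] at h3 h5
      have : i = j := by
        rcases Nat.lt_trichotomy i j with q | q | q
        · have h6 := h5.2.2.1 i q
          rw [← decV_same h2 p6 p7, h3.2.2.2] at h6; cases h6
        · exact q
        · have h6 := h3.2.2.1 j q
          rw [decV_same hj p6 p7, h5.2.2.2] at h6; cases h6
      subst this
      simpa using h4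
theorem bad_split (k : Arr 134) (hk : Bad W t k) : BadC W t (uSa.1 W (uSb.1 W (uSc.1 k))) := by
  intro l ℓ h
  have b1 : (spSa W l).length = 391 := by rw [spSa, rowT_len, h.len]
  have b2 : (spSb W (spSa W l)).length = 167 := by
    rw [spSb, tabT_len]; simp [drp_len, b1, tri]
  rw [uSa.2, uSb.2, uSc.2]
  beta_reduce
  rw [app_lam' _ h.len, app_lam' _ b1, app_lam' _ b2]
  exact hk _ h.split
theorem bad_grow (k : Arr 134) (hk : Bad W t k) (j : Nat) (ss : List Nat) : Bad W t (grow W j ss k) := by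
  rintro l ⟨ℓ, hℓ, h⟩
  have h1 := bad_copies _ (bad_split k hk) ss _ _ (h.Fc hℓ j)
  rw [grow, uFa.2, uFb.2, uFc.2]
  beta_reduce
  rw [app_lam' _ h.len, app_lam' _ (by simp [spFa, h.len]), app_lam' _ (by simp [spFb, spFa, drp_len, h.len])]
  show cond (Nat.beq (K6.alv W l) 0) true (app 137 _ (spFc W j (K6.alv W l :: l))) = false
  have h2 : Nat.beq (K6.alv W l) 0 = false := by
    rw [Bool.eq_false_iff]
    intro h3
    have h4 := Nat.eq_of_beq_eq_true h3
    have h5 := h.alv.1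
    rw [h4] at h5; simp at h5
  rw [h2]
  exact h1
theorem bad_run (C : Cls t) (k : Arr 134) (hk : Bad W t k) (rs : List (List Nat)) : Bad W t (run W k rs) := by
  induction rs with
  | nil => exact hk
  | cons r rs ih =>
    show Bad W t (cond (Nat.beq (hd r) 0) (grow W (hd (tl r)) (tl (tl r)) (run W k rs))
      (pass W (grow W (hd (tl r)) (tl (tl r)) (run W k rs))))
    cases Nat.beq (hd r) 0 with
    | true => exact bad_grow _ ih _ _
    | false => exact bad_pass C _ (bad_grow _ ih _ _)
theorem bad_nil : Bad W t (lam 134 (fun _ => false)) := by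
  intro l _
  rw [app_lam]

/-! cubes -/
theorem ini_bit (m : List Nat) (vs : List (Nat × Nat)) (x : Nat) (h : (ini W m vs).testBit x = true) :
    ∃ v, v ∈ vs ∧ (sL W v.2 (nth v.1 m)).testBit x = true := by
  induction vs with
  | nil => have h : (0 : Nat).testBit x = true := h; simp at h
  | cons v vs ih =>
    have h : (Nat.lor (ini W m vs) (sL W v.2 (nth v.1 m))).testBit x = true := h
    rw [tb_lor, Bool.or_eq_true] at h
    rcases h with h | h
    · obtain ⟨u, h1, h2⟩ := ih h
      exact ⟨u, List.mem_cons_of_mem _ h1, h2⟩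
    · exact ⟨v, by simp, h⟩
def Cub (t : Nat → Nat → Nat → Bool) (v : Bool) (pb : List Nat) : Prop :=
  ∀ i, nth i pb = 0 ∨ (nth i pb = 1 ∧ vl t i = v)
theorem tab_ini {pb : List Nat} {v : Bool} (hW : 0 < W) (H : Cub t v pb) :
    Tab W 0 12 (Cup t v) (fun g h => ini W pb (gt (gt okT (g-1)) (h-1))) := by
  intro g h h1 h2 h3 a ha
  obtain ⟨u, q1, q2⟩ := ini_bit _ _ _ ha
  obtain ⟨q3, q4⟩ := okT_ok g (by omega) h (by omega) h1 h2 u q1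
  have q5 : Bd W (nth u.1 pb) := by
    intro x hx
    rcases H u.1 with q | ⟨q, -⟩
    · rw [q] at hx; simp at hx
    · rw [q] at hx
      rw [Nat.testBit_one_eq_true_iff_self_eq_zero] at hx; omega
  obtain ⟨rfl, q6⟩ := sL_bit hW q5 q2
  rcases H u.1 with q | ⟨-, q⟩
  · rw [q] at q6; simp at q6
  · exact cup_vl (by omega) q3 q4 q
theorem check_sound (C : Cls t) (hW : 0 < W) (pb nb : List Nat) (rs : List (List Nat)) (h : check W pb nb rs = true)
    (hp : Cub t true pb) (hn : Cub t false nb) : False := by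
  have h1 : Good W t (initL W pb nb) := ⟨0, hW, Stt.mk' rfl (tab_ini hW hp) (tab_ini hW hn) Ok.zero (by rfl)
    (by show 1 < 2 ^ W; exact Nat.one_lt_two_pow (by omega))⟩
  have h2 := bad_run C _ bad_nil rs _ h1
  rw [check] at h
  rw [h] at h2; cases h2
end
end K6

namespace K6
def rfl3 (t : Nat → Nat → Nat → Bool) (a b c : Nat) : Bool := t (15 - c) (15 - b) (15 - a)
theorem cls_rfl {t : Nat → Nat → Nat → Bool} (C : Cls t) : Cls (rfl3 t) := by
  refine ⟨?_, ?_, ?_, ?_, ?_, ?_, ?_, ?_⟩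
  · intro v a b c d h1 h2 h3 h4 e1 e2
    exact C.s4 v (15-d) (15-c) (15-b) (15-a) (by omega) (by omega) (by omega) (by omega) e2 e1
  · intro v a b c d h1 h2 h3 h4 e1 e2
    exact C.s3 v (15-d) (15-c) (15-b) (15-a) (by omega) (by omega) (by omega) (by omega) e2 e1
  · intro v a b c d h1 h2 h3 h4 e1 e2
    exact C.s2 v (15-d) (15-c) (15-b) (15-a) (by omega) (by omega) (by omega) (by omega) e2 e1
  · intro v a b c d h1 h2 h3 h4 e1 e2
    exact C.s1 v (15-d) (15-c) (15-b) (15-a) (by omega) (by omega) (by omega) (by omega) e2 e1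
  · intro a b c d e h1 h2 h3 h4 h5 e1 e2 e3
    exact C.cap5 (15-e) (15-d) (15-c) (15-b) (15-a) (by omega) (by omega) (by omega) (by omega) (by omega) e3 e2 e1
  · intro a b c d e f h1 h2 h3 h4 h5 h6 e1 e2 e3 e4
    exact C.cup6 (15-f) (15-e) (15-d) (15-c) (15-b) (15-a) (by omega) (by omega) (by omega) (by omega) (by omega)
      (by omega) e4 e3 e2 e1
  · intro a b c b' c' d h1 h2 h3 h4 h5 h6 h7 e1 e2 e3 e4
    exact C.c44 (15-d) (15-c) (15-b) (15-c') (15-b') (15-a) (by omega) (by omega) (by omega) (by omega) (by omega)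
      (by omega) (by omega) e2 e1 e4 e3
  · intro a b c d x e h1 h2 h3 h4 h5 h6 h7 e1 e2 e3 e4
    exact C.c53 (15-e) (15-d) (15-c) (15-b) (15-x) (15-a) (by omega) (by omega) (by omega) (by omega) (by omega)
      (by omega) (by omega) e3 e2 e1 e4

/-- the cube `c` (listed from the last decision to the first) has no realization -/
def Dead (c : List Bool) : Prop :=
  ∀ t, Cls t → (∀ i x, c.reverse[i]? = some x → vl t i = x) → False
def bits (v : Bool) : List Bool → List Nat
  | [] => []
  | x :: l => (if x = v then 1 else 0) :: bits v l
theorem nth_bits (v : Bool) : ∀ (c : List Bool) (i : Nat),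
    nth i (bits v c) = 0 ∨ (nth i (bits v c) = 1 ∧ getElem? c i = some v)
  | [], i => by
    left
    induction i with
    | zero => rfl
    | succ n ih => exact ih
  | x :: l, 0 => by
    by_cases h : x = v
    · right; exact ⟨by simp [bits, h, nth, hd], by simp [h]⟩
    · left; simp [bits, h, nth, hd]
  | x :: l, i+1 => by
    have := nth_bits v l i
    simpa [bits, nth, tl] using this
theorem leaf {W : Nat} {pb nb : List Nat} {rs : List (List Nat)} (c : List Bool)
    (h : PLift (check W pb nb rs = true)) (hW : 0 < W)
    (hp : pb = bits true c.reverse) (hn : nb = bits false c.reverse) : Dead c := by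
  intro t C hc
  refine check_sound C hW pb nb rs h.down ?_ ?_
  · intro i
    rw [hp]
    exact (nth_bits true c.reverse i).imp id (fun h => ⟨h.1, hc i _ h.2⟩)
  · intro i
    rw [hn]
    exact (nth_bits false c.reverse i).imp id (fun h => ⟨h.1, hc i _ h.2⟩)
theorem br {c : List Bool} (h0 : Dead (false :: c)) (h1 : Dead (true :: c)) : Dead c := by
  intro t C hc
  have key : ∀ b, vl t c.length = b → ∀ i x, (b :: c).reverse[i]? = some x → vl t i = x := by
    intro b hb i x hx
    rw [List.reverse_cons, List.getElem?_append] at hx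
    split at hx
    · exact hc i x hx
    · next h =>
      rw [List.length_reverse] at *
      rcases Nat.lt_or_ge (i - c.length) 1 with h' | h'
      · have e : i = c.length := by omega
        subst e
        simp at hx
        rw [hb, hx]
      · rw [List.getElem?_eq_none (by simpa using h')] at hx
        cases hx
  cases hb : vl t c.length
  · exact h0 t C (key _ hb)
  · exact h1 t C (key _ hb)
theorem ord_sym : ∀ i < 6, (ord[i ^^^ 1]!).2 = 15 - ((ord[i]!).2 + (ord[i]!).1 / 16 + (ord[i]!).1 % 16) ∧
    (ord[i ^^^ 1]!).2 + (ord[i ^^^ 1]!).1 / 16 = 15 - ((ord[i]!).2 + (ord[i]!).1 / 16) ∧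
    (ord[i ^^^ 1]!).2 + (ord[i ^^^ 1]!).1 / 16 + (ord[i ^^^ 1]!).1 % 16 = 15 - (ord[i]!).2 := by decide +kernel
theorem dead_rfl {c c' : List Bool} (h : Dead c) (hl : c.length ≤ 6)
    (hc : ∀ i < 6, c.reverse[i]? = c'.reverse[i ^^^ 1]?) : Dead c' := by
  intro t C H
  apply h (rfl3 t) (cls_rfl C)
  intro i x hx
  have hi : i < 6 := by
    by_contra hi
    rw [List.getElem?_eq_none (by rw [List.length_reverse]; omega)] at hx
    cases hx
  rw [hc i hi] at hx
  have h1 := H _ _ hx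
  obtain ⟨e1, e2, e3⟩ := ord_sym i hi
  rw [vl, e3, e2, e1] at h1
  rw [vl, rfl3]
  exact h1
/-- reflection between the two asymmetric sign patterns on a pair -/
theorem sy1 (h : Dead [false, true]) : Dead [true, false] := dead_rfl h (by decide) (by decide)
theorem sy2 {x : Bool} (h : Dead [false, true, x, x]) : Dead [true, false, x, x] :=
  dead_rfl h (by simp) (by cases x <;> decide)
theorem sy3 {x y : Bool} (h : Dead [false, true, y, y, x, x]) : Dead [true, false, y, y, x, x] :=
  dead_rfl h (by simp) (by cases x <;> cases y <;> decide)
end K6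

namespace K6
theorem det3_eq (p q r : ℝ × ℝ) :
    det3 p q r = (q.1 - p.1) * (r.2 - p.2) - (q.2 - p.2) * (r.1 - p.1) := by
  rw [det3, Matrix.det_fin_three]
  simp
  ring

theorem extreme_of_pos (P : Set (ℝ × ℝ)) (x : ℝ × ℝ) (hx : x ∈ P) (u v w : ℝ)
    (h0 : u * x.1 + v * x.2 + w = 0)
    (h : ∀ y ∈ P, y ≠ x → 0 < u * y.1 + v * y.2 + w) :
    x ∈ Set.extremePoints ℝ (convexHull ℝ P) := by
  have hC : convexHull ℝ P ⊆ {y | y = x ∨ 0 < u * y.1 + v * y.2 + w} := by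
    apply convexHull_min
    · intro y hy
      by_cases e : y = x
      · exact Or.inl e
      · exact Or.inr (h y hy e)
    · intro y hy z hz a b ha hb hab
      have key : u * (a • y + b • z).1 + v * (a • y + b • z).2 + w
          = a * (u * y.1 + v * y.2 + w) + b * (u * z.1 + v * z.2 + w) := by
        simp only [Prod.fst_add, Prod.snd_add, Prod.smul_fst, Prod.smul_snd, smul_eq_mul]
        linear_combination (-w) * hab
      have h1 : 0 ≤ u * y.1 + v * y.2 + w := by
        rcases hy with rfl | hy
        · exact h0.ge
        · exact hy.le
      have h2 : 0 ≤ u * z.1 + v * z.2 + w := by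
        rcases hz with rfl | hz
        · exact h0.ge
        · exact hz.le
      rcases ha.eq_or_lt with rfl | ha
      · have : b = 1 := by linarith
        subst this
        simpa using hz
      rcases hb.eq_or_lt with rfl | hb
      · have : a = 1 := by linarith
        subst this
        simpa using hy
      rcases hy with rfl | hy
      · rcases hz with rfl | hz
        · left
          rw [← add_smul, hab, one_smul]
        · right
          rw [key]
          have := mul_pos hb hz
          have := mul_nonneg ha.le h1
          linarith
      · right
        rw [key]
        have := mul_pos ha hy
        have := mul_nonneg hb.le h2
        linarith
  rw [mem_extremePoints_iff_left]
  refine ⟨subset_convexHull ℝ P hx, ?_⟩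
  rintro y hy z hz ⟨a, b, ha, hb, hab, e⟩
  have key : u * (a • y + b • z).1 + v * (a • y + b • z).2 + w
      = a * (u * y.1 + v * y.2 + w) + b * (u * z.1 + v * z.2 + w) := by
    simp only [Prod.fst_add, Prod.snd_add, Prod.smul_fst, Prod.smul_snd, smul_eq_mul]
    linear_combination (-w) * hab
  rw [e, h0] at key
  have h2 : 0 ≤ u * z.1 + v * z.2 + w := by
    rcases hC hz with rfl | hz
    · exact h0.ge
    · exact le_of_lt hz
  rcases hC hy with hy | hy
  · exact hy
  · have := mul_pos ha hy
    have := mul_nonneg hb.le h2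
    linarith

theorem f6 : ∀ i : Fin 6, i + 2 ≠ i ∧ i + 2 ≠ i + 1 ∧ i ≠ i + 1 ∧ i ≠ i + 1 + 1 ∧ i + 2 = i + 1 + 1 ∧ i - 1 + 1 = i := by
  decide
theorem gon6 (S : Set (ℝ × ℝ)) (q : Fin 6 → ℝ × ℝ) (hS : ∀ i, q i ∈ S)
    (h : ∀ i j, j ≠ i → j ≠ i + 1 → 0 < det3 (q i) (q (i + 1)) (q j)) :
    ∃ P, IsGon 6 S P := by
  have inj : Function.Injective q := by
    intro i j e
    by_contra hne
    by_cases h1 : j = i + 1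
    · have := h i (i + 2) (f6 i).1 (f6 i).2.1
      rw [← h1, ← e, det3_eq] at this
      linarith
    · have := h i j (fun e => hne e.symm) h1
      rw [← e, det3_eq] at this
      linarith
  refine ⟨Set.range q, ?_, Set.finite_range q, ?_, ?_⟩
  · rintro _ ⟨i, rfl⟩
    exact hS i
  · rw [← Set.image_univ, Set.ncard_image_of_injective _ inj, Set.ncard_univ]
    simp
  · rintro _ ⟨i', rfl⟩
    obtain ⟨i, rfl⟩ : ∃ i, i + 1 = i' := ⟨i' - 1, (f6 i').2.2.2.2.2⟩
    have e2 : i + 2 = i + 1 + 1 := (f6 i).2.2.2.2.1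
    apply extreme_of_pos (Set.range q) (q (i+1)) ⟨_, rfl⟩
      (-((q (i+1)).2 - (q i).2) - ((q (i+2)).2 - (q (i+1)).2))
      (((q (i+1)).1 - (q i).1) + ((q (i+2)).1 - (q (i+1)).1))
      (-((q (i+1)).1 - (q i).1) * (q i).2 + ((q (i+1)).2 - (q i).2) * (q i).1
        - ((q (i+2)).1 - (q (i+1)).1) * (q (i+1)).2 + ((q (i+2)).2 - (q (i+1)).2) * (q (i+1)).1)
    · ring
    · rintro _ ⟨j, rfl⟩ hne
      have hj : j ≠ i + 1 := fun e => hne (by rw [e])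
      have h1 : 0 ≤ det3 (q i) (q (i+1)) (q j) ∧ 0 ≤ det3 (q (i+1)) (q (i+2)) (q j) ∧
          (0 < det3 (q i) (q (i+1)) (q j) ∨ 0 < det3 (q (i+1)) (q (i+2)) (q j)) := by
        by_cases c1 : j = i
        · have A := h (i+1) j (by rw [c1]; exact (f6 i).2.2.1) (by rw [c1]; exact (f6 i).2.2.2.1)
          rw [← e2] at A
          refine ⟨?_, A.le, Or.inr A⟩
          rw [c1, det3_eq]; apply le_of_eq; ring
        · have A := h i j c1 hj
          refine ⟨A.le, ?_, Or.inl A⟩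
          by_cases c2 : j = i + 2
          · rw [c2, det3_eq]; apply le_of_eq; ring
          · have B := h (i+1) j hj (by rw [← e2]; exact c2)
            rw [← e2] at B
            exact B.le
      obtain ⟨A, B, C⟩ := h1
      have : 0 < det3 (q i) (q (i+1)) (q j) + det3 (q (i+1)) (q (i+2)) (q j) := by
        rcases C with C | C <;> linarith
      rw [det3_eq, det3_eq] at this
      linarith
end K6

namespace K6
theorem gon6' (S : Set (ℝ × ℝ)) (a b c d e f : ℝ × ℝ) (ha : a ∈ S) (hb : b ∈ S) (hc : c ∈ S) (hd : d ∈ S)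
    (he : e ∈ S) (hf : f ∈ S)
    (h1 : 0 < det3 a b c ∧ 0 < det3 a b d ∧ 0 < det3 a b e ∧ 0 < det3 a b f)
    (h2 : 0 < det3 b c a ∧ 0 < det3 b c d ∧ 0 < det3 b c e ∧ 0 < det3 b c f)
    (h3 : 0 < det3 c d a ∧ 0 < det3 c d b ∧ 0 < det3 c d e ∧ 0 < det3 c d f)
    (h4 : 0 < det3 d e a ∧ 0 < det3 d e b ∧ 0 < det3 d e c ∧ 0 < det3 d e f)
    (h5 : 0 < det3 e f a ∧ 0 < det3 e f b ∧ 0 < det3 e f c ∧ 0 < det3 e f d)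
    (h6 : 0 < det3 f a b ∧ 0 < det3 f a c ∧ 0 < det3 f a d ∧ 0 < det3 f a e) :
    ∃ P, IsGon 6 S P := by
  apply gon6 S ![a, b, c, d, e, f]
  · intro i; fin_cases i
    · exact ha
    · exact hb
    · exact hc
    · exact hd
    · exact he
    · exact hf
  · obtain ⟨h11, h12, h13, h14⟩ := h1
    obtain ⟨h21, h22, h23, h24⟩ := h2
    obtain ⟨h31, h32, h33, h34⟩ := h3
    obtain ⟨h41, h42, h43, h44⟩ := h4
    obtain ⟨h51, h52, h53, h54⟩ := h5
    obtain ⟨h61, h62, h63, h64⟩ := h6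
    intro i j hj1 hj2
    fin_cases i
    · fin_cases j
      · exact absurd rfl hj1
      · exact absurd rfl hj2
      · exact h11
      · exact h12
      · exact h13
      · exact h14
    · fin_cases j
      · exact h21
      · exact absurd rfl hj1
      · exact absurd rfl hj2
      · exact h22
      · exact h23
      · exact h24
    · fin_cases j
      · exact h31
      · exact h32
      · exact absurd rfl hj1
      · exact absurd rfl hj2
      · exact h33
      · exact h34
    · fin_cases j
      · exact h41
      · exact h42
      · exact h43
      · exact absurd rfl hj1
      · exact absurd rfl hj2
      · exact h44
    · fin_cases j
      · exact h51
      · exact h52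
      · exact h53
      · exact h54
      · exact absurd rfl hj1
      · exact absurd rfl hj2
    · fin_cases j
      · exact absurd rfl hj2
      · exact h61
      · exact h62
      · exact h63
      · exact h64
      · exact absurd rfl hj1

theorem rot (a b c : ℝ × ℝ) : det3 a b c = det3 b c a := by rw [det3_eq, det3_eq]; ring
theorem swp (a b c : ℝ × ℝ) : det3 a b c = - det3 b a c := by rw [det3_eq, det3_eq]; ring
/-- Cramer's rule -/
theorem cram (p a d u v y : ℝ × ℝ) :
    det3 p a d * det3 u v y = det3 a d y * det3 u v p + det3 p y d * det3 u v a + det3 p a y * det3 u v d := by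
  simp only [det3_eq]; ring

/-- points seen from `p` in counterclockwise order -/
structure Fan (S : Set (ℝ × ℝ)) (p : ℝ × ℝ) (f : ℕ → ℝ × ℝ) : Prop where
  hp : p ∈ S
  hf : ∀ i, i ≤ 15 → f i ∈ S
  pos : ∀ i j, i < j → j ≤ 15 → 0 < det3 p (f i) (f j)
  ne : ∀ i j k, i < j → j < k → k ≤ 15 → det3 (f i) (f j) (f k) ≠ 0
noncomputable def tri3 (f : ℕ → ℝ × ℝ) (a b c : ℕ) : Bool := by
  classical exact decide (det3 (f a) (f b) (f c) < 0)
theorem tri3_t {f : ℕ → ℝ × ℝ} {a b c : ℕ} : tri3 f a b c = true ↔ det3 (f a) (f b) (f c) < 0 := by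
  simp [tri3]
section
variable {S : Set (ℝ × ℝ)} {p : ℝ × ℝ} {f : ℕ → ℝ × ℝ}
theorem tri3_f (F : Fan S p f) {a b c : ℕ} (h1 : a < b) (h2 : b < c) (h3 : c ≤ 15) :
    tri3 f a b c = false ↔ 0 < det3 (f a) (f b) (f c) := by
  have := F.ne a b c h1 h2 h3
  rw [← Bool.not_eq_true, tri3_t, not_lt]
  exact ⟨fun h => lt_of_le_of_ne h this.symm, fun h => h.le⟩
end
theorem pos_of_mul {a b : ℝ} (ha : 0 < a) (h : 0 < a * b) : 0 < b := (pos_iff_pos_of_mul_pos h).1 ha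
theorem neg_of_mul {a b : ℝ} (ha : 0 < a) (h : a * b < 0) : b < 0 := by
  by_contra hb
  push Not at hb
  have := mul_nonneg ha.le hb
  linarith
section
variable {S : Set (ℝ × ℝ)} {p : ℝ × ℝ} {f : ℕ → ℝ × ℝ}
theorem sgn_comb {X Y Z A B C : ℝ} (v : Bool) (hC : 0 < C) (hA : 0 < A) (hB : 0 < B)
    (e : Z * C = X * A + Y * B) (hX : cond v (X < 0) (0 < X)) (hY : cond v (Y < 0) (0 < Y)) :
    cond v (Z < 0) (0 < Z) := by
  cases v
  · simp only [cond_false] at *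
    have h1 := mul_pos hX hA
    have h2 := mul_pos hY hB
    apply pos_of_mul hC
    linarith
  · simp only [cond_true] at *
    have h1 := mul_neg_of_neg_of_pos hX hA
    have h2 := mul_neg_of_neg_of_pos hY hB
    apply neg_of_mul hC
    linarith
theorem tri3_v (F : Fan S p f) (v : Bool) {a b c : ℕ} (h1 : a < b) (h2 : b < c) (h3 : c ≤ 15) :
    tri3 f a b c = v ↔ cond v (det3 (f a) (f b) (f c) < 0) (0 < det3 (f a) (f b) (f c)) := by
  cases v
  · exact tri3_f F h1 h2 h3
  · exact tri3_t
end
end K6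

namespace K6
section
variable {a b c : ℝ × ℝ}
theorem ev1 (h : 0 < det3 a b c) : 0 < det3 b c a := by rw [det3_eq] at *; linarith
theorem ev2 (h : 0 < det3 a b c) : 0 < det3 c a b := by rw [det3_eq] at *; linarith
theorem od1 (h : det3 a b c < 0) : 0 < det3 a c b := by rw [det3_eq] at *; linarith
theorem od2 (h : det3 a b c < 0) : 0 < det3 c b a := by rw [det3_eq] at *; linarith
theorem od3 (h : det3 a b c < 0) : 0 < det3 b a c := by rw [det3_eq] at *; linarith
theorem od1' (h : 0 < det3 a b c) : det3 a c b < 0 := by rw [det3_eq] at *; linarith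
theorem od2' (h : 0 < det3 a b c) : det3 c b a < 0 := by rw [det3_eq] at *; linarith
theorem dz1 (a b : ℝ × ℝ) : 0 ≤ det3 a b a := by rw [det3_eq]; apply le_of_eq; ring
theorem dz2 (a b : ℝ × ℝ) : 0 ≤ det3 a b b := by rw [det3_eq]; apply le_of_eq; ring
end
theorem sep {p a d u v y : ℝ × ℝ} (h1 : 0 < det3 p a d) (h2 : 0 < det3 p a y) (h3 : 0 < det3 p y d)
    (h4 : 0 < det3 a d y * det3 u v p) (h5 : 0 ≤ det3 u v a) (h6 : 0 ≤ det3 u v d) : 0 < det3 u v y := by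
  apply pos_of_mul h1
  rw [cram p a d u v y]
  have := mul_nonneg h3.le h5
  have := mul_nonneg h2.le h6
  linarith
theorem hex44 (S : Set (ℝ × ℝ)) (p a b c d x y : ℝ × ℝ)
    (ma : a ∈ S) (mb : b ∈ S) (mc : c ∈ S) (md : d ∈ S) (mx : x ∈ S) (my : y ∈ S)
    (qab : 0 < det3 p a b)
    (qac : 0 < det3 p a c)
    (qad : 0 < det3 p a d)
    (qbc : 0 < det3 p b c)
    (qbd : 0 < det3 p b d)
    (qcd : 0 < det3 p c d)
    (qax : 0 < det3 p a x)
    (qay : 0 < det3 p a y)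
    (qxy : 0 < det3 p x y)
    (qxd : 0 < det3 p x d)
    (qyd : 0 < det3 p y d)
    (habc : 0 < det3 a b c)
    (habd : 0 < det3 a b d)
    (hacd : 0 < det3 a c d)
    (hbcd : 0 < det3 b c d)
    (haxy : det3 a x y < 0)
    (haxd : det3 a x d < 0)
    (hayd : det3 a y d < 0)
    (hxyd : det3 x y d < 0) :
    ∃ P, IsGon 6 S P := by
  have zx : 0 < det3 a d x := od1 haxd
  have zy : 0 < det3 a d y := od1 hayd
  have zb : det3 a d b < 0 := od1' habd
  have zc : det3 a d c < 0 := od1' hacd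
  exact gon6' S a b c d y x ma mb mc md my mx
    ⟨habc,
      habd,
      sep qad qay qyd (mul_pos zy (ev1 qab)) (dz1 _ _) (le_of_lt habd),
      sep qad qax qxd (mul_pos zx (ev1 qab)) (dz1 _ _) (le_of_lt habd)⟩
    ⟨(ev1 habc),
      hbcd,
      sep qad qay qyd (mul_pos zy (ev1 qbc)) (le_of_lt (ev1 habc)) (le_of_lt hbcd),
      sep qad qax qxd (mul_pos zx (ev1 qbc)) (le_of_lt (ev1 habc)) (le_of_lt hbcd)⟩
    ⟨(ev1 hacd),
      (ev1 hbcd),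
      sep qad qay qyd (mul_pos zy (ev1 qcd)) (le_of_lt (ev1 hacd)) (dz2 _ _),
      sep qad qax qxd (mul_pos zx (ev1 qcd)) (le_of_lt (ev1 hacd)) (dz2 _ _)⟩
    ⟨(od2 hayd),
      sep qad qab qbd (mul_pos_of_neg_of_neg zb (od2' qyd)) (le_of_lt (od2 hayd)) (dz1 _ _),
      sep qad qac qcd (mul_pos_of_neg_of_neg zc (od2' qyd)) (le_of_lt (od2 hayd)) (dz1 _ _),
      (od2 hxyd)⟩
    ⟨(od2 haxy),
      sep qad qab qbd (mul_pos_of_neg_of_neg zb (od2' qxy)) (le_of_lt (od2 haxy)) (le_of_lt (od3 hxyd)),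
      sep qad qac qcd (mul_pos_of_neg_of_neg zc (od2' qxy)) (le_of_lt (od2 haxy)) (le_of_lt (od3 hxyd)),
      (od3 hxyd)⟩
    ⟨sep qad qab qbd (mul_pos_of_neg_of_neg zb (od2' qax)) (dz2 _ _) (le_of_lt (od3 haxd)),
      sep qad qac qcd (mul_pos_of_neg_of_neg zc (od2' qax)) (dz2 _ _) (le_of_lt (od3 haxd)),
      (od3 haxd),
      (od3 haxy)⟩
theorem hex53 (S : Set (ℝ × ℝ)) (p a x e b c d : ℝ × ℝ)
    (ma : a ∈ S) (mx : x ∈ S) (me : e ∈ S) (mb : b ∈ S) (mc : c ∈ S) (md : d ∈ S)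
    (qax : 0 < det3 p a x)
    (qae : 0 < det3 p a e)
    (qxe : 0 < det3 p x e)
    (qab : 0 < det3 p a b)
    (qac : 0 < det3 p a c)
    (qad : 0 < det3 p a d)
    (qbc : 0 < det3 p b c)
    (qbd : 0 < det3 p b d)
    (qbe : 0 < det3 p b e)
    (qcd : 0 < det3 p c d)
    (qce : 0 < det3 p c e)
    (qde : 0 < det3 p d e)
    (haxe : 0 < det3 a x e)
    (habc : det3 a b c < 0)
    (habd : det3 a b d < 0)
    (habe : det3 a b e < 0)
    (hacd : det3 a c d < 0)
    (hace : det3 a c e < 0)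
    (hade : det3 a d e < 0)
    (hbcd : det3 b c d < 0)
    (hbce : det3 b c e < 0)
    (hbde : det3 b d e < 0)
    (hcde : det3 c d e < 0) :
    ∃ P, IsGon 6 S P := by
  have zb : 0 < det3 a e b := od1 habe
  have zc : 0 < det3 a e c := od1 hace
  have zd : 0 < det3 a e d := od1 hade
  have zx : det3 a e x < 0 := od1' haxe
  exact gon6' S a x e d c b ma mx me md mc mb
    ⟨haxe,
      sep qae qad qde (mul_pos zd (ev1 qax)) (dz1 _ _) (le_of_lt haxe),
      sep qae qac qce (mul_pos zc (ev1 qax)) (dz1 _ _) (le_of_lt haxe),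
      sep qae qab qbe (mul_pos zb (ev1 qax)) (dz1 _ _) (le_of_lt haxe)⟩
    ⟨(ev1 haxe),
      sep qae qad qde (mul_pos zd (ev1 qxe)) (le_of_lt (ev1 haxe)) (dz2 _ _),
      sep qae qac qce (mul_pos zc (ev1 qxe)) (le_of_lt (ev1 haxe)) (dz2 _ _),
      sep qae qab qbe (mul_pos zb (ev1 qxe)) (le_of_lt (ev1 haxe)) (dz2 _ _)⟩
    ⟨(od2 hade),
      sep qae qax qxe (mul_pos_of_neg_of_neg zx (od2' qde)) (le_of_lt (od2 hade)) (dz1 _ _),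
      (od2 hcde),
      (od2 hbde)⟩
    ⟨(od2 hacd),
      sep qae qax qxe (mul_pos_of_neg_of_neg zx (od2' qcd)) (le_of_lt (od2 hacd)) (le_of_lt (od3 hcde)),
      (od3 hcde),
      (od2 hbcd)⟩
    ⟨(od2 habc),
      sep qae qax qxe (mul_pos_of_neg_of_neg zx (od2' qbc)) (le_of_lt (od2 habc)) (le_of_lt (od3 hbce)),
      (od3 hbce),
      (od3 hbcd)⟩
    ⟨sep qae qax qxe (mul_pos_of_neg_of_neg zx (od2' qab)) (dz2 _ _) (le_of_lt (od3 habe)),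
      (od3 habe),
      (od3 habd),
      (od3 habc)⟩
theorem hexcap (S : Set (ℝ × ℝ)) (p a b c d e : ℝ × ℝ)
    (mp : p ∈ S) (ma : a ∈ S) (mb : b ∈ S) (mc : c ∈ S) (md : d ∈ S) (me : e ∈ S)
    (hpab : 0 < det3 p a b)
    (hpac : 0 < det3 p a c)
    (hpad : 0 < det3 p a d)
    (hpae : 0 < det3 p a e)
    (hpbc : 0 < det3 p b c)
    (hpbd : 0 < det3 p b d)
    (hpbe : 0 < det3 p b e)
    (hpcd : 0 < det3 p c d)
    (hpce : 0 < det3 p c e)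
    (hpde : 0 < det3 p d e)
    (habc : 0 < det3 a b c)
    (habd : 0 < det3 a b d)
    (habe : 0 < det3 a b e)
    (hacd : 0 < det3 a c d)
    (hace : 0 < det3 a c e)
    (hade : 0 < det3 a d e)
    (hbcd : 0 < det3 b c d)
    (hbce : 0 < det3 b c e)
    (hbde : 0 < det3 b d e)
    (hcde : 0 < det3 c d e) :
    ∃ P, IsGon 6 S P := by
  exact gon6' S p a b c d e mp ma mb mc md me
    ⟨hpab, hpac, hpad, hpae⟩
    ⟨(ev1 hpab), habc, habd, habe⟩
    ⟨(ev1 hpbc), (ev1 habc), hbcd, hbce⟩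
    ⟨(ev1 hpcd), (ev1 hacd), (ev1 hbcd), hcde⟩
    ⟨(ev1 hpde), (ev1 hade), (ev1 hbde), (ev1 hcde)⟩
    ⟨(ev2 hpae), (ev2 hpbe), (ev2 hpce), (ev2 hpde)⟩
theorem hexcup (S : Set (ℝ × ℝ)) (a b c d e f : ℝ × ℝ)
    (ma : a ∈ S) (mb : b ∈ S) (mc : c ∈ S) (md : d ∈ S) (me : e ∈ S) (mf : f ∈ S)
    (habc : det3 a b c < 0)
    (habd : det3 a b d < 0)
    (habe : det3 a b e < 0)
    (habf : det3 a b f < 0)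
    (hacd : det3 a c d < 0)
    (hace : det3 a c e < 0)
    (hacf : det3 a c f < 0)
    (hade : det3 a d e < 0)
    (hadf : det3 a d f < 0)
    (haef : det3 a e f < 0)
    (hbcd : det3 b c d < 0)
    (hbce : det3 b c e < 0)
    (hbcf : det3 b c f < 0)
    (hbde : det3 b d e < 0)
    (hbdf : det3 b d f < 0)
    (hbef : det3 b e f < 0)
    (hcde : det3 c d e < 0)
    (hcdf : det3 c d f < 0)
    (hcef : det3 c e f < 0)
    (hdef : det3 d e f < 0) :
    ∃ P, IsGon 6 S P := by
  exact gon6' S f e d c b a mf me md mc mb ma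
    ⟨(od2 hdef), (od2 hcef), (od2 hbef), (od2 haef)⟩
    ⟨(od3 hdef), (od2 hcde), (od2 hbde), (od2 hade)⟩
    ⟨(od3 hcdf), (od3 hcde), (od2 hbcd), (od2 hacd)⟩
    ⟨(od3 hbcf), (od3 hbce), (od3 hbcd), (od2 habc)⟩
    ⟨(od3 habf), (od3 habe), (od3 habd), (od3 habc)⟩
    ⟨(od1 haef), (od1 hadf), (od1 hacf), (od1 habf)⟩
end K6

namespace K6
section
variable {S : Set (ℝ × ℝ)} {p : ℝ × ℝ} {f : ℕ → ℝ × ℝ}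
theorem sg1 (F : Fan S p f) : ∀ v a b c d, a < b → b < c → c < d → d ≤ 15 →
    tri3 f a b c = v → tri3 f a c d = v → tri3 f a b d = v := by
  intro v a b c d h1 h2 h3 h4 e1 e2
  rw [tri3_v F v (by omega) (by omega) (by omega)] at *
  refine sgn_comb v (F.pos a c (by omega) (by omega)) (F.pos a d (by omega) (by omega)) (F.pos a b (by omega) (by omega)) ?_ e1 e2
  simp only [det3_eq]; ring
theorem sg2 (F : Fan S p f) : ∀ v a b c d, a < b → b < c → c < d → d ≤ 15 →
    tri3 f a b c = v → tri3 f b c d = v → tri3 f a b d = v := by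
  intro v a b c d h1 h2 h3 h4 e1 e2
  rw [tri3_v F v (by omega) (by omega) (by omega)] at *
  refine sgn_comb v (F.pos b c (by omega) (by omega)) (F.pos b d (by omega) (by omega)) (F.pos a b (by omega) (by omega)) ?_ e1 e2
  simp only [det3_eq]; ring
theorem sg3 (F : Fan S p f) : ∀ v a b c d, a < b → b < c → c < d → d ≤ 15 →
    tri3 f a b c = v → tri3 f b c d = v → tri3 f a c d = v := by
  intro v a b c d h1 h2 h3 h4 e1 e2
  rw [tri3_v F v (by omega) (by omega) (by omega)] at *
  refine sgn_comb v (F.pos b c (by omega) (by omega)) (F.pos c d (by omega) (by omega)) (F.pos a c (by omega) (by omega)) ?_ e1 e2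
  simp only [det3_eq]; ring
theorem sg4 (F : Fan S p f) : ∀ v a b c d, a < b → b < c → c < d → d ≤ 15 →
    tri3 f a b d = v → tri3 f b c d = v → tri3 f a c d = v := by
  intro v a b c d h1 h2 h3 h4 e1 e2
  rw [tri3_v F v (by omega) (by omega) (by omega)] at *
  refine sgn_comb v (F.pos b d (by omega) (by omega)) (F.pos c d (by omega) (by omega)) (F.pos a d (by omega) (by omega)) ?_ e1 e2
  simp only [det3_eq]; ring
theorem cls (F : Fan S p f) (hno : ¬ ∃ P, IsGon 6 S P) : Cls (tri3 f) := by
  refine ⟨sg1 F, sg2 F, sg3 F, sg4 F, ?_, ?_, ?_, ?_⟩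
  · intro a b c d e h1 h2 h3 h4 h5 tabc tbcd tcde
    have tabd := sg2 F false a b c d (by omega) (by omega) (by omega) (by omega) tabc tbcd
    have tacd := sg3 F false a b c d (by omega) (by omega) (by omega) (by omega) tabc tbcd
    have tbce := sg2 F false b c d e (by omega) (by omega) (by omega) (by omega) tbcd tcde
    have tbde := sg3 F false b c d e (by omega) (by omega) (by omega) (by omega) tbcd tcde
    have tabe := sg2 F false a b c e (by omega) (by omega) (by omega) (by omega) tabc tbce
    have tace := sg3 F false a b c e (by omega) (by omega) (by omega) (by omega) tabc tbce
    have tade := sg3 F false a b d e (by omega) (by omega) (by omega) (by omega) tabd tbde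
    exact hno (hexcap S p (f a) (f b) (f c) (f d) (f e) F.hp (F.hf a (by omega)) (F.hf b (by omega)) (F.hf c (by omega)) (F.hf d (by omega)) (F.hf e (by omega))
      (F.pos a b (by omega) (by omega)) (F.pos a c (by omega) (by omega)) (F.pos a d (by omega) (by omega)) (F.pos a e (by omega) (by omega)) (F.pos b c (by omega) (by omega)) (F.pos b d (by omega) (by omega)) (F.pos b e (by omega) (by omega)) (F.pos c d (by omega) (by omega)) (F.pos c e (by omega) (by omega)) (F.pos d e (by omega) (by omega))
      ((tri3_f F (by omega) (by omega) (by omega)).1 tabc) ((tri3_f F (by omega) (by omega) (by omega)).1 tabd) ((tri3_f F (by omega) (by omega) (by omega)).1 tabe) ((tri3_f F (by omega) (by omega) (by omega)).1 tacd) ((tri3_f F (by omega) (by omega) (by omega)).1 tace) ((tri3_f F (by omega) (by omega) (by omega)).1 tade) ((tri3_f F (by omega) (by omega) (by omega)).1 tbcd) ((tri3_f F (by omega) (by omega) (by omega)).1 tbce) ((tri3_f F (by omega) (by omega) (by omega)).1 tbde) ((tri3_f F (by omega) (by omega) (by omega)).1 tcde))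
  · intro a b c d e f' h1 h2 h3 h4 h5 h6 tabc tbcd tcde tdef
    have tabd := sg2 F true a b c d (by omega) (by omega) (by omega) (by omega) tabc tbcd
    have tacd := sg3 F true a b c d (by omega) (by omega) (by omega) (by omega) tabc tbcd
    have tbce := sg2 F true b c d e (by omega) (by omega) (by omega) (by omega) tbcd tcde
    have tbde := sg3 F true b c d e (by omega) (by omega) (by omega) (by omega) tbcd tcde
    have tcdf := sg2 F true c d e f' (by omega) (by omega) (by omega) (by omega) tcde tdef
    have tcef := sg3 F true c d e f' (by omega) (by omega) (by omega) (by omega) tcde tdef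
    have tabe := sg2 F true a b c e (by omega) (by omega) (by omega) (by omega) tabc tbce
    have tace := sg3 F true a b c e (by omega) (by omega) (by omega) (by omega) tabc tbce
    have tade := sg3 F true a b d e (by omega) (by omega) (by omega) (by omega) tabd tbde
    have tbcf := sg2 F true b c d f' (by omega) (by omega) (by omega) (by omega) tbcd tcdf
    have tbdf := sg3 F true b c d f' (by omega) (by omega) (by omega) (by omega) tbcd tcdf
    have tbef := sg3 F true b c e f' (by omega) (by omega) (by omega) (by omega) tbce tcef
    have tabf := sg2 F true a b c f' (by omega) (by omega) (by omega) (by omega) tabc tbcf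
    have tacf := sg3 F true a b c f' (by omega) (by omega) (by omega) (by omega) tabc tbcf
    have tadf := sg3 F true a b d f' (by omega) (by omega) (by omega) (by omega) tabd tbdf
    have taef := sg3 F true a b e f' (by omega) (by omega) (by omega) (by omega) tabe tbef
    exact hno (hexcup S (f a) (f b) (f c) (f d) (f e) (f f') (F.hf a (by omega)) (F.hf b (by omega)) (F.hf c (by omega)) (F.hf d (by omega)) (F.hf e (by omega)) (F.hf f' (by omega))
      (tri3_t.1 tabc) (tri3_t.1 tabd) (tri3_t.1 tabe) (tri3_t.1 tabf) (tri3_t.1 tacd) (tri3_t.1 tace) (tri3_t.1 tacf) (tri3_t.1 tade) (tri3_t.1 tadf) (tri3_t.1 taef) (tri3_t.1 tbcd) (tri3_t.1 tbce) (tri3_t.1 tbcf) (tri3_t.1 tbde) (tri3_t.1 tbdf) (tri3_t.1 tbef) (tri3_t.1 tcde) (tri3_t.1 tcdf) (tri3_t.1 tcef) (tri3_t.1 tdef))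
  · intro a b c x y d h1 h2 h3 h4 h5 h6 h7 tabc tbcd taxy txyd
    have tabd := sg2 F false a b c d (by omega) (by omega) (by omega) (by omega) tabc tbcd
    have tacd := sg3 F false a b c d (by omega) (by omega) (by omega) (by omega) tabc tbcd
    have taxd := sg2 F true a x y d (by omega) (by omega) (by omega) (by omega) taxy txyd
    have tayd := sg3 F true a x y d (by omega) (by omega) (by omega) (by omega) taxy txyd
    exact hno (hex44 S p (f a) (f b) (f c) (f d) (f x) (f y) (F.hf a (by omega)) (F.hf b (by omega)) (F.hf c (by omega)) (F.hf d (by omega)) (F.hf x (by omega)) (F.hf y (by omega))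
      (F.pos a b (by omega) (by omega)) (F.pos a c (by omega) (by omega)) (F.pos a d (by omega) (by omega)) (F.pos b c (by omega) (by omega)) (F.pos b d (by omega) (by omega)) (F.pos c d (by omega) (by omega)) (F.pos a x (by omega) (by omega)) (F.pos a y (by omega) (by omega)) (F.pos x y (by omega) (by omega)) (F.pos x d (by omega) (by omega)) (F.pos y d (by omega) (by omega))
      ((tri3_f F (by omega) (by omega) (by omega)).1 tabc) ((tri3_f F (by omega) (by omega) (by omega)).1 tabd) ((tri3_f F (by omega) (by omega) (by omega)).1 tacd) ((tri3_f F (by omega) (by omega) (by omega)).1 tbcd)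
      (tri3_t.1 taxy) (tri3_t.1 taxd) (tri3_t.1 tayd) (tri3_t.1 txyd))
  · intro a b c d x e h1 h2 h3 h4 h5 h6 h7 tabc tbcd tcde taxe
    have tabd := sg2 F true a b c d (by omega) (by omega) (by omega) (by omega) tabc tbcd
    have tacd := sg3 F true a b c d (by omega) (by omega) (by omega) (by omega) tabc tbcd
    have tbce := sg2 F true b c d e (by omega) (by omega) (by omega) (by omega) tbcd tcde
    have tbde := sg3 F true b c d e (by omega) (by omega) (by omega) (by omega) tbcd tcde
    have tabe := sg2 F true a b c e (by omega) (by omega) (by omega) (by omega) tabc tbce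
    have tace := sg3 F true a b c e (by omega) (by omega) (by omega) (by omega) tabc tbce
    have tade := sg3 F true a b d e (by omega) (by omega) (by omega) (by omega) tabd tbde
    exact hno (hex53 S p (f a) (f x) (f e) (f b) (f c) (f d) (F.hf a (by omega)) (F.hf x (by omega)) (F.hf e (by omega)) (F.hf b (by omega)) (F.hf c (by omega)) (F.hf d (by omega))
      (F.pos a x (by omega) (by omega)) (F.pos a e (by omega) (by omega)) (F.pos x e (by omega) (by omega)) (F.pos a b (by omega) (by omega)) (F.pos a c (by omega) (by omega)) (F.pos a d (by omega) (by omega)) (F.pos b c (by omega) (by omega)) (F.pos b d (by omega) (by omega)) (F.pos b e (by omega) (by omega)) (F.pos c d (by omega) (by omega)) (F.pos c e (by omega) (by omega)) (F.pos d e (by omega) (by omega))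
      ((tri3_f F (by omega) (by omega) (by omega)).1 taxe)
      (tri3_t.1 tabc) (tri3_t.1 tabd) (tri3_t.1 tabe) (tri3_t.1 tacd) (tri3_t.1 tace) (tri3_t.1 tade) (tri3_t.1 tbcd) (tri3_t.1 tbce) (tri3_t.1 tbde) (tri3_t.1 tcde))
end
end K6

namespace K6
theorem exists_sort {α : Type} (T : Finset α) (n : ℕ) (hn : T.card = n) (R : α → α → Prop)
    (tri : ∀ a ∈ T, ∀ b ∈ T, a ≠ b → R a b ∨ R b a)
    (asy : ∀ a ∈ T, ∀ b ∈ T, R a b → ¬ R b a)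
    (trn : ∀ a ∈ T, ∀ b ∈ T, ∀ c ∈ T, R a b → R b c → R a c) :
    ∃ f : Fin n → α, (∀ i, f i ∈ T) ∧ ∀ i j, i < j → R (f i) (f j) := by
  classical
  letI : LinearOrder T :=
    { le := fun a b => a = b ∨ R a.1 b.1
      le_refl := fun a => Or.inl rfl
      le_trans := by
        rintro a b c (rfl | h1) (rfl | h2)
        · exact Or.inl rfl
        · exact Or.inr h2
        · exact Or.inr h1
        · exact Or.inr (trn a a.2 b b.2 c c.2 h1 h2)
      le_antisymm := by
        rintro a b (rfl | h1) (h2 | h2)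
        · rfl
        · rfl
        · exact h2.symm
        · exact absurd h2 (asy a a.2 b b.2 h1)
      le_total := by
        intro a b
        by_cases e : a = b
        · exact Or.inl (Or.inl e)
        · rcases tri a a.2 b b.2 (fun h => e (Subtype.ext h)) with h | h
          · exact Or.inl (Or.inr h)
          · exact Or.inr (Or.inr h)
      toDecidableLE := fun _ _ => Classical.propDecidable _ }
  let e := monoEquivOfFin T (k := n) (by rw [Fintype.card_coe, hn])
  refine ⟨fun i => (e i).1, fun i => (e i).2, fun i j hij => ?_⟩
  have h1 : e i < e j := e.strictMono hij
  rcases h1.le with h | h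
  · exact absurd h h1.ne
  · exact h

theorem det_ne {S : Set (ℝ × ℝ)} (hgp : InGenPos S) {p q r : ℝ × ℝ} (hp : p ∈ S) (hq : q ∈ S) (hr : r ∈ S)
    (h1 : p ≠ q) (h2 : p ≠ r) (h3 : q ≠ r) : det3 p q r ≠ 0 := by
  intro h0
  apply hgp p hp q hq r hr h1 h2 h3
  rw [det3_eq] at h0
  rw [collinear_iff_of_mem (p₀ := p) (by simp)]
  refine ⟨q - p, ?_⟩
  intro x hx
  simp only [Set.mem_insert_iff, Set.mem_singleton_iff] at hx
  rcases hx with rfl | rfl | rfl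
  · exact ⟨0, by simp⟩
  · exact ⟨1, by simp⟩
  · by_cases e : q.1 - p.1 = 0
    · have e2 : q.2 - p.2 ≠ 0 := fun e2 => h1 (Prod.ext (by linarith) (by linarith))
      refine ⟨(x.2 - p.2) / (q.2 - p.2), ?_⟩
      have e3 : x.1 - p.1 = 0 := by
        rw [e, zero_mul, zero_sub, neg_eq_zero] at h0
        exact (mul_eq_zero.1 h0).resolve_left e2
      apply Prod.ext
      · simp [e]; linarith
      · simp only [vadd_eq_add, Prod.snd_add, Prod.smul_snd, Prod.snd_sub, smul_eq_mul]
        field_simp; ring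
    · refine ⟨(x.1 - p.1) / (q.1 - p.1), ?_⟩
      apply Prod.ext
      · simp only [vadd_eq_add, Prod.fst_add, Prod.smul_fst, Prod.fst_sub, smul_eq_mul]
        field_simp; ring
      · simp only [vadd_eq_add, Prod.snd_add, Prod.smul_snd, Prod.snd_sub, smul_eq_mul]
        field_simp
        linear_combination h0

theorem exists_fan (S : Set (ℝ × ℝ)) (hfin : S.Finite) (hcard : S.ncard = 17) (hgp : InGenPos S) :
    ∃ p f, Fan S p f := by
  classical
  have hne : S.Nonempty := by
    rw [← Set.ncard_pos hfin]; omega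
  obtain ⟨m, hm, hmin⟩ := Set.exists_min_image S (fun q => toLex q) hfin hne
  have half : ∀ q ∈ S, q ≠ m → m.1 < q.1 ∨ (m.1 = q.1 ∧ m.2 < q.2) := by
    intro q hq hqm
    have h1 := hmin q hq
    rw [Prod.Lex.le_iff] at h1
    rcases h1 with h1 | ⟨h1, h2⟩
    · exact Or.inl h1
    · refine Or.inr ⟨h1, lt_of_le_of_ne h2 (fun e => hqm (Prod.ext h1.symm e.symm))⟩
  have hT : (hfin.toFinset.erase m).card = 16 := by
    rw [Finset.card_erase_of_mem (by simpa using hm), ← Set.ncard_eq_toFinset_card S hfin, hcard]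
  have mem : ∀ q, q ∈ hfin.toFinset.erase m → q ∈ S ∧ q ≠ m := by
    intro q hq
    rw [Finset.mem_erase, Set.Finite.mem_toFinset] at hq
    exact ⟨hq.2, hq.1⟩
  obtain ⟨f, hf1, hf2⟩ := exists_sort (hfin.toFinset.erase m) 16 hT (fun q r => 0 < det3 m q r)
    (by
      intro a ha b hb hab
      obtain ⟨a1, a2⟩ := mem a ha
      obtain ⟨b1, b2⟩ := mem b hb
      have := det_ne hgp hm a1 b1 a2.symm b2.symm hab
      rcases lt_or_gt_of_ne this with h | h
      · right; exact od1 h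
      · left; exact h)
    (by
      intro a _ b _ h1 h2
      have := od1' h1
      linarith)
    (by
      intro a ha b hb c hc h1 h2
      obtain ⟨a1, a2⟩ := mem a ha
      obtain ⟨b1, b2⟩ := mem b hb
      obtain ⟨c1, c2⟩ := mem c hc
      have ha := half a a1 a2
      have hb := half b b1 b2
      have hc := half c c1 c2
      rw [det3_eq] at *
      set ax := a.1 - m.1 with hax
      set ay := a.2 - m.2 with hay
      set bx := b.1 - m.1 with hbx
      set bY := b.2 - m.2 with hby
      set cx := c.1 - m.1 with hcx
      set cy := c.2 - m.2 with hcy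
      have ha : 0 < ax ∨ (ax = 0 ∧ 0 < ay) := by
        rcases ha with h | ⟨h, h'⟩
        · left; linarith
        · right; exact ⟨by linarith, by linarith⟩
      have hb : 0 < bx ∨ (bx = 0 ∧ 0 < bY) := by
        rcases hb with h | ⟨h, h'⟩
        · left; linarith
        · right; exact ⟨by linarith, by linarith⟩
      have hc : 0 < cx ∨ (cx = 0 ∧ 0 < cy) := by
        rcases hc with h | ⟨h, h'⟩
        · left; linarith
        · right; exact ⟨by linarith, by linarith⟩
      rcases hb with hb | ⟨hb, hb'⟩
      · have hcx : 0 ≤ cx := by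
          rcases hc with h | ⟨h, -⟩
          · exact h.le
          · exact h.ge
        have hax0 : 0 < ax ∨ ax = 0 := by
          rcases ha with h | ⟨h, -⟩
          · exact Or.inl h
          · exact Or.inr h
        rcases hax0 with h | h
        · apply pos_of_mul hb
          have e : bx * (ax * cy - ay * cx) = ax * (bx * cy - bY * cx) + cx * (ax * bY - ay * bx) := by ring
          rw [e]
          have := mul_pos h h2
          have := mul_nonneg hcx h1.le
          linarith
        · rcases ha with ha | ⟨-, ha⟩
          · linarith
          · rw [h] at h1
            have := mul_pos ha hb
            linarith
      · rw [hb] at h2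
        rcases hc with hc | ⟨hc, -⟩
        · have := mul_pos hb' hc
          linarith
        · rw [hc] at h2
          linarith)
  have hne2 : ∀ i j, i < j → f i ≠ f j := by
    intro i j hij e
    have := hf2 i j hij
    rw [e] at this
    exact absurd this (by rw [det3_eq]; intro h; linarith)
  have hS : ∀ i, f i ∈ S := fun i => (mem _ (hf1 i)).1
  refine ⟨m, fun i => f (Fin.ofNat 16 i), hm, fun i _ => hS _, ?_, ?_⟩
  · intro i j hij hj
    apply hf2
    rw [Fin.lt_def]
    simp [Nat.mod_eq_of_lt (show i < 16 by omega), Nat.mod_eq_of_lt (show j < 16 by omega), hij]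
  · intro i j k hij hjk hk
    have lt : ∀ a b, a < b → b ≤ 15 → Fin.ofNat 16 a < Fin.ofNat 16 b := by
      intro a b h1 h2
      rw [Fin.lt_def]
      simp [Nat.mod_eq_of_lt (show a < 16 by omega), Nat.mod_eq_of_lt (show b < 16 by omega), h1]
    exact det_ne hgp (hS _) (hS _) (hS _) (hne2 _ _ (lt i j hij (by omega))) (hne2 _ _ (lt i k (by omega) (by omega)))
      (hne2 _ _ (lt j k hjk (by omega)))
end K6

set_option maxRecDepth 1000000
set_option maxHeartbeats 0
namespace K6
def t0 : PLift (check 4096 [1,0,0,0,0] [0,1,1,1,1] [[0,0,1],[0,0,2],[0,0,4],[0,0,8],[0,0,16],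
  [0,0,32],[0,0,64],[0,0,128],[0,0,256],[0,0,512],[0,0,1024],[1,0,1],[0,0,2],[0,0,8],[0,0,48],
  [1,0,94],[0,0,188],[0,0,376],[0,0,752],[1,0,5531],[0,0,550],[1,0,4719],[1,0,184],[1,73,4140],
  [1,186,25],[1,81,36],[1,126,4126],[1,97,106],[1,63,56],[1,108,4183],[1,88,4099],[1,84,95],
  [1,125,132],[1,63,4124],[1,133,8],[1,175,13],[1,66,4214],[1,84,4144],[1,189,82],[1,161,106],
  [1,188,4112],[1,133,37],[1,161,36],[1,175,4196],[1,204,4127],[1,84,107],[1,189,4169],[1,183,4177],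
  [1,166,115],[1,187,33],[1,116,4191],[1,175,61],[1,216,4109],[1,176,4136],[1,133,195],[1,188,4111],
  [1,216,4346],[1,183,37],[1,113,1050],[1,87,4101],[1,170,134],[1,104,7],[1,183,4139],[1,189,40],
  [1,107,4115],[1,101,37],[1,163,140],[1,123,48],[1,186,4281],[1,94,14],[1,65,4],[1,65,50],
  [1,60,4139],[1,59,4144],[1,60,82],[1,70,49],[1,79,23],[1,49,4161],[1,55,4109],[1,80,304],
  [1,46,4099],[1,0,8],[1,0,39],[1,0,1],[1,0,404],[1,0,4242],[1,0,74],[1,0,4117],[1,0,25],[1,0,275],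
  [1,0,4296],[1,0,708],[1,0,4152],[1,0,103],[1,0,18],[1,0,4261],[1,0,35],[1,0,8],[1,0,45],[1,0,158],
  [1,0,234],[1,0,4436],[1,0,4147],[0,0,4372],[1,0,12],[1,0,136],[0,0,4164],[1,0,4646],[0,0,170],
  [1,0,4291],[0,0,126],[1,0,4368],[0,0,5],[1,0,26],[0,0,4262],[1,0,396],[0,0,4350],[0,0,286],
  [1,0,60],[0,0,305],[0,0,4683],[1,0,4163],[0,0,189,4138],[0,0,4176],[0,0,766],[1,0,11],[0,0,4365],
  [0,0,4645,4108],[0,0,74],[1,0,1],[0,0,2],[0,0,4],[0,0,19],[1,0]] = true) := ⟨by decide +kernel⟩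
theorem d0 : Dead [false, false, false, false, true] := leaf _ t0 (by decide) rfl rfl
def t1 : PLift (check 4096 [1,0,0,0,1,0] [0,1,1,1,0,1] [[0,0,1],[0,0,2],[0,0,4],[0,0,8],[0,0,16],
  [0,0,32],[0,0,64],[0,0,128],[0,0,256],[0,0,512],[0,0,1024],[1,0]] = true) := ⟨by decide +kernel⟩
theorem d1 : Dead [false, true, false, false, false, true] := leaf _ t1 (by decide) rfl rfl
def t2 : PLift (check 4096 [1,0,0,0,1,1,0,0,0] [0,1,1,1,0,0,1,1,1] [[0,0,1],[0,0,2],[0,0,4],[0,0,8],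
  [0,0,16],[0,0,32],[0,0,64],[0,0,128],[0,0,256],[0,0,512],[0,0,1024],[1,0]] = true) := ⟨by decide +kernel⟩
theorem d2 : Dead [false, false, false, true, true, false, false, false, true] := leaf _ t2 (by decide) rfl rfl
def t3 : PLift (check 4096 [1,0,0,0,1,1,0,0,1,0] [0,1,1,1,0,0,1,1,0,1] [[0,0,1],[0,0,2],[0,0,4],
  [0,0,8],[0,0,16],[0,0,32],[0,0,64],[0,0,128],[0,0,256],[0,0,512],[0,0,1024],[1,0,1],[0,0,2],
  [0,0,4],[0,0,8],[1,0,127],[0,0,1708],[0,0,240],[0,0,35],[1,0,17],[1,0,370],[1,107,4254],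
  [1,195,4167],[1,186,4138],[1,121,22],[1,198,4284],[1,61,24],[1,162,5],[1,198,322],[1,162,4902],
  [1,98,4129],[1,96,112],[1,101,12],[1,112,10],[1,133,4137],[1,162,4128],[1,125,4221],[1,183,103],
  [1,83,4133],[1,183,4278],[1,166,4762],[1,88,4138],[1,59,9],[1,80,80],[1,130,81],[1,55,28],
  [1,62,4121],[1,55,287],[1,40,4362],[1,204,97],[1,0,88],[1,0,4319],[1,0,10],[1,0,4120],[1,0,156],
  [1,0,4133],[1,0,4111],[1,0,41],[1,0,4213],[1,0,4980],[1,0,131],[1,0,53],[1,0,4128],[1,0,4242],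
  [1,0,18],[1,0,52],[1,0,160],[1,0,4178],[0,0,4945],[1,0,55],[1,0,4155],[0,0,4414],[1,0,8],
  [0,0,4105],[1,0,4125],[0,0,4138],[1,0,4191],[0,0,131],[1,0,305],[0,0,4797],[1,0,58],[0,0,300],
  [1,0,76,8],[0,0,91],[0,0,4603],[1,0,330],[0,0,4348],[0,0,4501],[1,0,4743],[0,0,4243],[0,0,4498],
  [0,0,758],[1,0,4139],[0,0,4268],[0,0,4399],[1,0,345],[0,0,4288,28],[0,0,4371],[0,0,309],[1,0,17],
  [0,0,4591],[0,0,586,35],[0,0,4618],[1,0]] = true) := ⟨by decide +kernel⟩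
theorem d3 : Dead [false, true, false, false, true, true, false, false, false, true] := leaf _ t3 (by decide) rfl rfl
def t4 : PLift (check 4096 [1,0,0,0,1,1,0,0,1,1] [0,1,1,1,0,0,1,1,0,0] [[0,0,1],[0,0,2],[0,0,4],
  [0,0,8],[0,0,16],[0,0,32],[0,0,64],[0,0,128],[0,0,256],[0,0,512],[0,0,1024],[1,0,2],[0,0,4],
  [0,0,8],[0,0,127],[1,0,1390],[0,0,423],[0,0,332],[1,0,4178],[1,0,104],[1,62,4452],[1,91,166],
  [1,133,50],[1,134,30],[1,176,4097],[1,225,4191],[1,134,47],[1,123,249],[1,84,4111],[1,218,26],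
  [1,146,217],[1,110,25],[1,85,205],[1,116,4],[1,221,34],[1,186,4122],[1,112,4155],[1,225,53],
  [1,101,467],[1,133,61],[1,104,49],[1,136,4098],[1,187,4298],[1,175,4109],[1,85,95],[1,101,4170],
  [1,194,4101],[1,187,64],[1,99,39],[1,136,4192],[1,85,4125],[1,204,4147],[1,59,54],[1,97,4124],
  [1,97,94],[1,117,428],[1,93,4562],[1,97,63],[1,59,14],[1,116,4100],[1,89,13],[1,79,4148],
  [1,162,148],[1,106,579],[1,82,20],[1,198,6],[1,94,4175],[1,197,30],[1,83,2],[1,98,4161],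
  [1,165,43],[1,126,58],[1,118,4100],[1,96,4275],[1,52,126],[1,107,4145],[1,161,4762],[1,80,255],
  [1,121,280],[1,54,32],[1,65,4264],[1,54,92],[1,57,34],[1,36,79],[1,0,4228],[1,0,82],[1,0,2],
  [1,0,182],[1,0,4133],[1,0,3],[1,0,369],[1,0,4287],[1,0,124],[1,0,4165],[1,0,4118],[1,0,4352],
  [1,0,42],[1,0,98],[1,0,165],[0,0,1288],[1,0,3],[1,0,4174],[0,0,5018],[1,0,164],[0,0,40],
  [1,0,4216],[0,0,63],[1,0,4123],[0,0,22],[1,0,114,15],[0,0,4507],[0,0,187],[1,0,46],[0,0,4303],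
  [0,0,70],[1,0,4402,122],[0,0,34],[0,0,371],[1,0,255],[0,0,74],[0,0,4526],[1,0,80],[0,0,751],
  [0,0,5066],[1,0,1],[0,0,52],[0,0,369],[0,0,856],[1,0,2],[0,0,4],[0,0,62],[0,0,548],[1,0,1],
  [0,0,8],[0,0,16],[0,0,100],[1,0,128],[0,0,256],[0,0,1105],[0,0,5140,4102],[1,0,10],[0,0,688],
  [0,0,161,13],[0,0,4389],[1,0]] = true) := ⟨by decide +kernel⟩
theorem d4 : Dead [true, true, false, false, true, true, false, false, false, true] := leaf _ t4 (by decide) rfl rfl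
def t5 : PLift (check 4096 [1,0,0,0,1,1,0,1] [0,1,1,1,0,0,1,0] [[0,0,1],[0,0,2],[0,0,4],[0,0,8],
  [0,0,16],[0,0,32],[0,0,64],[0,0,128],[0,0,256],[0,0,512],[0,0,1024],[1,0,1],[0,0,6],[0,0,12],
  [0,0,24],[1,0,1838],[0,0,243],[0,0,4442],[1,0,4150],[1,32,121],[1,134,188],[1,85,4171],
  [1,181,117],[1,176,4112],[1,162,4108],[1,221,4102],[1,226,31],[1,171,29],[1,177,4117],[1,116,3],
  [1,163,4111],[1,138,4365],[1,139,4132],[1,221,4171],[1,122,34],[1,221,65],[1,194,4128],[1,177,6],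
  [1,138,4115],[1,222,4269],[1,176,4110],[1,138,62],[1,138,78],[1,138,4142],[1,131,4101],
  [1,60,4183],[1,123,116],[1,134,4151],[1,92,21],[1,185,27],[1,85,5],[1,131,4238],[1,198,106],
  [1,172,511],[1,94,4293],[1,60,7],[1,60,4121],[1,80,63],[1,198,4106],[1,108,4115],[1,82,1],
  [1,195,4189],[1,126,32],[1,147,194],[1,129,4163],[1,78,55],[1,129,6],[1,71,753],[1,79,41],
  [1,79,4106],[1,101,26],[1,52,4108],[1,52,4099],[1,135,344],[1,53,4],[1,135,81],[1,53,4123],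
  [1,74,4156],[1,61,221],[1,66,4212],[1,46,77],[1,61,33],[1,50,20],[1,53,1],[1,0,829],[1,0,4158],
  [1,120,14],[1,107,4136],[1,42,34],[1,0,7],[1,0,4111],[1,0,4117],[1,0,100],[1,0,44],[1,0,4128],
  [1,0,33],[1,0,4213],[1,0,76],[1,0,4215],[1,0,147],[1,0,67],[1,0,4112],[1,0,4106],[1,0,4144],
  [0,0,359],[1,0,4520],[1,0,4313],[0,0,7],[1,0,483],[0,0,4328],[1,0,4146],[0,0,93],[1,0,1],
  [0,0,4169],[1,0,19],[0,0,144],[1,0,96,27],[0,0,4747],[0,0,4225],[1,0,55],[0,0,4200],[0,0,5460],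
  [0,0,154],[1,0,28],[0,0,4306],[0,0,20,4100],[0,0,113],[1,0,2],[0,0,4],[0,0,36],[0,0,4471],
  [1,0]] = true) := ⟨by decide +kernel⟩
theorem d5 : Dead [true, false, true, true, false, false, false, true] := leaf _ t5 (by decide) rfl rfl
def t6 : PLift (check 4096 [1,0,0,0,1,1,1] [0,1,1,1,0,0,0] [[0,0,1],[0,0,2],[0,0,4],[0,0,8],
  [0,0,16],[0,0,32],[0,0,64],[0,0,128],[0,0,256],[0,0,512],[0,0,1024],[1,0,2],[0,0,8],[0,0,16],
  [0,0,32],[1,0,63],[0,0,1905],[0,0,4349],[0,0,1008],[1,0,4178],[1,0,4476],[1,46,22],[1,181,4121],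
  [1,213,52],[1,96,104],[1,65,4107],[1,80,4138],[1,194,47],[1,116,4219],[1,91,277],[1,83,4097],
  [1,183,4150],[1,101,4231],[1,60,6],[1,140,4114],[1,213,101],[1,92,14],[1,168,5081],[1,112,4158],
  [1,81,4126],[1,175,143],[1,98,78],[1,180,73],[1,83,4223],[1,89,4123],[1,139,22],[1,89,3],
  [1,139,4298],[1,180,4150],[1,166,2],[1,185,4151],[1,110,19],[1,186,86],[1,125,4102],[1,185,140],
  [1,88,4111],[1,133,4368],[1,124,8],[1,92,4154],[1,194,4142],[1,101,4175],[1,101,35],[1,106,4135],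
  [1,96,25],[1,121,4187],[1,75,4580],[1,198,4100],[1,105,6],[1,77,4136],[1,121,4128],[1,195,5],
  [1,69,17],[1,73,50],[1,50,4182],[1,78,4110],[1,0,23],[1,47,123],[1,0,4108],[1,35,41],[1,0,4143],
  [1,42,4337],[1,0,451],[1,57,4105],[1,58,34],[1,74,4154],[1,0,35],[1,51,71],[1,0,4138],[1,43,4151],
  [1,50,65],[1,44,4123],[1,126,762],[1,74,4214],[1,103,4113],[1,57,23],[1,0,19],[1,64,4586],
  [1,0,88],[1,62,22],[1,60,4181],[1,0,4134],[1,0,4111],[1,0,93],[1,0,21],[1,0,4163],[1,0,3],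
  [1,0,4104],[1,0,5716],[1,0,4119],[1,0,80],[1,0,17],[1,0,234],[1,0,27],[0,0,4101],[1,0,4179],
  [1,0,4],[0,0,548],[1,0,2],[0,0,32],[1,0,4165],[0,0,4107],[1,0,4267],[0,0,8],[0,0,4390],
  [1,0,27,4102],[0,0,156],[0,0,312],[1,0,23],[0,0,11],[0,0,55],[0,0,4137],[1,0,1],[0,0,4],
  [0,0,4161],[0,0,4266],[1,0,2],[0,0,8],[0,0,16],[0,0,32],[1,0,2],[0,0,4],[0,0,16],[0,0,64],
  [1,0]] = true) := ⟨by decide +kernel⟩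
theorem d6 : Dead [true, true, true, false, false, false, true] := leaf _ t6 (by decide) rfl rfl
def t7 : PLift (check 4096 [1,0,0,1,0,0,0] [0,1,1,0,1,1,1] [[0,0,1],[0,0,2],[0,0,4],[0,0,8],
  [0,0,16],[0,0,32],[0,0,64],[0,0,128],[0,0,256],[0,0,512],[0,0,1024],[1,0]] = true) := ⟨by decide +kernel⟩
theorem d7 : Dead [false, false, false, true, false, false, true] := leaf _ t7 (by decide) rfl rfl
def t8 : PLift (check 4096 [1,0,0,1,0,0,1,0] [0,1,1,0,1,1,0,1] [[0,0,1],[0,0,2],[0,0,4],[0,0,8],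
  [0,0,16],[0,0,32],[0,0,64],[0,0,128],[0,0,256],[0,0,512],[0,0,1024],[1,0,1],[0,0,6],[0,0,28],
  [0,0,56],[1,0,112],[0,0,224],[0,0,1936],[0,0,4226],[1,0,4192],[1,0,4176],[1,0,20],[1,92,4249],
  [1,136,7],[1,123,4114],[1,137,4366],[1,243,9],[1,59,44],[1,91,4880],[1,169,4126],[1,134,4099],
  [1,163,31],[1,59,4113],[1,59,51],[1,140,42],[1,136,4114],[1,100,4174],[1,123,29],[1,119,130],
  [1,111,4140],[1,89,4100],[1,123,7],[1,59,20],[1,91,30],[1,174,5936],[1,165,4143],[1,123,103],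
  [1,140,4244],[1,244,155],[1,165,4281],[1,136,4099],[1,127,4108],[1,176,4270],[1,244,27],
  [1,233,57],[1,163,13],[1,137,4157],[1,132,89],[1,141,4112],[1,187,6],[1,144,4104],[1,76,82],
  [1,72,4107],[1,73,4139],[1,67,4466],[1,130,15],[1,108,120],[1,74,4113],[1,54,4138],[1,54,4135],
  [1,0,5137],[1,42,80],[1,61,4141],[1,42,253],[1,0,24],[1,0,4103],[1,0,4116],[1,0,64],[1,0,4365],
  [1,0,4106],[1,0,456],[1,0,4464],[1,0,4277],[1,0,39],[1,0,4592],[1,0,313],[1,0,4249],[1,0,4099],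
  [1,0,4188],[1,0,27],[1,0,29],[0,0,31],[1,0,96],[1,0,4162],[0,0,70],[1,0,51],[0,0,226],[1,0,372],
  [0,0,4830],[0,0,67],[1,0,91],[0,0,6],[0,0,132],[1,0,4217],[0,0,4390],[0,0,4134],[0,0,5547],
  [1,0,112,1021],[0,0,4300],[0,0,737],[1,0,4142],[0,0,4407],[1,0,6],[0,0,123],[0,0,85],[1,0,4],
  [0,0,65],[0,0,28],[0,0,536],[1,0,1],[0,0,2],[0,0,125],[0,0,250],[1,0]] = true) := ⟨by decide +kernel⟩
theorem d8 : Dead [false, true, false, false, true, false, false, true] := leaf _ t8 (by decide) rfl rfl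
def t9 : PLift (check 4096 [1,0,0,1,0,0,1,1,0] [0,1,1,0,1,1,0,0,1] [[0,0,1],[0,0,2],[0,0,4],[0,0,8],
  [0,0,16],[0,0,32],[0,0,64],[0,0,128],[0,0,256],[0,0,512],[0,0,1024],[1,0]] = true) := ⟨by decide +kernel⟩
theorem d9 : Dead [false, true, true, false, false, true, false, false, true] := leaf _ t9 (by decide) rfl rfl
def t10 : PLift (check 4096 [1,0,0,1,0,0,1,1,1,0,0] [0,1,1,0,1,1,0,0,0,1,1] [[0,0,1],[0,0,2],
  [0,0,4],[0,0,8],[0,0,16],[0,0,32],[0,0,64],[0,0,128],[0,0,256],[0,0,512],[0,0,1024],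
  [1,0]] = true) := ⟨by decide +kernel⟩
theorem d10 : Dead [false, false, true, true, true, false, false, true, false, false, true] := leaf _ t10 (by decide) rfl rfl
def t11 : PLift (check 4096 [1,0,0,1,0,0,1,1,1,0,1,0] [0,1,1,0,1,1,0,0,0,1,0,1] [[0,0,1],[0,0,2],
  [0,0,4],[0,0,8],[0,0,16],[0,0,32],[0,0,64],[0,0,128],[0,0,256],[0,0,512],[0,0,1024],
  [1,0]] = true) := ⟨by decide +kernel⟩
theorem d11 : Dead [false, true, false, true, true, true, false, false, true, false, false, true] := leaf _ t11 (by decide) rfl rfl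
def t12 : PLift (check 4096 [1,0,0,1,0,0,1,1,1,0,1,1,0] [0,1,1,0,1,1,0,0,0,1,0,0,1] [[0,0,1],
  [0,0,2],[0,0,4],[0,0,8],[0,0,16],[0,0,32],[0,0,64],[0,0,128],[0,0,256],[0,0,512],[0,0,1024],
  [1,0,2],[0,0,4],[0,0,1896],[0,0,151],[1,0,4399],[0,0,344],[1,0,4300],[1,61,4138],[1,132,4154],
  [1,112,4119],[1,108,48],[1,168,4116],[1,176,4112],[1,59,61],[1,182,4550],[1,214,46],[1,92,11],
  [1,60,4123],[1,103,68],[1,91,4126],[1,60,4102],[1,165,149],[1,60,4140],[1,92,4128],[1,165,26],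
  [1,91,31],[1,176,4118],[1,163,4247],[1,168,4427],[1,158,90],[1,177,44],[1,165,32],[1,92,4146],
  [1,102,4148],[1,172,4206],[1,166,4668],[1,161,4125],[1,167,108],[1,136,4118],[1,144,4234],
  [1,92,4124],[1,134,4100],[1,187,40],[1,80,4437],[1,187,31],[1,79,4116],[1,131,32],[1,206,107],
  [1,126,4192],[1,97,39],[1,55,37],[1,81,4109],[1,58,4144],[1,65,4105],[1,124,4713],[1,130,34],
  [1,94,4209],[1,94,187],[1,78,4219],[1,76,66],[1,95,4124],[1,68,4262],[1,68,13],[1,0,174],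
  [1,0,4110],[1,0,41],[1,0,12],[1,0,7],[1,0,4099],[1,0,4831],[1,0,4109],[1,0,4149],[1,0,228],
  [1,0,4131],[1,0,93],[1,0,4175],[1,0,15],[1,0,40],[1,0,4137],[1,0,73],[1,0,4113],[1,0,2],
  [1,0,4347],[1,0,11],[1,0,10],[1,0,208],[1,0,68],[1,0,4138],[0,0,745],[1,0,4116],[1,0,31],
  [0,0,441],[1,0,4194],[0,0,1733],[1,0,4131],[0,0,48],[1,0,4180],[0,0,4366],[1,0,4108],[0,0,6],
  [1,0,52],[0,0,43],[0,0,4847],[1,0,33],[0,0,121],[0,0,241],[1,0,24],[0,0,73],[1,0,4113],[0,0,4209],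
  [0,0,4],[1,0,4198],[0,0,87],[0,0,4156],[1,0,59],[0,0,4133],[0,0,366],[0,0,943],[1,0,4112,26],
  [0,0,4363],[0,0,4523],[0,0,4900],[1,0,4163,1],[0,0,5883],[0,0,4279],[0,0,94],[1,0,3],[0,0,6],
  [0,0,4393],[0,0,883,4097],[1,0,2],[0,0,10],[0,0,22],[0,0,176],[1,0]] = true) := ⟨by decide +kernel⟩
theorem d12 : Dead [false, true, true, false, true, true, true, false, false, true, false, false, true] := leaf _ t12 (by decide) rfl rfl
def t13 : PLift (check 4096 [1,0,0,1,0,0,1,1,1,0,1,1,1] [0,1,1,0,1,1,0,0,0,1,0,0,0] [[0,0,1],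
  [0,0,2],[0,0,4],[0,0,8],[0,0,16],[0,0,32],[0,0,64],[0,0,128],[0,0,256],[0,0,512],[0,0,1024],
  [1,0,1],[0,0,2],[0,0,4],[0,0,16],[1,0,376],[0,0,1462],[0,0,4418],[0,0,188],[1,0,4254],[0,0,387],
  [1,0,4276],[1,0,4148],[1,0,4365],[1,0,9],[1,0,4590],[1,45,94],[1,0,4184],[1,0,4151],[1,0,52],
  [1,0,56],[1,0,4149],[1,0,72],[1,0,4288],[1,0,2],[1,0,4161],[1,0,59],[0,0,4122],[1,0,4227],
  [1,0,147],[0,0,4352],[1,0,10],[0,0,221],[1,0,4109],[0,0,4133],[1,0,6],[0,0,22],[1,0,58],[0,0,383],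
  [1,0,24],[0,0,29],[0,0,1467],[1,0,4158],[0,0,4286],[1,0,4191],[0,0,4387],[0,0,44],[1,0,4151],
  [0,0,56],[0,0,4499],[1,0,201],[0,0,47],[0,0,77],[1,0,4139],[0,0,4134],[0,0,4261],[0,0,364],
  [1,0,3],[0,0,346],[0,0,691],[0,0,5184,4110],[1,0]] = true) := ⟨by decide +kernel⟩
theorem d13 : Dead [true, true, true, false, true, true, true, false, false, true, false, false, true] := leaf _ t13 (by decide) rfl rfl
def t14 : PLift (check 4096 [1,0,0,1,0,0,1,1,1,1] [0,1,1,0,1,1,0,0,0,0] [[0,0,1],[0,0,2],[0,0,4],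
  [0,0,8],[0,0,16],[0,0,32],[0,0,64],[0,0,128],[0,0,256],[0,0,512],[0,0,1024],[1,0,2],[0,0,16],
  [0,0,32],[0,0,1664],[1,0,139],[0,0,276],[1,0,4482],[1,0,333],[1,66,30],[1,137,4119],[1,94,4256],
  [1,178,4138],[1,54,138],[1,61,4145],[1,112,256],[1,105,4108],[1,155,4203],[1,189,74],[1,171,4251],
  [1,147,671],[1,98,1],[1,155,4149],[1,126,70],[1,68,4121],[1,155,4171],[1,105,4162],[1,95,562],
  [1,175,4353],[1,189,373],[1,91,17],[1,97,4180],[1,105,19],[1,148,4257],[1,92,4150],[1,93,85],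
  [1,85,11],[1,55,35],[1,92,4148],[1,54,134],[1,55,10],[1,74,6],[1,0,4113],[1,0,185],[1,0,5618],
  [1,0,701],[1,74,13],[1,62,4128],[1,58,95],[1,0,4122],[1,0,2],[1,0,4113],[1,0,36],[1,0,4135],
  [1,0,4252],[1,0,335],[1,0,9],[1,0,4107],[1,0,4347],[1,0,4206],[1,0,342],[1,0,43],[0,0,4341],
  [1,0,186],[1,0,4141],[0,0,4770],[1,0,309],[0,0,4115],[1,0,6],[0,0,266],[1,0,7],[0,0,4512],
  [0,0,399],[1,0,4173],[0,0,4250],[0,0,4182],[1,0,5],[0,0,4192],[0,0,36],[1,0,71],[0,0,104,1088],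
  [0,0,101],[0,0,657],[1,0,4913],[0,0,32,4311],[0,0,4948],[0,0,857],[1,0,4],[0,0,119],[0,0,4338],
  [0,0,130],[1,0,1],[0,0,34],[0,0,185],[0,0,351],[1,0]] = true) := ⟨by decide +kernel⟩
theorem d14 : Dead [true, true, true, true, false, false, true, false, false, true] := leaf _ t14 (by decide) rfl rfl
def t15 : PLift (check 4096 [1,0,0,1,0,1] [0,1,1,0,1,0] [[0,0,1],[0,0,2],[0,0,4],[0,0,8],[0,0,16],
  [0,0,32],[0,0,64],[0,0,128],[0,0,256],[0,0,512],[0,0,1024],[1,0,1],[0,0,4],[0,0,16],[0,0,32],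
  [1,0,54],[0,0,299],[0,0,598],[0,0,1196],[1,0,824,4824],[0,0,4711],[1,0,87],[1,0,4302],
  [1,187,4131],[1,232,4171],[1,100,4160],[1,100,4097],[1,165,4103],[1,103,37],[1,232,63],[1,133,23],
  [1,112,9],[1,88,4386],[1,78,48],[1,133,4106],[1,135,4164],[1,144,5285],[1,129,4108],[1,123,172],
  [1,135,4426],[1,129,4099],[1,92,20],[1,126,4927],[1,131,133],[1,123,13],[1,100,4185],[1,132,27],
  [1,135,4114],[1,64,4177],[1,97,4351],[1,126,4105],[1,62,23],[1,78,26],[1,93,4098],[1,132,88],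
  [1,104,4198],[1,78,34],[1,99,4115],[1,126,4151],[1,78,4127],[1,85,4102],[1,70,4215],[1,57,4156],
  [1,85,4681],[1,85,254],[1,73,4348],[1,233,23],[1,72,4147],[1,50,3],[1,50,4304],[1,65,165],
  [1,68,4113],[1,108,5145],[1,105,4106],[1,67,12],[1,53,4185],[1,48,4132],[1,42,121],[1,0,3],
  [1,0,4115],[1,0,4143],[1,0,75],[1,0,4259],[1,0,4385],[1,0,339],[1,0,4505],[1,0,39],[1,0,4136],
  [1,0,4098],[1,0,4117],[1,0,5451],[1,0,95],[1,0,96],[1,0,4106],[1,0,4172],[1,0,38],[1,0,73],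
  [1,0,4166],[1,0,4322],[1,0,105],[1,0,8],[1,0,271],[1,0,4143],[1,0,12],[0,0,4461],[1,0,177],
  [1,0,4141],[0,0,4486],[1,0,658],[1,0,4151],[0,0,4276],[1,0,4253],[0,0,4246],[1,0,197],[0,0,4317],
  [1,0,152],[0,0,4838],[1,0,117],[0,0,399],[1,0,4189],[0,0,4234],[0,0,4473],[1,0,57],[0,0,4385],
  [0,0,569],[1,0,4272],[0,0,4553],[0,0,312],[0,0,215],[1,0,117],[0,0,4140,71],[0,0,8],[0,0,4330],
  [1,0,1],[0,0,4],[0,0,23],[0,0,657],[1,0,2],[0,0,8],[0,0,90],[0,0,272],[1,0]] = true) := ⟨by decide +kernel⟩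
theorem d15 : Dead [true, false, true, false, false, true] := leaf _ t15 (by decide) rfl rfl
def t16 : PLift (check 4096 [1,0,0,1,1,0,0,0,0] [0,1,1,0,0,1,1,1,1] [[0,0,1],[0,0,2],[0,0,4],
  [0,0,8],[0,0,16],[0,0,32],[0,0,64],[0,0,128],[0,0,256],[0,0,512],[0,0,1024],[1,0,1],[0,0,10],
  [0,0,20],[0,0,102],[1,0,938],[0,0,1876],[0,0,124],[1,0,89],[0,0,221],[1,0,4314],[1,0,268],
  [1,0,4186],[1,0,104],[1,0,4166],[1,0,49],[1,0,4174],[1,0,129],[1,0,4118],[1,0,288],[1,0,4110],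
  [1,0,4190],[1,0,4157],[1,0,6],[1,0,81],[1,0,127],[1,0,4179],[1,0,4],[1,0,27],[1,0,434],[1,0,4454],
  [1,0,151],[1,0,4232],[1,0,4130],[1,0,68],[0,0,5581],[1,0,4108],[1,0,85],[0,0,4185],[1,0,2],
  [0,0,397],[1,0,86],[0,0,4381],[1,0,193],[0,0,4195],[0,0,61],[1,0,4246],[0,0,4117],[0,0,4288],
  [1,0,112],[0,0,240],[0,0,4405],[0,0,506],[1,0,3],[0,0,105],[0,0,4399],[0,0,1663],[1,0,5],[0,0,10],
  [0,0,20],[0,0,4808],[1,0,1],[0,0,40],[0,0,210],[0,0,4585],[1,0]] = true) := ⟨by decide +kernel⟩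
theorem d16 : Dead [false, false, false, false, true, true, false, false, true] := leaf _ t16 (by decide) rfl rfl
def t17 : PLift (check 4096 [1,0,0,1,1,0,0,0,1,0] [0,1,1,0,0,1,1,1,0,1] [[0,0,1],[0,0,2],[0,0,4],
  [0,0,8],[0,0,16],[0,0,32],[0,0,64],[0,0,128],[0,0,256],[0,0,512],[0,0,1024],[1,0,5],[0,0,55],
  [0,0,445],[0,0,1703],[1,0,246],[0,0,150],[0,0,357],[1,0,4464],[1,0,4201],[1,50,22],[1,233,4108],
  [1,185,60],[1,93,4164],[1,119,4780],[1,105,27],[1,98,64],[1,131,4121],[1,98,4163],[1,93,4119],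
  [1,220,4995],[1,110,104],[1,81,4224],[1,197,4256],[1,189,9],[1,89,20],[1,140,3],[1,140,24],
  [1,91,4137],[1,96,18],[1,164,5162],[1,96,4294],[1,66,4130],[1,171,17],[1,63,4129],[1,92,4159],
  [1,78,5],[1,185,57],[1,163,5237],[1,75,99],[1,170,9],[1,55,4150],[1,0,26],[1,0,4114],[1,0,4147],
  [1,0,4193],[1,0,7],[1,0,4126],[1,0,71],[1,0,4135],[1,0,4119],[1,0,4191],[1,0,13],[1,0,20],
  [1,0,4838],[1,0,4126],[1,0,66],[1,0,4140],[1,0,4101],[0,0,4873],[1,0,4270],[1,0,29],[0,0,11],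
  [1,0,72],[0,0,4147],[1,0,205],[0,0,4248],[1,0,42],[0,0,84],[1,0,4393],[0,0,5252],[0,0,233],
  [1,0,93],[0,0,4315,4100],[0,0,81],[0,0,118],[1,0,213],[0,0,4386],[0,0,456],[0,0,4263],[1,0,11],
  [0,0,149],[0,0,4132],[0,0,4666],[1,0]] = true) := ⟨by decide +kernel⟩
theorem d17 : Dead [false, true, false, false, false, true, true, false, false, true] := leaf _ t17 (by decide) rfl rfl
def t18 : PLift (check 4096 [1,0,0,1,1,0,0,0,1,1] [0,1,1,0,0,1,1,1,0,0] [[0,0,1],[0,0,2],[0,0,4],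
  [0,0,8],[0,0,16],[0,0,32],[0,0,64],[0,0,128],[0,0,256],[0,0,512],[0,0,1024],[1,0,1],[0,0,6],
  [0,0,56],[0,0,448],[1,0,1262],[0,0,911],[0,0,4131],[0,0,177],[1,0,38],[1,0,4339],[1,63,9],
  [1,120,4978],[1,91,4151],[1,196,42],[1,96,4132],[1,98,4167],[1,137,4655],[1,117,4100],[1,134,26],
  [1,78,4109],[1,162,179],[1,120,4116],[1,65,4146],[1,73,10],[1,129,5321],[1,65,31],[1,162,4128],
  [1,92,21],[1,170,4239],[1,111,4101],[1,93,80],[1,99,4099],[1,92,4224],[1,79,4105],[1,161,4113],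
  [1,166,44],[1,79,22],[1,73,29],[1,59,4102],[1,60,4193],[1,76,10],[1,54,4129],[1,164,45],
  [1,56,4111],[1,0,51],[1,0,4175],[1,0,6],[1,0,100],[1,0,4406],[1,0,4108],[1,0,10],[1,0,52],
  [1,0,123],[1,0,4535],[1,0,4129],[1,0,14],[1,0,4688],[1,0,168],[1,0,8],[1,0,4788],[1,0,90],
  [1,0,45],[1,0,5589],[1,0,328],[1,0,4107],[1,0,4274],[1,0,4187],[1,0,32],[1,0,39],[1,0,4580],
  [1,0,152],[1,0,264],[0,0,4514],[1,0,209],[1,0,84],[0,0,4220],[1,0,4225],[0,0,4673],[1,0,342],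
  [0,0,810],[0,0,5288],[1,0,70],[0,0,173],[0,0,162],[1,0,4101],[0,0,4237],[0,0,4625],[0,0,4279],
  [1,0]] = true) := ⟨by decide +kernel⟩
theorem d18 : Dead [true, true, false, false, false, true, true, false, false, true] := leaf _ t18 (by decide) rfl rfl
def t19 : PLift (check 4096 [1,0,0,1,1,0,0,1,0] [0,1,1,0,0,1,1,0,1] [[0,0,1],[0,0,2],[0,0,4],
  [0,0,8],[0,0,16],[0,0,32],[0,0,64],[0,0,128],[0,0,256],[0,0,512],[0,0,1024],[1,0,1],[0,0,12],
  [0,0,24],[0,0,112],[1,0,1907],[0,0,151],[0,0,50],[1,0,4329],[1,0,146],[1,135,42],[1,85,4],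
  [1,136,4164],[1,162,3],[1,89,25],[1,77,4405],[1,131,4967],[1,204,61],[1,225,385],[1,112,4113],
  [1,87,41],[1,138,14],[1,72,12],[1,147,4114],[1,161,4136],[1,204,4173],[1,129,4184],[1,147,1],
  [1,86,6],[1,73,4116],[1,123,103],[1,136,186],[1,84,13],[1,81,100],[1,206,9],[1,172,324],
  [1,206,4122],[1,91,14],[1,131,4180],[1,83,58],[1,162,4116],[1,73,149],[1,131,4248],[1,70,4150],
  [1,141,29],[1,193,46],[1,77,237],[1,100,4401],[1,92,99],[1,187,4163],[1,72,4112],[1,84,69],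
  [1,70,4175],[1,141,21],[1,127,265],[1,194,4113],[1,130,152],[1,71,4167],[1,70,7],[1,116,4261],
  [1,100,135],[1,99,36],[1,74,4354],[1,52,254],[1,62,4170],[1,50,3],[1,0,4415],[1,49,96],[1,0,59],
  [1,0,24],[1,0,4247],[1,0,38],[1,0,228],[1,0,16],[1,0,4140],[1,0,117],[1,0,4417],[1,0,4220],
  [1,0,291],[1,0,55],[1,0,4565],[1,0,4149],[1,0,75],[1,0,4131],[1,0,4142],[1,0,169],[1,0,4162],
  [1,0,30],[1,0,4168],[1,0,4121],[1,0,4139],[1,0,4804],[0,0,224],[1,0,203],[1,0,2],[0,0,4354],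
  [1,0,4214],[0,0,20],[1,0,24],[0,0,4131],[1,0,28],[0,0,6],[1,0,5042],[0,0,3],[1,0,4835],[0,0,540],
  [0,0,4665],[1,0,2],[0,0,75],[0,0,4103],[1,0,53],[0,0,377],[0,0,599],[1,0,4356],[0,0,4287],
  [0,0,4531],[0,0,278],[1,0,2],[0,0,4],[0,0,8],[0,0,4145],[1,0]] = true) := ⟨by decide +kernel⟩
theorem d19 : Dead [false, true, false, false, true, true, false, false, true] := leaf _ t19 (by decide) rfl rfl
def t20 : PLift (check 4096 [1,0,0,1,1,0,0,1,1,0,0] [0,1,1,0,0,1,1,0,0,1,1] [[0,0,1],[0,0,2],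
  [0,0,4],[0,0,8],[0,0,16],[0,0,32],[0,0,64],[0,0,128],[0,0,256],[0,0,512],[0,0,1024],[1,0,31],
  [0,0,632],[0,0,1264],[0,0,945,179],[1,0,153],[0,0,66],[1,0,4268],[1,0,193],[1,57,4455],[1,80,1],
  [1,111,4265],[1,77,47],[1,171,4148],[1,170,43],[1,68,4335],[1,110,4241],[1,161,4104],[1,110,4100],
  [1,59,204],[1,123,4791],[1,234,4104],[1,170,142],[1,135,4128],[1,222,10],[1,245,33],[1,82,4110],
  [1,72,4195],[1,163,2],[1,165,17],[1,194,5158],[1,155,461],[1,187,4103],[1,222,4155],[1,122,4],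
  [1,154,12],[1,163,32],[1,165,4111],[1,138,4102],[1,177,4293],[1,163,23],[1,157,4218],[1,180,22],
  [1,163,4132],[1,81,4127],[1,83,39],[1,220,103],[1,72,131],[1,161,4661],[1,171,69],[1,124,4134],
  [1,137,82],[1,171,21],[1,72,4116],[1,88,31],[1,86,232],[1,168,4212],[1,148,10],[1,130,17],
  [1,168,4208],[1,77,4102],[1,98,4111],[1,75,86],[1,70,4276],[1,96,160],[1,71,4121],[1,42,394],
  [1,103,4471],[1,108,4104],[1,0,136],[1,0,4192],[1,49,34],[1,0,89],[1,0,4],[1,0,5180],[1,0,334],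
  [1,0,4162],[1,0,4280],[1,0,65],[1,0,18],[1,0,46],[1,0,359],[1,0,4109],[1,0,4135],[1,0,84],
  [1,0,4184],[1,0,96],[1,0,128],[1,0,4111],[1,0,4545],[1,0,4233],[1,0,4185],[1,0,157],[0,0,202],
  [1,0,3],[1,0,4339],[0,0,866],[1,0,4279],[0,0,4448],[1,0,61],[0,0,73],[1,0,153],[0,0,181],
  [1,0,4151],[0,0,4120],[1,0,4792],[0,0,1392],[0,0,4736],[1,0,4221],[0,0,141],[1,0,3],[0,0,4116],
  [0,0,26],[1,0,34],[0,0,4210],[0,0,38],[1,0,18],[0,0,4209,39],[0,0,77],[0,0,4127],[1,0,22],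
  [0,0,4532],[0,0,5183],[0,0,197],[1,0,21],[0,0,42],[0,0,554],[0,0,4916],[1,0,1],[0,0,2],[0,0,10],
  [0,0,4810],[1,0]] = true) := ⟨by decide +kernel⟩
theorem d20 : Dead [false, false, true, true, false, false, true, true, false, false, true] := leaf _ t20 (by decide) rfl rfl
def t21 : PLift (check 4096 [1,0,0,1,1,0,0,1,1,0,1,0] [0,1,1,0,0,1,1,0,0,1,0,1] [[0,0,1],[0,0,2],
  [0,0,4],[0,0,8],[0,0,16],[0,0,32],[0,0,64],[0,0,128],[0,0,256],[0,0,512],[0,0,1024],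
  [1,0]] = true) := ⟨by decide +kernel⟩
theorem d21 : Dead [false, true, false, true, true, false, false, true, true, false, false, true] := leaf _ t21 (by decide) rfl rfl
def t22 : PLift (check 4096 [1,0,0,1,1,0,0,1,1,0,1,1,0,0] [0,1,1,0,0,1,1,0,0,1,0,0,1,1] [[0,0,1],
  [0,0,2],[0,0,4],[0,0,8],[0,0,16],[0,0,32],[0,0,64],[0,0,128],[0,0,256],[0,0,512],[0,0,1024],
  [1,0,1605],[0,0,367,4165],[0,0,316],[1,0,27],[1,0,170],[1,46,4432],[1,146,72],[1,63,14],
  [1,56,4146],[1,55,4114],[1,86,4130],[1,161,4134],[1,68,3],[1,97,4302],[1,95,91],[1,73,4164],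
  [1,168,22],[1,96,13],[1,56,47],[1,130,5288],[1,169,152],[1,92,4145],[1,96,4184],[1,62,12],
  [1,185,4123],[1,62,5],[1,170,78],[1,128,4100],[1,168,50],[1,128,49],[1,131,4197],[1,130,4915],
  [1,168,4103],[1,163,4166],[1,83,4203],[1,83,4132],[1,170,53],[1,204,10],[1,106,132],[1,59,4115],
  [1,129,4421],[1,106,4162],[1,80,38],[1,161,8],[1,100,4244],[1,69,15],[1,80,4149],[1,78,96],
  [1,51,4190],[1,0,14],[1,0,4147],[1,0,61],[1,0,12],[1,0,4151],[1,0,650],[1,0,32],[1,0,24],[1,0,83],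
  [1,0,4099],[1,0,128],[1,0,4114],[1,0,16],[1,0,5415],[1,0,4108],[1,0,369],[1,0,4150],[1,0,27],
  [1,0,4375],[0,0,4243],[1,0,92],[1,0,4125],[0,0,4114],[1,0,4501],[0,0,41],[1,0,39],[0,0,4139],
  [1,0,240,6],[0,0,102],[0,0,480],[1,0,4146,4170],[0,0,4165],[0,0,1235],[1,0,96],[0,0,176],[0,0,85],
  [1,0,300],[0,0,419],[1,0,16],[0,0,77,446],[0,0,4364],[0,0,1087],[1,0,6],[0,0,4217],[0,0,20],
  [0,0,4225],[1,0,1],[0,0,2],[0,0,30],[0,0,60],[1,0]] = true) := ⟨by decide +kernel⟩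
theorem d22 : Dead [false, false, true, true, false, true, true, false, false, true, true, false, false, true] := leaf _ t22 (by decide) rfl rfl
def t23 : PLift (check 4096 [1,0,0,1,1,0,0,1,1,0,1,1,0,1] [0,1,1,0,0,1,1,0,0,1,0,0,1,0] [[0,0,1],
  [0,0,2],[0,0,4],[0,0,8],[0,0,16],[0,0,32],[0,0,64],[0,0,128],[0,0,256],[0,0,512],[0,0,1024],
  [1,0,1067],[0,0,783],[0,0,186],[0,0,4435],[1,0,207],[0,0,4200],[1,0,19],[1,103,5176],[1,85,432],
  [1,130,3],[1,146,4125],[1,83,4097],[1,82,69],[1,77,4162],[1,85,35],[1,55,4207],[1,56,41],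
  [1,103,4975],[1,119,163],[1,206,4138],[1,51,82],[1,51,4345],[1,0,4152],[1,0,115],[1,0,4297],
  [1,0,96],[1,0,4112],[1,0,21],[1,0,4100],[1,0,4424],[1,0,4108],[1,0,30],[1,0,4173],[1,0,5559],
  [1,0,43],[1,0,1],[1,0,4196],[1,0,4129],[1,0,97],[0,0,4116],[1,0,4212],[1,0,6],[0,0,24],[1,0,27],
  [0,0,4337],[1,0,16],[0,0,103],[1,0,34],[0,0,68],[1,0,100],[0,0,4258],[0,0,436],[1,0,8,141],
  [0,0,40],[0,0,893],[1,0,42],[0,0,4217],[0,0,1165],[0,0,4392],[1,0,32],[0,0,4690],[0,0,4600,639],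
  [0,0,108],[1,0,3],[0,0,24],[0,0,62],[0,0,119,153],[1,0,1],[0,0,9],[0,0,637],[0,0,477],
  [1,0]] = true) := ⟨by decide +kernel⟩
theorem d23 : Dead [true, false, true, true, false, true, true, false, false, true, true, false, false, true] := leaf _ t23 (by decide) rfl rfl
def t24 : PLift (check 4096 [1,0,0,1,1,0,0,1,1,0,1,1,1] [0,1,1,0,0,1,1,0,0,1,0,0,0] [[0,0,1],
  [0,0,2],[0,0,4],[0,0,8],[0,0,16],[0,0,32],[0,0,64],[0,0,128],[0,0,256],[0,0,512],[0,0,1024],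
  [1,0,1],[0,0,16],[0,0,94],[0,0,444],[1,0,1194],[0,0,4736],[0,0,710],[1,0,170],[0,0,4530],[1,0,42],
  [1,0,303],[1,0,4183],[1,0,4118],[1,0,35],[1,0,4129],[1,0,5],[1,0,32],[1,0,4304],[0,0,4333],
  [1,0,125],[0,0,4127],[1,0,43],[0,0,4182],[1,0,141],[0,0,4734],[1,0,3],[0,0,161],[1,0,140,4174],
  [0,0,277],[0,0,4492],[1,0,4209],[0,0,124],[0,0,5131],[1,0,22],[0,0,4153],[0,0,4454],[0,0,4380],
  [1,0,4],[0,0,96],[0,0,812],[0,0,203],[1,0,2],[0,0,8],[0,0,16],[0,0,32],[1,0]] = true) := ⟨by decide +kernel⟩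
theorem d24 : Dead [true, true, true, false, true, true, false, false, true, true, false, false, true] := leaf _ t24 (by decide) rfl rfl
def t25 : PLift (check 4096 [1,0,0,1,1,0,0,1,1,1,0,0] [0,1,1,0,0,1,1,0,0,0,1,1] [[0,0,1],[0,0,2],
  [0,0,4],[0,0,8],[0,0,16],[0,0,32],[0,0,64],[0,0,128],[0,0,256],[0,0,512],[0,0,1024],[1,0,1],
  [0,0,2],[0,0,4],[0,0,169],[1,0,148],[0,0,1318],[0,0,624],[0,0,130],[1,0,100],[0,0,4237],[1,0,283],
  [1,0,4118],[1,0,4508],[1,0,5],[1,0,139],[1,0,4306],[1,0,122],[1,0,4141],[1,0,4919],[1,0,232],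
  [1,0,87],[1,0,4476],[1,0,51],[1,0,142],[1,0,1],[1,0,4168],[1,0,4272],[0,0,210],[1,0,4140],
  [1,0,4435],[1,0,37],[0,0,2],[1,0,29],[1,0,89],[1,0,4237],[1,0,264],[1,0,93],[1,0,4286],[1,0,111],
  [1,0,4165],[0,0,4628],[1,0,4152],[1,0,23],[0,0,103],[1,0,4122],[0,0,4200],[1,0,1177],[0,0,4775],
  [1,0,21],[0,0,41],[1,0,4209],[0,0,19],[1,0,4324],[0,0,411],[1,0,6,130],[0,0,86],[0,0,172],
  [1,0,4246],[0,0,601],[0,0,4146],[1,0,4573],[0,0,4254,114],[0,0,4107],[0,0,4904],[1,0,1],[0,0,2],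
  [0,0,4],[0,0,19],[1,0]] = true) := ⟨by decide +kernel⟩
theorem d25 : Dead [false, false, true, true, true, false, false, true, true, false, false, true] := leaf _ t25 (by decide) rfl rfl
def t26 : PLift (check 4096 [1,0,0,1,1,0,0,1,1,1,0,1] [0,1,1,0,0,1,1,0,0,0,1,0] [[0,0,1],[0,0,2],
  [0,0,4],[0,0,8],[0,0,16],[0,0,32],[0,0,64],[0,0,128],[0,0,256],[0,0,512],[0,0,1024],[1,0,856],
  [0,0,1209],[0,0,4189],[0,0,4762],[1,0,390],[1,0,4266],[1,71,4129],[1,134,41],[1,247,21],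
  [1,104,4565],[1,110,43],[1,112,35],[1,80,4259],[1,222,19],[1,104,4427],[1,176,4173],[1,167,5238],
  [1,245,71],[1,226,83],[1,61,4120],[1,177,23],[1,61,4791],[1,177,4166],[1,167,35],[1,104,4101],
  [1,177,112],[1,161,4318],[1,247,5456],[1,155,10],[1,153,39],[1,204,4107],[1,226,4141],
  [1,161,4229],[1,224,26],[1,245,4610],[1,167,4136],[1,81,4121],[1,161,23],[1,117,4113],[1,72,4148],
  [1,146,43],[1,117,4568],[1,163,54],[1,198,10],[1,116,1],[1,131,4099],[1,198,5184],[1,80,60],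
  [1,198,47],[1,61,4129],[1,125,4118],[1,170,57],[1,126,60],[1,68,244],[1,123,4098],[1,220,4277],
  [1,82,40],[1,140,4115],[1,168,7],[1,186,18],[1,82,4148],[1,86,5748],[1,247,4107],[1,125,99],
  [1,165,10],[1,175,183],[1,60,4134],[1,82,4112],[1,86,4145],[1,134,59],[1,79,77],[1,206,31],
  [1,102,4194],[1,120,4144],[1,106,4104],[1,84,62],[1,57,5069],[1,62,51],[1,128,4153],[1,64,4128],
  [1,50,21],[1,0,4244],[1,0,18],[1,0,4289],[1,0,2],[1,0,4178],[1,0,6],[1,0,4110],[1,0,58],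
  [1,0,4117],[1,0,153],[1,0,5240],[1,0,218],[1,0,27],[1,0,12],[1,0,4119],[1,0,4229],[1,0,687],
  [0,0,4792],[1,0,179],[1,0,4165],[0,0,4269],[1,0,25],[0,0,24],[1,0,209],[0,0,5120],[1,0,4135],
  [0,0,4238],[0,0,127],[1,0,444,4189],[0,0,4834],[0,0,26],[1,0,16],[0,0,66],[0,0,4494],[0,0,33],
  [1,0,2],[0,0,443],[0,0,4676,120],[0,0,521],[1,0,1],[0,0,4],[0,0,8],[0,0,16],[1,0]] = true) := ⟨by decide +kernel⟩
theorem d26 : Dead [true, false, true, true, true, false, false, true, true, false, false, true] := leaf _ t26 (by decide) rfl rfl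
def t27 : PLift (check 4096 [1,0,0,1,1,0,0,1,1,1,1] [0,1,1,0,0,1,1,0,0,0,0] [[0,0,1],[0,0,2],
  [0,0,4],[0,0,8],[0,0,16],[0,0,32],[0,0,64],[0,0,128],[0,0,256],[0,0,512],[0,0,1024],
  [1,0]] = true) := ⟨by decide +kernel⟩
theorem d27 : Dead [true, true, true, true, false, false, true, true, false, false, true] := leaf _ t27 (by decide) rfl rfl
def t28 : PLift (check 4096 [1,0,0,1,1,0,1,0] [0,1,1,0,0,1,0,1] [[0,0,1],[0,0,2],[0,0,4],[0,0,8],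
  [0,0,16],[0,0,32],[0,0,64],[0,0,128],[0,0,256],[0,0,512],[0,0,1024],[1,0,20],[0,0,98],[0,0,220],
  [0,0,1370],[1,0,522],[0,0,4921],[0,0,389],[1,0,5],[1,0,4304],[1,107,4247],[1,130,200],[1,141,17],
  [1,92,4102],[1,105,4645],[1,98,67],[1,134,4109],[1,169,4159],[1,168,65],[1,167,20],[1,116,11],
  [1,134,8],[1,141,4156],[1,170,35],[1,156,4162],[1,170,4133],[1,170,170],[1,96,4184],[1,77,5215],
  [1,102,139],[1,218,55],[1,65,4144],[1,92,4123],[1,53,12],[1,69,40],[1,49,4229],[1,0,155],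
  [1,0,4180],[1,0,4238],[1,0,391],[1,0,4137],[1,0,4511],[1,0,52],[1,0,4104],[1,0,4149],[1,0,48],
  [1,0,4174],[1,0,64],[1,0,15],[1,0,58],[1,0,4258],[1,0,4163],[1,0,89],[1,0,76],[0,0,4117],
  [1,0,4122],[1,0,4519],[0,0,4855],[1,0,265],[0,0,4391],[1,0,335],[0,0,709],[1,0,4174],[0,0,4225],
  [1,0,9],[0,0,92],[1,0,245,4198],[0,0,180],[0,0,4373],[1,0,4194],[0,0,49],[0,0,351],[1,0,368,3],
  [0,0,4207],[0,0,2],[1,0,4232],[0,0,4875],[0,0,50],[1,0,374],[0,0,187],[0,0,4653],[0,0,462],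
  [1,0,4184],[0,0,5305],[0,0,12,4298],[0,0,495],[1,0,1],[0,0,2],[0,0,16],[0,0,170],[1,0]] = true) := ⟨by decide +kernel⟩
theorem d28 : Dead [false, true, false, true, true, false, false, true] := leaf _ t28 (by decide) rfl rfl
def t29 : PLift (check 4096 [1,0,0,1,1,0,1,1,0] [0,1,1,0,0,1,0,0,1] [[0,0,1],[0,0,2],[0,0,4],
  [0,0,8],[0,0,16],[0,0,32],[0,0,64],[0,0,128],[0,0,256],[0,0,512],[0,0,1024],[1,0,1],[0,0,10],
  [0,0,110],[0,0,1506],[1,0,433],[0,0,130],[0,0,4682],[1,0,170],[1,0,4177],[1,117,4131],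
  [1,116,4526],[1,106,62],[1,132,60],[1,52,4149],[1,57,4140],[1,75,4160],[1,134,4101],[1,116,5110],
  [1,126,30],[1,75,4104],[1,71,55],[1,173,19],[1,157,20],[1,59,4117],[1,157,97],[1,59,4367],
  [1,57,4178],[1,164,56],[1,80,5472],[1,116,4108],[1,83,142],[1,127,4181],[1,193,42],[1,96,4236],
  [1,234,5064],[1,164,4120],[1,102,130],[1,102,98],[1,52,4347],[1,164,59],[1,162,4160],[1,92,65],
  [1,0,4099],[1,92,4235],[1,117,108],[1,74,26],[1,0,40],[1,0,4153],[1,0,36],[1,0,87],[1,0,4206],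
  [1,0,102],[1,0,394],[1,0,4265],[1,0,4277],[1,0,144],[1,0,57],[1,0,4209],[1,0,5662],[1,0,264],
  [1,0,54],[0,0,4172],[1,0,62],[1,0,370],[0,0,4791],[1,0,63],[0,0,4134],[1,0,334],[0,0,4148],
  [1,0,4318],[0,0,1069],[0,0,4622],[1,0,20,496],[0,0,109],[0,0,4100],[1,0,4295,220],[0,0,384],
  [0,0,4359],[1,0,4105],[0,0,4134],[1,0,983],[0,0,459,10],[0,0,4253],[0,0,1262],[1,0,4458],
  [0,0,4181],[0,0,144],[0,0,4255],[1,0,1],[0,0,4],[0,0,18],[0,0,74],[1,0]] = true) := ⟨by decide +kernel⟩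
theorem d29 : Dead [false, true, true, false, true, true, false, false, true] := leaf _ t29 (by decide) rfl rfl
def t30 : PLift (check 4096 [1,0,0,1,1,0,1,1,1,0] [0,1,1,0,0,1,0,0,0,1] [[0,0,1],[0,0,2],[0,0,4],
  [0,0,8],[0,0,16],[0,0,32],[0,0,64],[0,0,128],[0,0,256],[0,0,512],[0,0,1024],[1,0,19],[0,0,206],
  [0,0,908],[0,0,1816],[1,0,76,11],[0,0,4249],[1,0,4445],[1,0,245],[1,51,4151],[1,82,4141],
  [1,94,78],[1,110,4352],[1,186,64],[1,89,129],[1,162,61],[1,157,4395],[1,139,136],[1,116,4123],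
  [1,158,4350],[1,178,9],[1,102,4129],[1,101,4211],[1,186,4152],[1,169,4166],[1,178,51],
  [1,163,4140],[1,186,4464],[1,110,26],[1,60,32],[1,166,4121],[1,175,20],[1,175,261],[1,171,4184],
  [1,82,4132],[1,168,4339],[1,91,95],[1,77,4125],[1,82,13],[1,148,4164],[1,61,35],[1,172,4231],
  [1,147,105],[1,96,4148],[1,69,13],[1,50,4104],[1,156,78],[1,195,4149],[1,68,75],[1,0,26],
  [1,0,4191],[1,0,30],[1,0,4297],[1,0,297],[1,0,4273],[1,0,4320],[1,0,330],[1,0,9],[1,0,4326],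
  [1,0,25],[1,0,280],[1,0,70],[1,0,4196],[1,0,7],[1,0,4113],[1,0,271],[1,0,646],[0,0,120],
  [1,0,4448],[1,0,4139],[0,0,54],[1,0,4152],[0,0,112],[1,0,4187],[0,0,225],[1,0,4279],[0,0,4573],
  [0,0,676],[1,0,4524,400],[0,0,4396],[0,0,473],[1,0,181],[0,0,362],[0,0,4947],[1,0,324],[0,0,175],
  [0,0,4129],[1,0,240],[0,0,536],[0,0,915],[1,0,1],[0,0,35],[0,0,51],[1,0,9],[0,0,4614],[0,0,4163],
  [0,0,5305],[1,0,1],[0,0,2],[0,0,4],[0,0,20],[1,0]] = true) := ⟨by decide +kernel⟩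
theorem d30 : Dead [false, true, true, true, false, true, true, false, false, true] := leaf _ t30 (by decide) rfl rfl
def t31 : PLift (check 4096 [1,0,0,1,1,0,1,1,1,1] [0,1,1,0,0,1,0,0,0,0] [[0,0,1],[0,0,2],[0,0,4],
  [0,0,8],[0,0,16],[0,0,32],[0,0,64],[0,0,128],[0,0,256],[0,0,512],[0,0,1024],[1,0,1],[0,0,6],
  [0,0,38],[0,0,892],[1,0,1528],[0,0,240],[0,0,4531],[1,0,373],[1,0,21],[1,0,4425],[1,66,4257],
  [1,84,37],[1,172,80],[1,70,156],[1,123,4162],[1,71,33],[1,77,4961],[1,123,4099],[1,97,2],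
  [1,130,4112],[1,71,209],[1,77,4101],[1,61,152],[1,173,4169],[1,120,140],[1,59,23],[1,137,74],
  [1,85,4276],[1,69,92],[1,55,232],[1,63,4735],[1,73,648],[1,167,4101],[1,172,4405],[1,58,32],
  [1,55,111],[1,54,80],[1,53,4228],[1,0,4277],[1,0,55],[1,0,140],[1,0,4171],[1,0,77],[1,0,4150],
  [1,0,58],[1,0,50],[1,0,10],[1,0,249],[1,0,4215],[1,0,74],[1,0,107],[1,0,4167],[0,0,31],[1,0,106],
  [1,0,4149],[0,0,4281],[1,0,82],[0,0,91],[1,0,254],[0,0,981],[1,0,4453],[0,0,237],[1,0,4140],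
  [0,0,4184],[1,0,10],[0,0,4599],[0,0,5],[1,0,4104],[0,0,4191,314],[0,0,61],[1,0,41],[0,0,231,87],
  [0,0,4349],[0,0,161],[1,0,2],[0,0,124],[0,0,33],[0,0,4299],[1,0,1],[0,0,4],[0,0,8],[0,0,16],
  [1,0]] = true) := ⟨by decide +kernel⟩
theorem d31 : Dead [true, true, true, true, false, true, true, false, false, true] := leaf _ t31 (by decide) rfl rfl
def t32 : PLift (check 4096 [1,0,0,1,1,1,0,0,0] [0,1,1,0,0,0,1,1,1] [[0,0,1],[0,0,2],[0,0,4],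
  [0,0,8],[0,0,16],[0,0,32],[0,0,64],[0,0,128],[0,0,256],[0,0,512],[0,0,1024],[1,0,1],[0,0,10],
  [0,0,20],[0,0,102],[1,0,140],[0,0,1807],[0,0,276],[1,0,113],[1,0,4207],[1,0,426],[1,125,4181],
  [1,162,48],[1,125,4186],[1,69,70],[1,127,4139],[1,126,25],[1,84,36],[1,65,4145],[1,157,56],
  [1,131,4124],[1,67,4278],[1,131,215],[1,193,14],[1,84,236],[1,166,4105],[1,50,119],[1,95,4243],
  [1,47,46],[1,95,767],[1,161,4740],[1,95,6],[1,0,38],[1,0,4119],[1,0,4421],[1,0,73],[1,0,5356],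
  [1,0,37],[1,0,43],[1,0,4123],[1,0,4109],[1,0,135],[1,0,4199],[1,0,493],[1,0,4269],[1,0,4],
  [1,0,49],[1,0,4130],[0,0,68],[1,0,4470],[1,0,212],[0,0,184],[1,0,4181],[0,0,4208],[1,0,60],
  [0,0,8],[1,0,4214],[0,0,29],[1,0,4150],[0,0,108],[0,0,4469],[1,0,7],[0,0,4230],[1,0,776,275],
  [0,0,42],[0,0,1468],[1,0,4396],[0,0,171],[1,0,8],[0,0,65],[0,0,4301],[1,0,4166],[0,0,4105],
  [1,0,40],[0,0,4149],[0,0,71],[1,0,4106],[0,0,4116],[0,0,127],[0,0,764],[1,0,4185],[0,0,4111,4264],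
  [0,0,5915],[0,0,4146],[1,0,4122],[0,0,4369],[0,0,4406],[0,0,370],[1,0]] = true) := ⟨by decide +kernel⟩
theorem d32 : Dead [false, false, false, true, true, true, false, false, true] := leaf _ t32 (by decide) rfl rfl
def t33 : PLift (check 4096 [1,0,0,1,1,1,0,0,1,0,0] [0,1,1,0,0,0,1,1,0,1,1] [[0,0,1],[0,0,2],
  [0,0,4],[0,0,8],[0,0,16],[0,0,32],[0,0,64],[0,0,128],[0,0,256],[0,0,512],[0,0,1024],[1,0,14],
  [0,0,28],[0,0,56],[0,0,882],[1,0,1750],[0,0,107],[0,0,441],[1,0,4135],[1,38,4218],[1,123,33],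
  [1,120,1],[1,219,4158],[1,75,38],[1,124,51],[1,107,21],[1,94,4227],[1,107,4123],[1,119,137],
  [1,52,4168],[1,162,9],[1,100,2],[1,116,4342],[1,137,58],[1,84,4167],[1,75,70],[1,154,4163],
  [1,98,60],[1,117,4122],[1,125,4204],[1,94,68],[1,162,38],[1,234,18],[1,76,4147],[1,117,4279],
  [1,127,109],[1,97,4245],[1,97,4109],[1,93,175],[1,65,4216],[1,64,34],[1,54,4432],[1,166,4174],
  [1,97,262],[1,65,6],[1,51,4107],[1,48,4110],[1,0,30],[1,0,542],[1,0,4273],[1,66,56],[1,54,347],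
  [1,0,4621],[1,0,6],[1,0,145],[1,0,4239],[1,0,92],[1,0,4144],[1,0,15],[1,0,5360],[1,0,179],
  [1,0,78],[1,0,4119],[1,0,19],[1,0,4236],[1,0,213],[1,0,4298],[1,0,112],[1,0,4123],[1,0,144],
  [0,0,4200],[1,0,47],[1,0,51],[0,0,335],[1,0,4238],[1,0,4137],[0,0,78],[1,0,4126],[0,0,4115],
  [1,0,253],[0,0,4134],[1,0,10],[0,0,4312],[1,0,252],[0,0,4590],[0,0,948],[1,0,21,32],[0,0,72],
  [0,0,4183],[1,0,4119,4155],[0,0,4250],[0,0,4658],[1,0,227],[0,0,136],[0,0,43],[0,0,1060],[1,0,77],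
  [0,0,4446],[0,0,251],[0,0,243],[1,0,8],[0,0,4284],[0,0,4232],[0,0,336],[1,0,1],[0,0,2],[0,0,4],
  [0,0,16],[1,0]] = true) := ⟨by decide +kernel⟩
theorem d33 : Dead [false, false, true, false, false, true, true, true, false, false, true] := leaf _ t33 (by decide) rfl rfl
def t34 : PLift (check 4096 [1,0,0,1,1,1,0,0,1,0,1] [0,1,1,0,0,0,1,1,0,1,0] [[0,0,1],[0,0,2],
  [0,0,4],[0,0,8],[0,0,16],[0,0,32],[0,0,64],[0,0,128],[0,0,256],[0,0,512],[0,0,1024],[1,0,1],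
  [0,0,2],[0,0,28],[0,0,56],[1,0,876],[0,0,1226],[0,0,782],[0,0,4234],[1,0,60],[1,0,4801],[1,0,72],
  [1,51,32],[1,75,23],[1,128,4101],[1,137,4379],[1,131,2],[1,78,114],[1,206,275],[1,130,4121],
  [1,95,59],[1,136,4099],[1,127,4236],[1,183,4165],[1,206,4100],[1,165,75],[1,112,22],[1,185,4197],
  [1,183,5305],[1,185,4140],[1,105,216],[1,94,4162],[1,83,142],[1,131,4136],[1,81,28],[1,57,1],
  [1,71,4245],[1,57,51],[1,77,145],[1,62,17],[1,49,4128],[1,53,14],[1,0,4119],[1,0,5289],[1,0,120],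
  [1,48,4154],[1,0,4104],[1,0,26],[1,0,46],[1,0,123],[1,0,4278],[1,0,9],[1,0,29],[1,0,155],
  [1,0,4109],[1,0,4199],[1,0,4139],[1,0,96],[1,0,4243],[1,0,151],[0,0,4603],[1,0,41],[1,0,4145],
  [0,0,11],[1,0,10],[0,0,56],[1,0,4224],[0,0,4807],[1,0,4164],[0,0,307],[1,0,4382],[0,0,82],
  [0,0,4171],[1,0,56],[0,0,4106],[1,0,666],[0,0,413],[0,0,175],[1,0,290],[0,0,4274],[0,0,4626],
  [0,0,453],[1,0,4376],[0,0,4392],[0,0,134],[0,0,4522],[1,0,4145],[0,0,64],[0,0,55],[0,0,4169],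
  [1,0,20],[0,0,25,4203],[0,0,106],[0,0,1486],[1,0,14],[0,0,236],[0,0,4603],[0,0,4799,145],[1,0,1],
  [0,0,2],[0,0,55],[0,0,110],[1,0]] = true) := ⟨by decide +kernel⟩
theorem d34 : Dead [true, false, true, false, false, true, true, true, false, false, true] := leaf _ t34 (by decide) rfl rfl
def t35 : PLift (check 4096 [1,0,0,1,1,1,0,0,1,1] [0,1,1,0,0,0,1,1,0,0] [[0,0,1],[0,0,2],[0,0,4],
  [0,0,8],[0,0,16],[0,0,32],[0,0,64],[0,0,128],[0,0,256],[0,0,512],[0,0,1024],[1,0,1],[0,0,20],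
  [0,0,40],[0,0,80],[1,0,1686],[0,0,342],[0,0,181],[1,0,159],[1,0,4379],[1,0,71],[1,0,4114],
  [1,0,145],[1,0,4122],[1,0,49],[1,0,39],[1,0,108],[1,0,4391],[1,0,22],[1,0,177],[1,0,4230],
  [1,0,268],[1,0,4271],[0,0,4952],[1,0,76],[1,0,4156],[0,0,6],[1,0,74],[0,0,158],[1,0,4281],
  [0,0,120],[0,0,4234],[1,0,87,50],[0,0,591],[0,0,282],[1,0,4239],[0,0,4533],[0,0,422],[1,0,5],
  [0,0,65],[0,0,269],[0,0,4400],[1,0,10],[0,0,53],[0,0,1001],[0,0,4926],[1,0]] = true) := ⟨by decide +kernel⟩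
theorem d35 : Dead [true, true, false, false, true, true, true, false, false, true] := leaf _ t35 (by decide) rfl rfl
def t36 : PLift (check 4096 [1,0,0,1,1,1,0,1] [0,1,1,0,0,0,1,0] [[0,0,1],[0,0,2],[0,0,4],[0,0,8],
  [0,0,16],[0,0,32],[0,0,64],[0,0,128],[0,0,256],[0,0,512],[0,0,1024],[1,0,1],[0,0,2],[0,0,47],
  [0,0,247],[1,0,449],[0,0,1928],[0,0,93],[0,0,185],[1,0,4165],[1,0,250],[1,0,4199],[1,0,21],
  [1,0,89],[1,0,4492],[1,0,72],[1,0,189],[1,0,4144],[1,0,5],[1,0,4163],[1,0,592],[1,0,4105],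
  [1,0,70],[1,0,44],[1,0,4359],[0,0,251],[1,0,7],[1,0,4203],[0,0,50],[1,0,4142],[0,0,38],[1,0,70],
  [0,0,85],[1,0,4147],[0,0,4324],[0,0,505],[1,0,4162],[0,0,5],[0,0,4172],[1,0,8],[0,0,273],
  [0,0,1373],[0,0,4137],[1,0,65],[0,0,108],[0,0,4218],[0,0,485],[1,0,1],[0,0,2],[0,0,18],[0,0,117],
  [1,0]] = true) := ⟨by decide +kernel⟩
theorem d36 : Dead [true, false, true, true, true, false, false, true] := leaf _ t36 (by decide) rfl rfl
def t37 : PLift (check 4096 [1,0,0,1,1,1,1,0,0] [0,1,1,0,0,0,0,1,1] [[0,0,1],[0,0,2],[0,0,4],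
  [0,0,8],[0,0,16],[0,0,32],[0,0,64],[0,0,128],[0,0,256],[0,0,512],[0,0,1024],[1,0,1],[0,0,10],
  [0,0,110],[0,0,220],[1,0,446],[0,0,1557],[0,0,132],[0,0,4363],[1,0,4624],[1,0,4117],[1,0,400],
  [1,107,4264],[1,157,116],[1,69,4140],[1,84,4112],[1,56,4165],[1,123,4271],[1,69,4111],[1,69,19],
  [1,125,37],[1,84,4109],[1,124,4203],[1,85,21],[1,104,17],[1,125,79],[1,193,173],[1,83,26],
  [1,99,4283],[1,125,4145],[1,92,31],[1,40,128],[1,102,9],[1,39,4],[1,117,310],[1,0,5143],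
  [1,65,251],[1,0,56],[1,0,4233],[1,0,4102],[1,0,63],[1,0,4110],[1,0,92],[1,0,4232],[1,0,109],
  [1,0,760],[1,0,4177],[1,0,4306],[1,0,40],[1,0,1],[0,0,4234],[1,0,228],[0,0,4269],[1,0,200],
  [0,0,4199],[1,0,101],[0,0,4636],[1,0,374],[0,0,4192],[1,0,132],[0,0,18],[0,0,4218],[1,0,428],
  [0,0,4467],[0,0,233],[1,0,61],[0,0,295,5030],[0,0,4611],[0,0,430],[1,0,1],[0,0,3],[0,0,127],
  [0,0,4489],[1,0,2],[0,0,13],[0,0,4207],[0,0,4836,29],[1,0,7],[0,0,31],[0,0,239],[0,0,5648],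
  [1,0]] = true) := ⟨by decide +kernel⟩
theorem d37 : Dead [false, false, true, true, true, true, false, false, true] := leaf _ t37 (by decide) rfl rfl
def t38 : PLift (check 4096 [1,0,0,1,1,1,1,0,1] [0,1,1,0,0,0,0,1,0] [[0,0,1],[0,0,2],[0,0,4],
  [0,0,8],[0,0,16],[0,0,32],[0,0,64],[0,0,128],[0,0,256],[0,0,512],[0,0,1024],[1,0,38],[0,0,87],
  [0,0,174],[0,0,1805],[1,0,333],[0,0,4562],[0,0,4214],[1,0,76],[1,0,4206],[1,185,40],[1,155,175],
  [1,82,4102],[1,105,4109],[1,116,32],[1,98,9],[1,116,35],[1,184,75],[1,184,4361],[1,98,191],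
  [1,124,65],[1,147,18],[1,77,27],[1,116,4122],[1,213,20],[1,166,4100],[1,177,4226],[1,94,4190],
  [1,140,13],[1,185,10],[1,99,17],[1,116,4157],[1,78,4135],[1,107,16],[1,59,4185],[1,101,55],
  [1,58,4122],[1,59,212],[1,97,4098],[1,64,4178],[1,123,17],[1,106,4142],[1,51,4126],[1,194,601],
  [1,70,4127],[1,70,5],[1,48,66],[1,195,149],[1,96,4107],[1,74,4562],[1,105,13],[1,66,4130],
  [1,45,28],[1,74,598],[1,71,4106],[1,51,33],[1,0,89],[1,0,4146],[1,0,4],[1,0,23],[1,0,7],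
  [1,0,4413],[1,0,4160],[1,0,263],[1,0,5240],[1,0,120],[1,0,8],[1,0,4318],[1,0,283],[1,0,4253],
  [1,0,25],[0,0,20],[1,0,4246],[1,0,4316],[0,0,589],[1,0,4693],[0,0,127],[1,0,4131],[0,0,4200],
  [1,0,109],[0,0,4189],[0,0,4215],[1,0,4287,52],[0,0,293],[0,0,34],[1,0,53],[0,0,4588],[0,0,4462],
  [0,0,1229],[1,0,4123],[0,0,4106],[0,0,4121],[0,0,4129],[1,0,3],[0,0,222],[0,0,425],[0,0,4148],
  [1,0]] = true) := ⟨by decide +kernel⟩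
theorem d38 : Dead [true, false, true, true, true, true, false, false, true] := leaf _ t38 (by decide) rfl rfl
def t39 : PLift (check 4096 [1,0,0,1,1,1,1,1] [0,1,1,0,0,0,0,0] [[0,0,1],[0,0,2],[0,0,4],[0,0,8],
  [0,0,16],[0,0,32],[0,0,64],[0,0,128],[0,0,256],[0,0,512],[0,0,1024],[1,0,1],[0,0,2],[0,0,41],
  [0,0,113],[1,0,160],[0,0,320],[0,0,1566],[0,0,625],[1,0,4637],[0,0,4409],[1,0,59],[1,0,91],
  [1,0,4231],[1,0,4421],[1,0,1023],[1,0,4139],[1,0,4397],[1,0,33],[1,0,72],[1,0,35],[1,0,260],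
  [1,0,4132],[1,0,14],[1,0,862],[1,0,4175],[0,0,4193],[1,0,52],[1,0,4205],[0,0,28],[1,0,4174],
  [0,0,4515],[1,0,7],[0,0,199],[1,0,8],[0,0,4199],[1,0,4190,122],[0,0,188],[0,0,4638],[1,0,155],
  [0,0,320],[0,0,146],[1,0,122],[0,0,429],[0,0,4247],[0,0,4565],[1,0,8],[0,0,713],[0,0,5151,4107],
  [0,0,236],[1,0]] = true) := ⟨by decide +kernel⟩
theorem d39 : Dead [true, true, true, true, true, false, false, true] := leaf _ t39 (by decide) rfl rfl
def t40 : PLift (check 4096 [1,0,1,0,0,0] [0,1,0,1,1,1] [[0,0,1],[0,0,2],[0,0,4],[0,0,8],[0,0,16],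
  [0,0,32],[0,0,64],[0,0,128],[0,0,256],[0,0,512],[0,0,1024],[1,0]] = true) := ⟨by decide +kernel⟩
theorem d40 : Dead [false, false, false, true, false, true] := leaf _ t40 (by decide) rfl rfl
def t41 : PLift (check 4096 [1,0,1,0,0,1,0] [0,1,0,1,1,0,1] [[0,0,1],[0,0,2],[0,0,4],[0,0,8],
  [0,0,16],[0,0,32],[0,0,64],[0,0,128],[0,0,256],[0,0,512],[0,0,1024],[1,0,8],[0,0,16],[0,0,32],
  [0,0,64],[1,0,1790],[0,0,262],[0,0,943],[1,0,4155],[1,49,4576],[1,97,4145],[1,88,274],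
  [1,135,4136],[1,147,4222],[1,97,4126],[1,135,24],[1,198,4151],[1,93,4148],[1,100,113],[1,97,4177],
  [1,94,49],[1,94,4100],[1,69,41],[1,63,4107],[1,52,2],[1,63,18],[1,44,4329],[1,41,134],[1,65,4180],
  [1,42,4105],[1,57,10],[1,0,44],[1,0,27],[1,0,4143],[1,0,31],[1,0,220],[1,0,4165],[1,0,11],
  [1,0,690],[1,0,5596],[1,0,113],[1,0,6],[1,0,4130],[1,0,4],[1,0,4222],[1,0,16],[1,0,109],
  [0,0,4208],[1,0,180],[1,0,4257],[0,0,165],[1,0,4215],[0,0,156],[1,0,4226],[0,0,4104],[1,0,4145],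
  [0,0,4102],[1,0,58],[0,0,141],[1,0,103],[0,0,4475],[0,0,4146],[1,0,29],[0,0,1124],[0,0,4340],
  [1,0,18],[0,0,287],[0,0,4862],[1,0,4171],[0,0,336],[0,0,4712],[0,0,5316],[1,0,33],[0,0,130],
  [0,0,170],[0,0,4253],[1,0,1],[0,0,2],[0,0,4],[0,0,21],[1,0]] = true) := ⟨by decide +kernel⟩
theorem d41 : Dead [false, true, false, false, true, false, true] := leaf _ t41 (by decide) rfl rfl
def t42 : PLift (check 4096 [1,0,1,0,0,1,1,0] [0,1,0,1,1,0,0,1] [[0,0,1],[0,0,2],[0,0,4],[0,0,8],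
  [0,0,16],[0,0,32],[0,0,64],[0,0,128],[0,0,256],[0,0,512],[0,0,1024],[1,0,4],[0,0,8],[0,0,16],
  [0,0,32],[1,0,506],[0,0,1845],[0,0,75],[1,0,4290],[0,0,102],[1,0,4644],[1,63,247],[1,98,4329],
  [1,127,4173],[1,96,34],[1,177,107],[1,166,4230],[1,128,12],[1,218,4134],[1,81,4149],[1,132,52],
  [1,60,4131],[1,142,4112],[1,218,4108],[1,246,27],[1,118,4144],[1,215,4213],[1,145,4332],
  [1,117,151],[1,116,35],[1,162,30],[1,215,7],[1,176,43],[1,129,4106],[1,81,4111],[1,166,4696],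
  [1,65,33],[1,60,65],[1,93,60],[1,140,4147],[1,97,6],[1,69,4131],[1,165,3],[1,123,81],[1,98,5895],
  [1,91,25],[1,69,107],[1,69,12],[1,130,155],[1,173,4106],[1,123,4101],[1,107,4207],[1,146,4112],
  [1,89,4143],[1,64,4097],[1,92,4196],[1,60,35],[1,116,28],[1,219,4180],[1,205,20],[1,82,4175],
  [1,120,6],[1,70,4114],[1,126,299],[1,69,4123],[1,73,52],[1,99,4135],[1,125,4254],[1,105,24],
  [1,121,8],[1,136,30],[1,61,4119],[1,61,81],[1,57,4114],[1,46,4111],[1,0,4115],[1,0,152],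
  [1,0,4102],[1,0,4218],[1,0,90],[1,0,168],[1,0,124],[1,0,4251],[1,0,4981],[1,0,296],[1,0,4139],
  [1,0,15],[1,0,82],[1,0,41],[1,0,4225],[0,0,4329],[1,0,54],[1,0,4163],[0,0,381],[1,0,35],[0,0,306],
  [1,0,4347],[0,0,214],[1,0,4221,4174],[0,0,4812],[0,0,287],[1,0,24],[0,0,4238],[0,0,4464],[1,0,49],
  [0,0,122,4682],[0,0,4205],[0,0,4115],[1,0,2],[0,0,4574],[0,0,174],[0,0,4924],[1,0,1],[0,0,4],
  [0,0,10],[0,0,20],[1,0,2],[0,0,35],[0,0,70],[0,0,296],[1,0]] = true) := ⟨by decide +kernel⟩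
theorem d42 : Dead [false, true, true, false, false, true, false, true] := leaf _ t42 (by decide) rfl rfl
def t43 : PLift (check 4096 [1,0,1,0,0,1,1,1] [0,1,0,1,1,0,0,0] [[0,0,1],[0,0,2],[0,0,4],[0,0,8],
  [0,0,16],[0,0,32],[0,0,64],[0,0,128],[0,0,256],[0,0,512],[0,0,1024],[1,0,4],[0,0,8],[0,0,16],
  [0,0,32],[1,0,1087],[0,0,782],[0,0,4469],[1,0,57],[1,0,115],[1,63,4138],[1,96,4119],[1,130,114],
  [1,99,29],[1,155,4168],[1,52,30],[1,102,15],[1,175,4447],[1,232,18],[1,129,74],[1,133,4100],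
  [1,173,4204],[1,172,252],[1,172,16],[1,94,5560],[1,165,294],[1,99,4169],[1,101,4126],[1,123,186],
  [1,59,4118],[1,126,4160],[1,72,21],[1,125,53],[1,52,78],[1,58,4099],[1,71,4130],[1,71,7],
  [1,42,4217],[1,0,25],[1,0,51],[1,0,41],[1,0,4305],[1,0,4408],[1,0,689],[1,0,4849],[1,0,8],
  [1,0,4139],[1,0,82],[1,0,155],[1,0,4180],[1,0,9],[1,0,85],[1,0,4150],[1,0,112],[1,0,4152],
  [0,0,244],[1,0,4124],[1,0,92],[0,0,4924],[1,0,321],[0,0,124],[1,0,4162],[0,0,4228],[1,0,298],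
  [0,0,4380],[1,0,11,747],[0,0,224],[0,0,4201],[1,0,137],[0,0,4221],[0,0,404],[1,0,3],[0,0,4292],
  [0,0,4312,6],[0,0,179],[1,0,1],[0,0,20],[0,0,50],[0,0,537],[1,0,1],[0,0,2],[0,0,4],[0,0,8],
  [1,0]] = true) := ⟨by decide +kernel⟩
theorem d43 : Dead [true, true, true, false, false, true, false, true] := leaf _ t43 (by decide) rfl rfl
def t44 : PLift (check 4096 [1,0,1,0,1] [0,1,0,1,0] [[0,0,1],[0,0,2],[0,0,4],[0,0,8],[0,0,16],
  [0,0,32],[0,0,64],[0,0,128],[0,0,256],[0,0,512],[0,0,1024],[1,0,1],[0,0,2],[0,0,32],[0,0,64],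
  [1,0,125],[0,0,250],[0,0,500],[0,0,1000],[1,0,1704],[0,0,4541],[1,0,77],[1,0,4121],[1,129,4461],
  [1,123,47],[1,130,65],[1,220,4119],[1,121,4],[1,232,4249],[1,58,12],[1,99,4102],[1,78,4122],
  [1,57,14],[1,48,4109],[1,0,4946],[1,0,4],[1,0,36],[1,0,4187],[1,0,4320],[1,0,68],[1,0,4372],
  [1,0,4122],[1,0,4130],[1,0,4137],[1,0,25],[1,0,4216],[0,0,4185],[1,0,39],[1,0,4556],[0,0,11],
  [1,0,210],[0,0,5468],[1,0,22],[0,0,166],[1,0,31,187],[0,0,4388],[0,0,233],[1,0,4244],[0,0,4392],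
  [0,0,276],[1,0,4537],[0,0,69],[0,0,4277],[0,0,209],[1,0,2],[0,0,116],[0,0,4624,68],[0,0,202],
  [1,0,25],[0,0,571],[0,0,4472,247],[0,0,274],[1,0,1],[0,0,8],[0,0,4433],[0,0,10],[1,0,1],[0,0,2],
  [0,0,4],[0,0,26],[1,0]] = true) := ⟨by decide +kernel⟩
theorem d44 : Dead [true, false, true, false, true] := leaf _ t44 (by decide) rfl rfl
def t45 : PLift (check 4096 [1,0,1,1,0,0,0,0] [0,1,0,0,1,1,1,1] [[0,0,1],[0,0,2],[0,0,4],[0,0,8],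
  [0,0,16],[0,0,32],[0,0,64],[0,0,128],[0,0,256],[0,0,512],[0,0,1024],[1,0,4],[0,0,8],[0,0,16],
  [0,0,32],[1,0,241],[0,0,978],[0,0,1956],[0,0,66],[1,0,97],[1,0,4151],[1,0,4359],[1,0,9],[1,0,35],
  [1,0,4166],[1,0,49],[1,0,159],[1,0,4103],[1,0,1],[1,0,4149],[1,0,477],[1,0,4129],[1,0,4139],
  [1,0,4215],[1,0,95],[1,0,4108],[1,0,4122],[1,0,58],[1,0,60],[1,0,4963],[1,0,256],[1,0,4109],
  [1,0,4302],[1,0,4138],[1,0,137],[1,0,4281],[0,0,10],[1,0,41],[1,0,115],[0,0,4135],[1,0,15],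
  [0,0,9],[1,0,228],[0,0,5078],[1,0,102],[0,0,128],[1,0,4115],[0,0,98],[0,0,4206],[1,0,4129,654],
  [0,0,66],[0,0,360],[1,0,4178,225],[0,0,4274],[0,0,397],[1,0,4478],[0,0,4860,10],[0,0,534],
  [0,0,4993],[1,0,2],[0,0,28],[0,0,189],[0,0,4364,1258],[1,0,1],[0,0,14],[0,0,141],[0,0,603,2],
  [1,0,4],[0,0,22],[0,0,47],[0,0,472],[1,0]] = true) := ⟨by decide +kernel⟩
theorem d45 : Dead [false, false, false, false, true, true, false, true] := leaf _ t45 (by decide) rfl rfl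
def t46 : PLift (check 4096 [1,0,1,1,0,0,0,1] [0,1,0,0,1,1,1,0] [[0,0,1],[0,0,2],[0,0,4],[0,0,8],
  [0,0,16],[0,0,32],[0,0,64],[0,0,128],[0,0,256],[0,0,512],[0,0,1024],[1,0,4],[0,0,8],[0,0,527],
  [0,0,1054],[1,0,1488],[0,0,4141],[0,0,4529],[1,0,4122],[1,105,4212],[1,128,196],[1,175,95],
  [1,175,4099],[1,194,148],[1,98,4111],[1,136,4106],[1,170,4497],[1,52,4133],[1,135,75],[1,65,9],
  [1,175,44],[1,130,4160],[1,120,4120],[1,73,4128],[1,107,4156],[1,89,45],[1,183,4175],[1,128,4099],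
  [1,97,4116],[1,183,4681],[1,177,78],[1,183,38],[1,123,4098],[1,86,144],[1,140,4151],[1,88,70],
  [1,88,4281],[1,107,4559],[1,125,102],[1,131,21],[1,80,44],[1,80,4098],[1,131,4097],[1,69,121],
  [1,63,5229],[1,125,214],[1,95,4126],[1,80,170],[1,125,71],[1,123,59],[1,125,32],[1,65,38],
  [1,95,4099],[1,92,141],[1,105,178],[1,136,24],[1,92,28],[1,78,4128],[1,53,452],[1,85,4265],
  [1,57,76],[1,54,5],[1,49,4202],[1,57,13],[1,0,4237],[1,0,4163],[1,44,542],[1,100,95],[1,72,4346],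
  [1,55,33],[1,52,4133],[1,0,4111],[1,46,4231],[1,103,24],[1,58,4162],[1,0,4143],[1,0,158],
  [1,53,11],[1,0,12],[1,0,53],[1,0,4285],[1,0,457],[1,0,4205],[1,0,17],[1,0,38],[1,0,4109],
  [1,0,4148],[1,0,1080],[1,0,4221],[1,0,4114],[1,0,60],[1,0,4153],[1,0,139],[1,0,30],[1,0,4242],
  [0,0,46],[1,0,4179],[0,0,19],[1,0,137],[0,0,4384],[1,0,24,5128],[0,0,245],[0,0,5271],[1,0,88,274],
  [0,0,39],[0,0,130],[1,0,4274],[0,0,4452],[0,0,143],[1,0,4132],[0,0,4224],[0,0,4347],[0,0,477],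
  [1,0,3],[0,0,6],[0,0,13],[0,0,4249],[1,0,1],[0,0,15],[0,0,30],[0,0,60],[1,0]] = true) := ⟨by decide +kernel⟩
theorem d46 : Dead [true, false, false, false, true, true, false, true] := leaf _ t46 (by decide) rfl rfl
def t47 : PLift (check 4096 [1,0,1,1,0,0,1,0] [0,1,0,0,1,1,0,1] [[0,0,1],[0,0,2],[0,0,4],[0,0,8],
  [0,0,16],[0,0,32],[0,0,64],[0,0,128],[0,0,256],[0,0,512],[0,0,1024],[1,0,4],[0,0,8],[0,0,16],
  [0,0,32],[1,0,66],[0,0,752],[0,0,1393],[0,0,4369],[1,0,134],[1,0,4249],[1,57,99],[1,91,9],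
  [1,140,4353],[1,96,13],[1,146,4158],[1,171,4108],[1,145,90],[1,171,4395],[1,102,306],[1,111,4167],
  [1,89,5],[1,132,52],[1,195,4099],[1,111,4142],[1,98,4119],[1,196,297],[1,196,4123],[1,170,4132],
  [1,106,125],[1,170,4201],[1,49,26],[1,137,4097],[1,105,4129],[1,137,201],[1,71,48],[1,42,5],
  [1,75,9],[1,0,322],[1,77,4417],[1,57,130],[1,44,4129],[1,0,4107],[1,0,4526],[1,0,7],[1,0,55],
  [1,0,308],[1,0,8],[1,0,4356],[1,0,66],[1,0,27],[1,0,145],[1,0,4267],[1,0,70],[1,0,4143],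
  [1,0,5003],[1,0,961],[1,0,4108],[1,0,4132],[1,0,4193],[1,0,45],[1,0,4167],[1,0,55],[1,0,4124],
  [1,0,4133],[1,0,5],[1,0,93],[1,0,4121],[1,0,4140],[0,0,4357],[1,0,17],[1,0,43],[0,0,4251],
  [1,0,122],[0,0,171],[1,0,67],[0,0,4105],[0,0,371],[1,0,4097],[0,0,4117],[1,0,3],[0,0,93],
  [0,0,5960],[1,0,4203,4236],[0,0,4144],[0,0,965],[1,0,55],[0,0,4249,4777],[0,0,4326],[1,0,5],
  [0,0,36],[0,0,400],[0,0,42,613],[1,0,1],[0,0,2],[0,0,9],[0,0,18],[1,0]] = true) := ⟨by decide +kernel⟩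
theorem d47 : Dead [false, true, false, false, true, true, false, true] := leaf _ t47 (by decide) rfl rfl
def t48 : PLift (check 4096 [1,0,1,1,0,0,1,1,0,0,0] [0,1,0,0,1,1,0,0,1,1,1] [[0,0,1],[0,0,2],
  [0,0,4],[0,0,8],[0,0,16],[0,0,32],[0,0,64],[0,0,128],[0,0,256],[0,0,512],[0,0,1024],
  [1,0]] = true) := ⟨by decide +kernel⟩
theorem d48 : Dead [false, false, false, true, true, false, false, true, true, false, true] := leaf _ t48 (by decide) rfl rfl
def t49 : PLift (check 4096 [1,0,1,1,0,0,1,1,0,0,1,0] [0,1,0,0,1,1,0,0,1,1,0,1] [[0,0,1],[0,0,2],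
  [0,0,4],[0,0,8],[0,0,16],[0,0,32],[0,0,64],[0,0,128],[0,0,256],[0,0,512],[0,0,1024],
  [1,0]] = true) := ⟨by decide +kernel⟩
theorem d49 : Dead [false, true, false, false, true, true, false, false, true, true, false, true] := leaf _ t49 (by decide) rfl rfl
def t50 : PLift (check 4096 [1,0,1,1,0,0,1,1,0,0,1,1,0,0] [0,1,0,0,1,1,0,0,1,1,0,0,1,1] [[0,0,1],
  [0,0,2],[0,0,4],[0,0,8],[0,0,16],[0,0,32],[0,0,64],[0,0,128],[0,0,256],[0,0,512],[0,0,1024],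
  [1,0]] = true) := ⟨by decide +kernel⟩
theorem d50 : Dead [false, false, true, true, false, false, true, true, false, false, true, true, false, true] := leaf _ t50 (by decide) rfl rfl

  def t51 : PLift (check 4096 [1,0,1,1,0,0,1,1,0,0,1,1,0,1,0,0] [0,1,0,0,1,1,0,0,1,1,0,0,1,0,1,1] [[0,0,1],
  [0,0,2],[0,0,4],[0,0,8],[0,0,16],[0,0,32],[0,0,64],[0,0,128],[0,0,256],[0,0,512],[0,0,1024],
  [1,0,1],[0,0,16],[0,0,1240],[0,0,796,4448],[1,0,4196],[0,0,4821],[1,0,4145],[1,0,25],[1,173,197],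
  [1,135,4110],[1,88,89],[1,84,4103],[1,164,4176],[1,174,4128],[1,98,111],[1,164,47],[1,133,106],
  [1,102,4285],[1,167,4115],[1,93,43],[1,195,67],[1,77,4151],[1,89,81],[1,141,4109],[1,107,4103],
  [1,85,34],[1,193,4105],[1,92,26],[1,124,104],[1,57,4162],[1,61,4126],[1,82,478],[1,52,4099],
  [1,49,18],[1,0,4517],[1,0,109],[1,0,192],[1,0,4264],[1,0,4161],[1,0,163],[1,0,4142],[1,0,4186],
  [1,0,1023],[1,0,5092],[1,0,1],[1,0,4117],[1,0,76],[1,0,4125],[1,0,90],[1,0,12],[1,0,45],[1,0,87],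
  [0,0,4176],[1,0,98],[1,0,4105],[0,0,355],[1,0,174],[0,0,206],[1,0,16],[0,0,234],[1,0,8],
  [0,0,1162],[0,0,4185],[1,0,87],[0,0,9],[0,0,4165],[1,0,363],[0,0,4354,222],[0,0,577],[0,0,4983],
  [1,0,111],[0,0,4343,4097],[0,0,27],[0,0,99],[1,0,1],[0,0,2],[0,0,4],[0,0,47],[1,0]] = true) := ⟨by decide +kernel⟩
theorem d51 : Dead [false, false, true, false, true, true, false, false, true, true, false, false, true, true, false, true] := leaf _ t51 (by decide) rfl rfl

  def t52 : PLift (check 4096 [1,0,1,1,0,0,1,1,0,0,1,1,0,1,0,1] [0,1,0,0,1,1,0,0,1,1,0,0,1,0,1,0] [[0,0,1],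
  [0,0,2],[0,0,4],[0,0,8],[0,0,16],[0,0,32],[0,0,64],[0,0,128],[0,0,256],[0,0,512],[0,0,1024],
  [1,0,97],[0,0,1274],[0,0,304,4821],[0,0,276],[1,0,98],[1,0,4969],[1,36,205],[1,97,4256],
  [1,52,4198],[1,112,23],[1,134,254],[1,89,4170],[1,165,4118],[1,176,8],[1,174,4207],[1,245,4129],
  [1,162,11],[1,96,4136],[1,123,13],[1,166,4401],[1,120,4098],[1,123,4114],[1,134,4097],
  [1,162,4125],[1,142,4102],[1,93,103],[1,93,4145],[1,104,56],[1,92,74],[1,98,42],[1,107,4565],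
  [1,98,123],[1,69,360],[1,88,4228],[1,98,70],[1,104,142],[1,83,29],[1,131,4179],[1,57,1],[1,56,22],
  [1,100,237],[1,147,4161],[1,85,4150],[1,47,27],[1,79,4184],[1,0,4197],[1,0,288],[1,0,5202],
  [1,0,682],[1,0,4170],[1,0,28],[1,0,4157],[1,0,4107],[1,0,113],[1,0,4158],[1,0,4125],[1,0,47],
  [1,0,4355],[1,0,31],[0,0,97],[1,0,4268],[1,0,107],[0,0,4399],[1,0,216],[0,0,508],[1,0,4115],
  [0,0,4156],[1,0,4302,4140],[0,0,32],[0,0,16],[1,0,4276],[0,0,46],[0,0,398],[1,0,132],[0,0,4401],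
  [0,0,304],[1,0,12],[0,0,163],[0,0,4643,4106],[0,0,250],[1,0,1],[0,0,2],[0,0,8],[0,0,266],[1,0,4],
  [0,0,8],[0,0,16],[0,0,32],[1,0]] = true) := ⟨by decide +kernel⟩
theorem d52 : Dead [true, false, true, false, true, true, false, false, true, true, false, false, true, true, false, true] := leaf _ t52 (by decide) rfl rfl

  def t53 : PLift (check 4096 [1,0,1,1,0,0,1,1,0,0,1,1,0,1,1] [0,1,0,0,1,1,0,0,1,1,0,0,1,0,0] [[0,0,1],
  [0,0,2],[0,0,4],[0,0,8],[0,0,16],[0,0,32],[0,0,64],[0,0,128],[0,0,256],[0,0,512],[0,0,1024],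
  [1,0,1],[0,0,8],[0,0,906],[0,0,1052],[1,0,4580],[0,0,4346],[0,0,968],[1,0,4215],[1,0,4237],
  [1,0,4255],[1,0,219],[1,0,4103],[1,0,4384],[1,0,78],[1,0,4194],[1,0,25],[1,0,4137],[1,0,93],
  [1,0,4186],[1,0,4412],[1,0,8],[0,0,83],[1,0,4275],[0,0,4966],[1,0,347],[0,0,4169],[1,0,19,510],
  [0,0,39],[0,0,5657],[1,0,83],[0,0,458,4105],[0,0,1],[0,0,257],[1,0,10],[0,0,162],[0,0,4157,60],
  [0,0,4177],[1,0,1],[0,0,2],[0,0,4],[0,0,8],[1,0]] = true) := ⟨by decide +kernel⟩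
theorem d53 : Dead [true, true, false, true, true, false, false, true, true, false, false, true, true, false, true] := leaf _ t53 (by decide) rfl rfl
def t54 : PLift (check 4096 [1,0,1,1,0,0,1,1,0,0,1,1,1] [0,1,0,0,1,1,0,0,1,1,0,0,0] [[0,0,1],
  [0,0,2],[0,0,4],[0,0,8],[0,0,16],[0,0,32],[0,0,64],[0,0,128],[0,0,256],[0,0,512],[0,0,1024],
  [1,0,1],[0,0,2],[0,0,4],[0,0,16],[1,0,177],[0,0,354],[0,0,1430],[0,0,4802],[1,0,4244],[0,0,62],
  [1,0,41],[0,0,85],[1,0,4235],[1,0,16],[1,0,237],[1,0,4124],[0,0,10],[1,0,29],[1,0,108],[0,0,4110],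
  [1,0,4450],[0,0,164],[1,0,51],[0,0,238],[1,0,4256],[0,0,4297],[1,0,3,5060],[0,0,4800],[0,0,390],
  [1,0,4240,284],[0,0,4178],[0,0,22],[1,0,4340],[0,0,11],[0,0,4398],[0,0,1477],[1,0,5],[0,0,43],
  [0,0,64],[0,0,4212],[1,0,1],[0,0,4758],[0,0,313,238],[0,0,1236],[1,0,2],[0,0,4],[0,0,8],[0,0,16],
  [1,0]] = true) := ⟨by decide +kernel⟩
theorem d54 : Dead [true, true, true, false, false, true, true, false, false, true, true, false, true] := leaf _ t54 (by decide) rfl rfl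
def t55 : PLift (check 4096 [1,0,1,1,0,0,1,1,0,1] [0,1,0,0,1,1,0,0,1,0] [[0,0,1],[0,0,2],[0,0,4],
  [0,0,8],[0,0,16],[0,0,32],[0,0,64],[0,0,128],[0,0,256],[0,0,512],[0,0,1024],[1,0]] = true) := ⟨by decide +kernel⟩
theorem d55 : Dead [true, false, true, true, false, false, true, true, false, true] := leaf _ t55 (by decide) rfl rfl
def t56 : PLift (check 4096 [1,0,1,1,0,0,1,1,1] [0,1,0,0,1,1,0,0,0] [[0,0,1],[0,0,2],[0,0,4],
  [0,0,8],[0,0,16],[0,0,32],[0,0,64],[0,0,128],[0,0,256],[0,0,512],[0,0,1024],[1,0,2],[0,0,4],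
  [0,0,1783],[0,0,161],[1,0,4425],[0,0,4470],[1,0,110],[1,47,4170],[1,97,4213],[1,107,3],
  [1,95,4128],[1,132,88],[1,162,37],[1,91,2],[1,93,4129],[1,121,4120],[1,132,4257],[1,107,89],
  [1,93,73],[1,243,4118],[1,162,110],[1,164,4134],[1,163,4331],[1,178,4721],[1,121,87],[1,116,24],
  [1,112,131],[1,196,4226],[1,60,46],[1,112,4133],[1,120,4145],[1,128,10],[1,106,2],[1,97,4118],
  [1,98,36],[1,166,77],[1,205,4146],[1,120,8],[1,197,4163],[1,98,88],[1,172,377],[1,197,3],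
  [1,134,4523],[1,175,4235],[1,197,39],[1,149,109],[1,162,59],[1,175,4103],[1,97,230],[1,134,4099],
  [1,195,21],[1,97,4128],[1,97,106],[1,98,5769],[1,174,54],[1,149,4143],[1,163,27],[1,98,4129],
  [1,106,353],[1,140,8],[1,123,40],[1,123,4159],[1,106,4098],[1,82,4242],[1,68,4150],[1,166,46],
  [1,65,4119],[1,169,128],[1,80,39],[1,56,4229],[1,57,59],[1,205,24],[1,183,4134],[1,125,28],
  [1,47,4165],[1,46,257],[1,46,4125],[1,0,4239],[1,0,13],[1,0,128],[1,0,4197],[1,0,77],[1,0,4290],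
  [1,0,4100],[1,0,4107],[1,0,56],[1,0,162],[1,0,5219],[1,0,1171],[1,0,4187],[1,0,27],[1,0,4424],
  [1,0,25],[1,0,4111],[1,0,108],[0,0,51],[1,0,4209],[1,0,8],[0,0,689],[1,0,4193],[0,0,4619],
  [1,0,63],[0,0,4192],[1,0,4317],[0,0,30],[1,0,104,4338],[0,0,99],[0,0,4304],[1,0,19],[0,0,481],
  [0,0,4157],[1,0,4315],[0,0,4158,112],[0,0,767],[0,0,4310],[1,0,4326],[0,0,181],[0,0,4455],
  [0,0,339],[1,0,3],[0,0,7],[0,0,285],[0,0,4968],[1,0,1],[0,0,2],[0,0,4],[0,0,8],[1,0]] = true) := ⟨by decide +kernel⟩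
theorem d56 : Dead [true, true, true, false, false, true, true, false, true] := leaf _ t56 (by decide) rfl rfl
def t57 : PLift (check 4096 [1,0,1,1,0,1,0] [0,1,0,0,1,0,1] [[0,0,1],[0,0,2],[0,0,4],[0,0,8],
  [0,0,16],[0,0,32],[0,0,64],[0,0,128],[0,0,256],[0,0,512],[0,0,1024],[1,0,4],[0,0,8],[0,0,16],
  [0,0,32],[1,0,315],[0,0,630],[0,0,1260],[0,0,1477],[1,0,71],[0,0,4206],[1,0,70],[1,0,4172],
  [1,40,4105],[1,48,4254],[1,49,8],[1,46,4402],[1,51,74],[1,108,4581],[1,53,89],[1,79,4105],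
  [1,52,4183],[1,66,23],[1,79,4157],[1,79,3],[1,46,4114],[1,79,316],[1,58,4185],[1,0,4140],
  [1,0,4118],[1,0,8],[1,0,4116],[1,0,4195],[1,0,88],[1,0,4405],[1,0,4109],[1,0,34],[1,0,5594],
  [1,0,61],[1,0,4125],[1,0,4132],[1,0,24],[0,0,288],[1,0,4179],[1,0,4187],[0,0,34],[1,0,4121],
  [0,0,4562],[1,0,4101],[1,0,27],[0,0,9],[1,0,4141],[0,0,251],[1,0,4125],[0,0,4236],[1,0,42,4190],
  [0,0,195],[0,0,4172],[1,0,323,4133],[0,0,4666],[0,0,126],[1,0,901],[0,0,4565],[0,0,954],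
  [1,0,4362],[0,0,16],[0,0,4196],[1,0,40],[0,0,188],[0,0,252],[0,0,82],[1,0,1],[0,0,2],[0,0,31],
  [0,0,4729],[1,0,4],[0,0,8],[0,0,16],[0,0,33],[1,0]] = true) := ⟨by decide +kernel⟩
theorem d57 : Dead [false, true, false, true, true, false, true] := leaf _ t57 (by decide) rfl rfl
def t58 : PLift (check 4096 [1,0,1,1,0,1,1,0,0] [0,1,0,0,1,0,0,1,1] [[0,0,1],[0,0,2],[0,0,4],
  [0,0,8],[0,0,16],[0,0,32],[0,0,64],[0,0,128],[0,0,256],[0,0,512],[0,0,1024],[1,0,1],[0,0,2],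
  [0,0,4],[0,0,8],[1,0,112],[0,0,224],[0,0,1902],[0,0,198],[1,0,4344],[0,0,4129],[1,0,4225],
  [1,84,144],[1,103,56],[1,103,77],[1,133,4198],[1,134,38],[1,126,62],[1,206,4164],[1,103,4148],
  [1,194,4162],[1,195,64],[1,178,4109],[1,157,4153],[1,246,4274],[1,195,6],[1,184,4138],[1,60,26],
  [1,208,4588],[1,86,16],[1,94,363],[1,213,23],[1,165,4159],[1,98,10],[1,184,29],[1,208,4101],
  [1,246,4306],[1,174,4186],[1,184,101],[1,206,4165],[1,118,4118],[1,81,8],[1,206,62],[1,111,25],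
  [1,131,4102],[1,86,4225],[1,130,11],[1,74,142],[1,74,18],[1,58,4156],[1,52,28],[1,61,125],
  [1,233,4361],[1,83,4132],[1,0,4114],[1,51,9],[1,108,4],[1,0,169],[1,0,2],[1,0,4177],[1,0,677],
  [1,0,130],[1,0,4158],[1,0,14],[1,0,4192],[1,0,66],[1,0,37],[1,0,180],[1,0,4336],[1,0,117],
  [1,0,79],[1,0,4377],[1,0,331],[1,0,4154],[1,0,4296],[1,0,155],[0,0,4232],[1,0,307],[1,0,54],
  [0,0,4137],[1,0,5351],[0,0,110],[1,0,4181],[0,0,24],[1,0,4360,509],[0,0,37],[1,0,56],[0,0,391],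
  [0,0,77],[1,0,190],[0,0,4158],[0,0,66],[0,0,4212],[1,0,4527],[0,0,362],[0,0,5642],[0,0,310],
  [1,0,3],[0,0,101],[0,0,91],[0,0,512],[1,0]] = true) := ⟨by decide +kernel⟩
theorem d58 : Dead [false, false, true, true, false, true, true, false, true] := leaf _ t58 (by decide) rfl rfl
def t59 : PLift (check 4096 [1,0,1,1,0,1,1,0,1] [0,1,0,0,1,0,0,1,0] [[0,0,1],[0,0,2],[0,0,4],
  [0,0,8],[0,0,16],[0,0,32],[0,0,64],[0,0,128],[0,0,256],[0,0,512],[0,0,1024],[1,0,1],[0,0,2],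
  [0,0,4],[0,0,8],[1,0,16],[0,0,120],[0,0,240],[0,0,1926],[1,0,29],[0,0,78],[0,0,56],[1,0,4169],
  [1,0,4327],[1,0,4155],[1,38,96],[1,54,4377],[1,47,95],[1,76,138],[1,65,4332],[1,106,4104],
  [1,66,9],[1,106,4464],[1,79,997],[1,72,5],[1,65,4175],[1,77,22],[1,62,3],[1,105,4155],[1,38,4528],
  [1,104,171],[1,0,4124],[1,41,4294],[1,0,115],[1,0,4109],[1,0,4263],[1,0,20],[1,0,4106],[1,0,4150],
  [1,0,4195],[1,0,27],[1,0,33],[1,0,4479],[1,0,9],[1,0,4135],[1,0,35],[0,0,5535],[1,0,34],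
  [1,0,4132],[0,0,77],[1,0,4128],[1,0,16],[0,0,8],[1,0,4159],[0,0,4107],[1,0,12],[0,0,205],[1,0,35],
  [0,0,4180],[0,0,4452],[1,0,157],[0,0,75],[1,0,26,4190],[0,0,18],[0,0,123],[1,0,4342],[0,0,4108],
  [0,0,4204],[1,0,36],[0,0,45],[0,0,4239],[1,0,5104],[0,0,212,72],[0,0,4182],[0,0,4214],[1,0,21],
  [0,0,4283],[0,0,41],[0,0,538],[1,0,1],[0,0,32],[0,0,47,5614],[0,0,64],[1,0,13],[0,0,4359],
  [0,0,81],[0,0,1045],[1,0,6],[0,0,29],[0,0,217],[0,0,4530],[1,0]] = true) := ⟨by decide +kernel⟩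
theorem d59 : Dead [true, false, true, true, false, true, true, false, true] := leaf _ t59 (by decide) rfl rfl
def t60 : PLift (check 4096 [1,0,1,1,0,1,1,1] [0,1,0,0,1,0,0,0] [[0,0,1],[0,0,2],[0,0,4],[0,0,8],
  [0,0,16],[0,0,32],[0,0,64],[0,0,128],[0,0,256],[0,0,512],[0,0,1024],[1,0,2],[0,0,4],[0,0,8],
  [0,0,16],[1,0,156],[0,0,312],[0,0,765],[0,0,1530],[1,0,36],[0,0,4351],[1,0,74],[1,0,119],
  [1,0,4462],[1,0,4111],[1,0,14],[1,0,4523],[1,0,4219],[1,0,4237],[0,0,4561],[1,0,72],[1,0,196],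
  [0,0,227],[1,0,4507],[0,0,4194],[1,0,4118],[0,0,254],[1,0,50,781],[0,0,89],[0,0,346],[1,0,4151],
  [0,0,18],[0,0,179],[0,0,353],[1,0,4602],[0,0,4258],[0,0,4762],[0,0,145],[1,0,51],[0,0,4312],
  [0,0,4196,444],[0,0,640],[1,0,1],[0,0,4],[0,0,13],[0,0,21],[1,0]] = true) := ⟨by decide +kernel⟩
theorem d60 : Dead [true, true, true, false, true, true, false, true] := leaf _ t60 (by decide) rfl rfl
def t61 : PLift (check 4096 [1,0,1,1,1] [0,1,0,0,0] [[0,0,1],[0,0,2],[0,0,4],[0,0,8],[0,0,16],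
  [0,0,32],[0,0,64],[0,0,128],[0,0,256],[0,0,512],[0,0,1024],[1,0,2],[0,0,12],[0,0,24],[0,0,48],
  [1,0,90],[0,0,414],[0,0,828],[0,0,1656],[1,0,204],[0,0,410],[1,0,4242],[1,0,4361],[1,130,301],
  [1,168,4399],[1,165,89],[1,97,4107],[1,171,4194],[1,167,4115],[1,86,110],[1,142,4102],[1,116,5],
  [1,86,4351],[1,165,274],[1,92,1],[1,197,55],[1,133,4111],[1,116,4261],[1,168,13],[1,108,4238],
  [1,97,9],[1,59,17],[1,61,4103],[1,169,4241],[1,182,4146],[1,232,65],[1,148,4130],[1,102,4109],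
  [1,61,26],[1,67,136],[1,54,4183],[1,205,52],[1,100,38],[1,99,254],[1,99,4525],[1,0,447],[1,0,9],
  [1,0,4297],[1,0,16],[1,0,42],[1,0,168],[1,0,205],[1,0,4401],[1,0,149],[1,0,63],[1,0,4282],
  [1,0,59],[1,0,97],[1,0,66],[0,0,5130],[1,0,99],[0,0,502],[1,0,4173],[0,0,4558],[1,0,90],[0,0,345],
  [1,0,79],[0,0,4254],[0,0,4724],[1,0,93,4188],[0,0,323],[0,0,4323],[1,0,174],[0,0,4322],[0,0,161],
  [0,0,5772],[1,0,20],[0,0,40],[0,0,241],[0,0,4303],[1,0,1],[0,0,7],[0,0,294],[0,0,1004],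
  [1,0]] = true) := ⟨by decide +kernel⟩
theorem d61 : Dead [true, true, true, false, true] := leaf _ t61 (by decide) rfl rfl
def t62 : PLift (check 4096 [0,0,1,0] [1,1,0,1] [[0,0,1],[0,0,2],[0,0,4],[0,0,8],[0,0,16],[0,0,32],
  [0,0,64],[0,0,128],[0,0,256],[0,0,512],[0,0,1024],[1,0]] = true) := ⟨by decide +kernel⟩
theorem d62 : Dead [false, true, false, false] := leaf _ t62 (by decide) rfl rfl
def t63 : PLift (check 4096 [1,1,1,0] [0,0,0,1] [[0,0,1],[0,0,2],[0,0,4],[0,0,8],[0,0,16],[0,0,32],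
  [0,0,64],[0,0,128],[0,0,256],[0,0,512],[0,0,1024],[1,0,1],[0,0,14],[0,0,28],[0,0,56],[1,0,101],
  [0,0,1498],[0,0,569],[0,0,4470],[1,0,4488],[1,0,4182],[1,137,185],[1,97,4106],[1,97,4129],
  [1,137,4986],[1,162,4201],[1,139,4157],[1,179,4117],[1,86,4099],[1,166,7],[1,165,4114],
  [1,171,4104],[1,180,142],[1,179,4563],[1,132,4115],[1,171,4621],[1,138,6],[1,113,110],
  [1,134,4218],[1,175,4351],[1,130,77],[1,86,4],[1,177,25],[1,182,4532],[1,194,57],[1,139,12],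
  [1,89,21],[1,128,10],[1,91,4315],[1,206,4140],[1,247,4248],[1,162,4159],[1,148,4127],[1,128,134],
  [1,80,4771],[1,98,4112],[1,137,4109],[1,148,123],[1,108,21],[1,69,5156],[1,76,20],[1,163,36],
  [1,111,4126],[1,64,4124],[1,246,4250],[1,91,40],[1,108,38],[1,105,4845],[1,76,11],[1,63,20],
  [1,183,242],[1,64,4160],[1,68,23],[1,54,4266],[1,32,4103],[1,0,4114],[1,0,4159],[1,0,4869],
  [1,0,124],[1,0,28],[1,0,4224],[1,0,22],[1,0,48],[1,0,10],[1,0,4201],[1,0,261],[1,0,4384],[1,0,20],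
  [1,0,4176],[1,0,584],[1,0,4130],[1,0,93],[1,0,4613],[1,0,156],[0,0,5400],[1,0,10],[1,0,143],
  [0,0,4100],[1,0,4128],[1,0,4147],[0,0,4104],[1,0,4173],[0,0,35],[1,0,596],[0,0,4682],[1,0,339],
  [0,0,102],[1,0,56,4243],[0,0,4378],[0,0,330],[1,0,12],[0,0,5123],[0,0,4120],[1,0,115],[0,0,4204],
  [0,0,10],[0,0,4326],[1,0,18],[0,0,166],[0,0,4981],[0,0,25],[1,0,1],[0,0,2],[0,0,4],[0,0,55],
  [1,0]] = true) := ⟨by decide +kernel⟩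
theorem d63 : Dead [false, true, true, true] := leaf _ t63 (by decide) rfl rfl
def t64 : PLift (check 4096 [0,0,0,0,1,0] [1,1,1,1,0,1] [[0,0,1],[0,0,2],[0,0,4],[0,0,8],[0,0,16],
  [0,0,32],[0,0,64],[0,0,128],[0,0,256],[0,0,512],[0,0,1024],[1,0]] = true) := ⟨by decide +kernel⟩
theorem d64 : Dead [false, true, false, false, false, false] := leaf _ t64 (by decide) rfl rfl
def t65 : PLift (check 4096 [0,0,1,1,1,0,0,0] [1,1,0,0,0,1,1,1] [[0,0,1],[0,0,2],[0,0,4],[0,0,8],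
  [0,0,16],[0,0,32],[0,0,64],[0,0,128],[0,0,256],[0,0,512],[0,0,1024],[1,0,1],[0,0,2],[0,0,24],
  [0,0,48],[1,0,95],[0,0,190],[0,0,1900],[0,0,183],[1,0,152],[0,0,4365],[1,0,132],[1,0,19],
  [1,0,234],[1,0,4122],[1,0,90],[1,0,4150],[1,0,27],[1,0,669],[1,0,4143],[1,0,3],[1,0,4105],
  [1,0,4160],[1,0,77],[1,0,271],[1,0,4498],[1,0,94],[1,0,4171],[1,0,4100],[1,0,410],[1,0,57],
  [1,0,4263],[0,0,4752],[1,0,145],[1,0,15],[0,0,4219],[1,0,14],[1,0,132],[0,0,4245],[1,0,124],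
  [0,0,20],[1,0,4128],[0,0,11],[1,0,62],[0,0,948],[0,0,162],[1,0,4285],[0,0,847,4670],[0,0,4215],
  [1,0,30],[0,0,244],[0,0,1,4926],[0,0,4965],[1,0,2],[0,0,4],[0,0,60],[0,0,266],[1,0,1],[0,0,8],
  [0,0,16],[0,0,92],[1,0]] = true) := ⟨by decide +kernel⟩
theorem d65 : Dead [false, false, false, true, true, true, false, false] := leaf _ t65 (by decide) rfl rfl
def t66 : PLift (check 4096 [0,0,1,1,1,0,0,1] [1,1,0,0,0,1,1,0] [[0,0,1],[0,0,2],[0,0,4],[0,0,8],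
  [0,0,16],[0,0,32],[0,0,64],[0,0,128],[0,0,256],[0,0,512],[0,0,1024],[1,0,1],[0,0,2],[0,0,24],
  [0,0,48],[1,0,96],[0,0,192],[0,0,1904],[0,0,282],[1,0,4197],[0,0,13],[1,0,65],[1,78,6],[1,52,86],
  [1,52,4105],[1,104,4149],[1,170,4177],[1,244,32],[1,146,4400],[1,118,21],[1,167,4173],
  [1,117,4109],[1,87,31],[1,112,4101],[1,185,4097],[1,167,4124],[1,140,4168],[1,136,4107],
  [1,162,4367],[1,140,46],[1,152,4222],[1,185,4124],[1,81,58],[1,60,35],[1,163,163],[1,172,36],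
  [1,127,826],[1,142,4209],[1,81,3],[1,118,4199],[1,89,4100],[1,171,48],[1,139,86],[1,125,4244],
  [1,234,4122],[1,148,8],[1,148,4135],[1,153,4493],[1,139,4163],[1,141,13],[1,168,60],[1,81,4232],
  [1,68,4099],[1,67,4100],[1,67,4101],[1,53,4132],[1,66,5448],[1,100,37],[1,66,3],[1,63,4134],
  [1,83,4146],[1,57,32],[1,54,91],[1,56,4112],[1,80,4230],[1,100,570],[1,50,11],[1,58,4143],
  [1,72,9],[1,231,4108],[1,53,4110],[1,75,98],[1,97,4151],[1,72,4100],[1,56,4133],[1,103,8],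
  [1,99,4296],[1,42,383],[1,103,7],[1,0,4130],[1,0,26],[1,0,5441],[1,55,50],[1,0,4101],[1,0,4118],
  [1,0,93],[1,51,154],[1,0,4183],[1,0,12],[1,0,19],[1,0,5],[1,0,4639],[1,0,13],[1,0,15],[1,0,4112],
  [1,0,4522],[1,0,4118],[1,0,25],[1,0,4107],[1,0,4165],[1,0,4255],[1,0,4340],[1,0,27],[0,0,5362],
  [1,0,364],[1,0,78],[0,0,60],[1,0,11],[0,0,4149],[1,0,4175],[0,0,153],[1,0,204],[0,0,4132],
  [0,0,4620],[1,0,256],[0,0,4114],[1,0,142],[0,0,4154],[0,0,26],[1,0,12,4182],[0,0,4101],[0,0,4648],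
  [1,0,29,4331],[0,0,4532],[0,0,892],[1,0,4260],[0,0,8,4268],[0,0,4166],[0,0,4135],[1,0,16],
  [0,0,4408],[0,0,275],[0,0,4692],[1,0,1],[0,0,2],[0,0,4],[0,0,33],[1,0]] = true) := ⟨by decide +kernel⟩
theorem d66 : Dead [true, false, false, true, true, true, false, false] := leaf _ t66 (by decide) rfl rfl
def t67 : PLift (check 4096 [0,0,1,1,1,0,1] [1,1,0,0,0,1,0] [[0,0,1],[0,0,2],[0,0,4],[0,0,8],
  [0,0,16],[0,0,32],[0,0,64],[0,0,128],[0,0,256],[0,0,512],[0,0,1024],[1,0,2],[0,0,4],[0,0,47],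
  [0,0,94],[1,0,181],[0,0,362],[0,0,1646],[0,0,734],[1,0,62],[0,0,4163],[1,0,79],[1,0,4204],
  [1,0,127],[1,0,4126],[1,0,4123],[1,0,69],[1,0,5],[1,0,4145],[1,0,207],[1,0,1365],[1,0,4219],
  [1,0,36],[1,0,4099],[1,0,4121],[1,0,54],[1,0,4224],[0,0,4409],[1,0,105],[0,0,4100],[1,0,33],
  [0,0,4354],[1,0,436],[0,0,4472],[1,0,720,4219],[0,0,4345],[0,0,4148],[1,0,33],[0,0,276],
  [0,0,4310],[1,0,4155],[0,0,81],[0,0,1217],[0,0,4852],[1,0,5],[0,0,38],[0,0,532],[0,0,355],[1,0,1],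
  [0,0,2],[0,0,84],[0,0,219],[1,0,2],[0,0,4],[0,0,8],[0,0,16],[1,0]] = true) := ⟨by decide +kernel⟩
theorem d67 : Dead [true, false, true, true, true, false, false] := leaf _ t67 (by decide) rfl rfl
def t68 : PLift (check 4096 [1,1,0,0,1,0,0] [0,0,1,1,0,1,1] [[0,0,1],[0,0,2],[0,0,4],[0,0,8],
  [0,0,16],[0,0,32],[0,0,64],[0,0,128],[0,0,256],[0,0,512],[0,0,1024],[1,0,1],[0,0,2],[0,0,4],
  [0,0,496],[1,0,735],[0,0,5566],[0,0,681],[0,0,370],[1,0,4545],[1,0,4154],[1,157,175],[1,107,4335],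
  [1,196,4105],[1,209,72],[1,110,4123],[1,206,70],[1,168,4319],[1,110,4144],[1,89,4110],
  [1,106,4121],[1,222,4159],[1,206,230],[1,61,60],[1,186,4109],[1,171,4134],[1,157,96],[1,182,4114],
  [1,171,79],[1,145,4105],[1,177,4172],[1,117,11],[1,161,4120],[1,220,4143],[1,64,4102],[1,98,48],
  [1,107,57],[1,233,81],[1,91,4241],[1,174,173],[1,163,8],[1,64,4185],[1,156,4109],[1,80,4145],
  [1,80,154],[1,74,40],[1,185,4142],[1,75,4132],[1,103,4264],[1,63,80],[1,97,41],[1,183,4115],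
  [1,129,4257],[1,63,823],[1,56,4230],[1,110,4188],[1,129,4149],[1,95,1],[1,73,25],[1,86,4131],
  [1,69,152],[1,95,4202],[1,69,17],[1,69,32],[1,51,4206],[1,44,880],[1,85,11],[1,51,4098],
  [1,102,4176],[1,56,5],[1,0,4116],[1,126,39],[1,44,4186],[1,37,15],[1,101,4297],[1,0,323],
  [1,102,6],[1,99,68],[1,58,4120],[1,108,4104],[1,47,4100],[1,0,1196],[1,102,4503],[1,56,14],
  [1,69,4209],[1,53,4153],[1,69,9],[1,108,4107],[1,58,167],[1,102,4108],[1,0,4176],[1,0,4241],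
  [1,0,118],[1,0,4568],[1,0,37],[1,0,270],[1,0,4190],[1,0,121],[1,0,2],[1,0,3],[1,0,4144],
  [1,0,1268],[1,0,4276],[1,0,4167],[1,0,4125],[1,0,36],[1,0,28],[1,0,80],[1,0,4149],[1,0,4581],
  [0,0,696],[1,0,274],[1,0,3],[0,0,6],[1,0,4138],[0,0,1037],[1,0,4210],[0,0,11],[1,0,4184],[0,0,4],
  [1,0,4280,296],[0,0,13],[0,0,1],[1,0,4364,4123],[0,0,65],[0,0,9],[1,0,21],[0,0,4119],
  [0,0,4212,456],[0,0,4753],[1,0,1],[0,0,5],[0,0,11],[0,0,227],[1,0]] = true) := ⟨by decide +kernel⟩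
theorem d68 : Dead [false, false, true, false, false, true, true] := leaf _ t68 (by decide) rfl rfl
def t69 : PLift (check 4096 [1,1,0,0,1,0,1] [0,0,1,1,0,1,0] [[0,0,1],[0,0,2],[0,0,4],[0,0,8],
  [0,0,16],[0,0,32],[0,0,64],[0,0,128],[0,0,256],[0,0,512],[0,0,1024],[1,0,1],[0,0,2],[0,0,4],
  [0,0,8],[1,0,157],[0,0,314],[0,0,628],[0,0,5352],[1,0,914],[0,0,4668],[0,0,4186],[1,0,4454],
  [1,0,37],[1,0,101],[1,0,34],[1,95,4127],[1,79,119],[1,125,9],[1,95,4129],[1,51,4183],[1,148,4113],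
  [1,55,37],[1,0,4293],[1,0,4216],[1,0,561],[1,0,5000],[1,0,156],[1,0,104],[1,0,6],[1,0,4174],
  [1,0,4234],[1,0,12],[1,0,105],[1,0,37],[1,0,26],[1,0,4157],[1,0,4461],[1,0,21],[1,0,167],
  [1,0,4125],[1,0,14],[1,0,4303],[0,0,484],[1,0,4126],[1,0,4129],[0,0,4900],[1,0,232],[0,0,4242],
  [1,0,350],[0,0,4468],[1,0,5058],[0,0,78],[1,0,16],[0,0,4401],[1,0,76],[0,0,4200],[1,0,259,248],
  [0,0,4335],[0,0,371],[1,0,4194],[0,0,4590],[0,0,12],[1,0,119],[0,0,72],[0,0,4334],[1,0,220],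
  [0,0,46],[0,0,92],[1,0,130,4108],[0,0,4138],[0,0,535],[1,0,4129],[0,0,4276],[1,0,4341],[0,0,4293],
  [0,0,5673],[1,0,193],[0,0,90],[0,0,65],[0,0,4544],[1,0,78],[0,0,221],[0,0,4184,937],[0,0,4117],
  [1,0,1],[0,0,2],[0,0,4],[0,0,8],[1,0]] = true) := ⟨by decide +kernel⟩
theorem d69 : Dead [true, false, true, false, false, true, true] := leaf _ t69 (by decide) rfl rfl
def t70 : PLift (check 4096 [1,1,1,1,1,0] [0,0,0,0,0,1] [[0,0,1],[0,0,2],[0,0,4],[0,0,8],[0,0,16],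
  [0,0,32],[0,0,64],[0,0,128],[0,0,256],[0,0,512],[0,0,1024],[1,0]] = true) := ⟨by decide +kernel⟩
theorem d70 : Dead [false, true, true, true, true, true] := leaf _ t70 (by decide) rfl rfl
def t71 : PLift (check 4096 [0,0,0,0,0,0] [1,1,1,1,1,1] [[0,0,1],[0,0,2],[0,0,4],[0,0,8],[0,0,16],
  [0,0,32],[0,0,64],[0,0,128],[0,0,256],[0,0,512],[0,0,1024],[1,0]] = true) := ⟨by decide +kernel⟩
theorem d71 : Dead [false, false, false, false, false, false] := leaf _ t71 (by decide) rfl rfl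
def t72 : PLift (check 4096 [0,0,0,0,1,1] [1,1,1,1,0,0] [[0,0,1],[0,0,2],[0,0,4],[0,0,8],[0,0,16],
  [0,0,32],[0,0,64],[0,0,128],[0,0,256],[0,0,512],[0,0,1024],[1,0]] = true) := ⟨by decide +kernel⟩
theorem d72 : Dead [true, true, false, false, false, false] := leaf _ t72 (by decide) rfl rfl
def t73 : PLift (check 4096 [0,0,1,1,0,0,0,0] [1,1,0,0,1,1,1,1] [[0,0,1],[0,0,2],[0,0,4],[0,0,8],
  [0,0,16],[0,0,32],[0,0,64],[0,0,128],[0,0,256],[0,0,512],[0,0,1024],[1,0,1],[0,0,2],[0,0,4],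
  [0,0,24],[1,0,102],[0,0,204],[0,0,858],[0,0,1716],[1,0,150,4341],[0,0,478],[0,0,4898],[1,0,4121],
  [1,0,73],[1,0,4160],[1,0,4210],[1,0,32],[1,0,4133],[1,79,4366],[1,86,4106],[1,169,36],[1,242,13],
  [1,180,4800],[1,81,4130],[1,141,290],[1,218,3],[1,134,4148],[1,180,4165],[1,81,46],[1,71,4130],
  [1,101,5234],[1,169,39],[1,105,4125],[1,180,4104],[1,115,4288],[1,218,42],[1,205,53],[1,197,4137],
  [1,214,5613],[1,229,4103],[1,228,29],[1,228,48],[1,202,4145],[1,234,4107],[1,149,4118],[1,190,50],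
  [1,179,18],[1,150,4334],[1,190,17],[1,184,69],[1,206,23],[1,149,4208],[1,179,4124],[1,206,4128],
  [1,212,98],[1,185,23],[1,148,4099],[1,186,4341],[1,227,26],[1,227,4137],[1,184,8],[1,227,33],
  [1,179,366],[1,206,4795],[1,184,55],[1,150,5],[1,206,8],[1,206,4148],[1,212,4134],[1,201,4111],
  [1,204,4230],[1,211,4122],[1,179,71],[1,148,1],[1,187,5403],[1,185,76],[1,185,4137],[1,254,4190],
  [1,212,13],[1,254,178],[1,184,5],[1,212,4099],[1,150,23],[1,168,4115],[1,148,4133],[1,235,43],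
  [1,182,4186],[1,177,4230],[1,220,514],[1,143,4549],[1,209,4099],[1,0,67],[1,0,4214],[1,0,4114],
  [1,0,4103],[1,0,4890],[1,0,77],[1,0,148],[1,0,4112],[1,0,4367],[1,0,60],[1,0,33],[1,0,28],
  [1,0,4597],[1,0,164],[1,0,40],[1,0,4314],[1,0,21],[1,0,229],[1,0,5211],[0,0,83],[1,0,88],
  [1,0,193],[0,0,4122],[1,0,4202],[0,0,4124],[0,0,373],[1,0,58],[0,0,246],[0,0,4349],[0,0,181],
  [1,0,2],[0,0,11],[0,0,4140],[0,0,22,4540],[1,0]] = true) := ⟨by decide +kernel⟩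
theorem d73 : Dead [false, false, false, false, true, true, false, false] := leaf _ t73 (by decide) rfl rfl
def t74 : PLift (check 4096 [0,0,1,1,0,0,0,1] [1,1,0,0,1,1,1,0] [[0,0,1],[0,0,2],[0,0,4],[0,0,8],
  [0,0,16],[0,0,32],[0,0,64],[0,0,128],[0,0,256],[0,0,512],[0,0,1024],[1,0,1],[0,0,2],[0,0,4],
  [0,0,24],[1,0,90],[0,0,180],[0,0,855],[0,0,1710],[1,0,137],[0,0,489],[1,0,9],[1,0,4214],
  [1,100,4202],[1,52,147],[1,53,4104],[1,158,4100],[1,96,4128],[1,123,4184],[1,80,26],[1,85,4150],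
  [1,235,4111],[1,154,161],[1,125,20],[1,60,4126],[1,80,4274],[1,67,109],[1,102,14],[1,57,22],
  [1,93,160],[1,71,4134],[1,100,36],[1,93,4511],[1,62,464],[1,0,4187],[1,56,31],[1,49,82],
  [1,0,4108],[1,0,16],[1,0,4168],[1,0,4149],[1,0,4242],[1,0,36],[1,0,18],[1,0,166],[1,0,647],
  [1,0,4287],[1,0,4214],[1,0,226],[1,0,95],[1,0,4193],[1,0,4213],[1,0,320],[1,0,10],[1,0,4138],
  [1,0,5],[1,0,297],[1,0,4140],[1,0,4250],[1,0,889],[1,0,35],[1,0,4122],[1,0,48],[1,0,4543],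
  [1,0,309],[1,0,1154],[1,0,4312],[1,0,64],[1,0,37],[1,0,111],[1,0,4288],[1,0,4527],[0,0,126],
  [1,0,4122],[0,0,13],[1,0,4506],[0,0,4878],[0,0,376],[1,0,4144,4266],[0,0,6],[0,0,4295],[1,0,4260],
  [0,0,4222],[0,0,181],[0,0,5759],[1,0,119],[0,0,700],[0,0,54],[0,0,4374],[1,0,1],[0,0,7],[0,0,32],
  [0,0,210],[1,0]] = true) := ⟨by decide +kernel⟩
theorem d74 : Dead [true, false, false, false, true, true, false, false] := leaf _ t74 (by decide) rfl rfl
def t75 : PLift (check 4096 [0,0,1,1,0,0,1,0] [1,1,0,0,1,1,0,1] [[0,0,1],[0,0,2],[0,0,4],[0,0,8],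
  [0,0,16],[0,0,32],[0,0,64],[0,0,128],[0,0,256],[0,0,512],[0,0,1024],[1,0,1],[0,0,2],[0,0,4],
  [0,0,24],[1,0,102],[0,0,204],[0,0,1481],[0,0,607],[1,0,219],[0,0,4147],[1,0,4275],[1,0,4977],
  [1,78,4102],[1,230,61],[1,157,195],[1,230,3],[1,230,114],[1,171,4212],[1,158,16],[1,81,43],
  [1,134,4161],[1,93,7],[1,158,4097],[1,158,4149],[1,157,4202],[1,128,313],[1,75,28],[1,157,4120],
  [1,106,4176],[1,59,3],[1,108,128],[1,128,4344],[1,71,20],[1,63,96],[1,92,10],[1,53,4104],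
  [1,53,4197],[1,0,131],[1,0,49],[1,0,129],[1,0,4109],[1,0,4124],[1,0,146],[1,0,4169],[1,0,4333],
  [1,0,4564],[1,0,69],[1,0,3],[1,0,5085],[1,0,132],[1,0,218],[1,0,4219],[1,0,72],[1,0,31],[1,0,782],
  [1,0,4177],[1,0,4187],[1,0,201],[1,0,709],[1,0,4151],[1,0,4220],[1,0,107],[1,0,4109],[1,0,4099],
  [1,0,4146],[1,0,4278],[1,0,4128],[1,0,4543],[1,0,195],[1,0,64],[1,0,4179],[1,0,306],[0,0,4254],
  [1,0,264],[1,0,4505],[0,0,666],[1,0,28],[0,0,35],[1,0,300],[0,0,4684],[1,0,88,4619],[0,0,398],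
  [0,0,208],[1,0,6,110],[0,0,21],[0,0,4309],[1,0,436],[0,0,58],[0,0,577],[0,0,230],[1,0,1],[0,0,4],
  [0,0,29],[0,0,116],[1,0]] = true) := ⟨by decide +kernel⟩
theorem d75 : Dead [false, true, false, false, true, true, false, false] := leaf _ t75 (by decide) rfl rfl
def t76 : PLift (check 4096 [0,0,1,1,0,0,1,1,0,0,0] [1,1,0,0,1,1,0,0,1,1,1] [[0,0,1],[0,0,2],
  [0,0,4],[0,0,8],[0,0,16],[0,0,32],[0,0,64],[0,0,128],[0,0,256],[0,0,512],[0,0,1024],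
  [1,0]] = true) := ⟨by decide +kernel⟩
theorem d76 : Dead [false, false, false, true, true, false, false, true, true, false, false] := leaf _ t76 (by decide) rfl rfl
def t77 : PLift (check 4096 [0,0,1,1,0,0,1,1,0,0,1,0] [1,1,0,0,1,1,0,0,1,1,0,1] [[0,0,1],[0,0,2],
  [0,0,4],[0,0,8],[0,0,16],[0,0,32],[0,0,64],[0,0,128],[0,0,256],[0,0,512],[0,0,1024],[1,0,2],
  [0,0,4],[0,0,8],[0,0,16],[1,0,1345],[0,0,160],[0,0,569],[1,0,4439],[1,0,4564],[1,105,26],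
  [1,171,4176],[1,126,93],[1,163,4103],[1,57,15],[1,76,65],[1,101,4108],[1,98,139],[1,89,4156],
  [1,169,100],[1,187,4181],[1,77,90],[1,124,136],[1,100,23],[1,124,96],[1,132,4116],[1,81,4],
  [1,132,10],[1,169,64],[1,171,144],[1,172,207],[1,128,4946],[1,129,4299],[1,169,82],[1,172,56],
  [1,131,4147],[1,128,4104],[1,235,4130],[1,128,728],[1,148,46],[1,235,4148],[1,130,4112],
  [1,57,4237],[1,64,57],[1,54,4099],[1,75,120],[1,54,25],[1,0,4133],[1,0,4139],[1,0,4254],[1,0,129],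
  [1,0,4147],[1,0,12],[1,0,619],[1,0,4205],[1,0,4306],[1,0,4114],[1,0,88],[1,0,31],[1,0,3],
  [1,0,5107],[0,0,1189],[1,0,4150],[1,0,73],[0,0,4229],[1,0,125],[0,0,4183],[1,0,175],[1,0,20],
  [0,0,4139],[1,0,358],[0,0,1157],[1,0,4239],[0,0,4293],[1,0,160],[0,0,107],[0,0,4359],[1,0,27],
  [0,0,4163],[0,0,373],[1,0,4214],[0,0,59],[0,0,4441],[0,0,100],[1,0,1],[0,0,175],[0,0,5144],
  [0,0,1052,4527],[1,0,2],[0,0,4],[0,0,8],[0,0,16],[1,0]] = true) := ⟨by decide +kernel⟩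
theorem d77 : Dead [false, true, false, false, true, true, false, false, true, true, false, false] := leaf _ t77 (by decide) rfl rfl
def t78 : PLift (check 4096 [0,0,1,1,0,0,1,1,0,0,1,1,0] [1,1,0,0,1,1,0,0,1,1,0,0,1] [[0,0,1],
  [0,0,2],[0,0,4],[0,0,8],[0,0,16],[0,0,32],[0,0,64],[0,0,128],[0,0,256],[0,0,512],[0,0,1024],
  [1,0,1],[0,0,4],[0,0,8],[0,0,16],[1,0,1589],[0,0,419],[0,0,4231],[0,0,4310],[1,0,113],[1,0,31],
  [1,0,75],[1,62,4102],[1,55,4287],[1,78,10],[1,83,162],[1,63,62],[1,57,4201],[1,92,4123],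
  [1,80,4097],[1,53,4126],[1,99,50],[1,146,4103],[1,146,4168],[1,0,4140],[1,0,46],[1,0,4114],
  [1,0,149],[1,0,4198],[1,0,654],[1,0,4165],[1,0,87],[1,0,4124],[1,0,4189],[1,0,36],[1,0,4837],
  [1,0,9],[1,0,77],[1,0,4118],[1,0,4103],[0,0,4131],[1,0,321],[1,0,1],[0,0,4113],[1,0,4191],
  [0,0,196],[1,0,4224],[0,0,4107],[0,0,293],[1,0,4475],[0,0,549],[0,0,4119],[1,0,4117,406],
  [0,0,4223],[0,0,4154],[1,0,74],[0,0,8,1210],[0,0,720],[1,0,1228],[0,0,1],[0,0,833],[1,0,4221],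
  [0,0,100],[1,0,4100],[0,0,4189],[1,0,4300],[0,0,4617],[0,0,57],[1,0,236],[0,0,35],[0,0,4137],
  [1,0,56],[0,0,79],[0,0,370,4126],[0,0,1292],[1,0,2],[0,0,4146],[0,0,4986],[0,0,139],[1,0,1],
  [0,0,4],[0,0,8],[0,0,16],[1,0]] = true) := ⟨by decide +kernel⟩
theorem d78 : Dead [false, true, true, false, false, true, true, false, false, true, true, false, false] := leaf _ t78 (by decide) rfl rfl
def t79 : PLift (check 4096 [0,0,1,1,0,0,1,1,0,0,1,1,1] [1,1,0,0,1,1,0,0,1,1,0,0,0] [[0,0,1],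
  [0,0,2],[0,0,4],[0,0,8],[0,0,16],[0,0,32],[0,0,64],[0,0,128],[0,0,256],[0,0,512],[0,0,1024],
  [1,0,1],[0,0,2],[0,0,4],[0,0,8],[1,0,13],[0,0,1680],[0,0,323],[0,0,4569],[1,0,78],[1,0,4254],
  [1,38,11],[1,175,10],[1,133,4127],[1,77,22],[1,139,35],[1,175,96],[1,170,4449],[1,235,4099],
  [1,111,4105],[1,246,5],[1,175,4168],[1,170,4132],[1,170,50],[1,245,4190],[1,171,73],[1,73,34],
  [1,158,4189],[1,98,4284],[1,172,101],[1,153,4098],[1,104,11],[1,73,4651],[1,107,574],[1,53,18],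
  [1,93,4134],[1,148,21],[1,100,4293],[1,53,149],[1,146,4233],[1,42,96],[1,51,4211],[1,0,124],
  [1,0,1184],[1,0,4706],[1,49,4180],[1,0,4133],[1,50,8],[1,0,4149],[1,0,22],[1,0,110],[1,0,4239],
  [1,0,34],[1,0,15],[1,0,4116],[1,0,140],[1,0,4223],[1,0,4120],[1,0,4594],[1,0,14],[1,0,4301],
  [1,0,37],[1,0,43],[1,0,17],[1,0,169],[1,188,4267],[1,209,21],[1,149,348],[1,226,673],[1,237,4142],
  [1,212,49],[1,148,113],[1,188,18],[1,177,4213],[1,167,98],[1,119,13],[1,0,4164],[1,0,4253],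
  [1,0,149],[1,0,366],[1,0,4181],[1,0,4417],[1,0,40],[1,0,1],[1,0,65],[1,0,183],[1,0,4158],[1,0,7],
  [1,0,36],[0,0,437],[1,0,21],[1,0,8],[0,0,4615],[1,0,116],[0,0,4155],[1,0,363],[0,0,24],[1,0,192],
  [0,0,730],[0,0,5450],[1,0,4270],[0,0,13],[1,0,4171],[0,0,19],[1,0,49],[0,0,4134],[0,0,4136],
  [1,0,209],[0,0,276],[0,0,4492],[0,0,237],[1,0]] = true) := ⟨by decide +kernel⟩
theorem d79 : Dead [true, true, true, false, false, true, true, false, false, true, true, false, false] := leaf _ t79 (by decide) rfl rfl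
def t80 : PLift (check 4096 [0,0,1,1,0,0,1,1,0,1] [1,1,0,0,1,1,0,0,1,0] [[0,0,1],[0,0,2],[0,0,4],
  [0,0,8],[0,0,16],[0,0,32],[0,0,64],[0,0,128],[0,0,256],[0,0,512],[0,0,1024],[1,0]] = true) := ⟨by decide +kernel⟩
theorem d80 : Dead [true, false, true, true, false, false, true, true, false, false] := leaf _ t80 (by decide) rfl rfl
def t81 : PLift (check 4096 [0,0,1,1,0,0,1,1,1] [1,1,0,0,1,1,0,0,0] [[0,0,1],[0,0,2],[0,0,4],
  [0,0,8],[0,0,16],[0,0,32],[0,0,64],[0,0,128],[0,0,256],[0,0,512],[0,0,1024],[1,0]] = true) := ⟨by decide +kernel⟩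
theorem d81 : Dead [true, true, true, false, false, true, true, false, false] := leaf _ t81 (by decide) rfl rfl
def t82 : PLift (check 4096 [0,0,1,1,1,1] [1,1,0,0,0,0] [[0,0,1],[0,0,2],[0,0,4],[0,0,8],[0,0,16],
  [0,0,32],[0,0,64],[0,0,128],[0,0,256],[0,0,512],[0,0,1024],[1,0,4],[0,0,8],[0,0,223],[0,0,446],
  [1,0,888],[0,0,1776],[0,0,331],[1,0,62],[1,56,20],[1,162,4122],[1,141,247],[1,59,114],
  [1,197,4159],[1,113,4222],[1,190,4233],[1,147,84],[1,138,23],[1,152,4155],[1,110,4227],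
  [1,164,4196],[1,171,14],[1,162,17],[1,220,4167],[1,138,7],[1,181,4152],[1,159,4440],[1,164,80],
  [1,81,4114],[1,181,4125],[1,133,307],[1,136,4253],[1,84,86],[1,103,4257],[1,111,5],[1,82,2],
  [1,139,1],[1,139,23],[1,58,4175],[1,102,4228],[1,105,4108],[1,106,4143],[1,166,4106],[1,58,235],
  [1,184,4292],[1,98,4188],[1,196,5193],[1,184,4097],[1,184,139],[1,196,19],[1,53,4140],[1,128,56],
  [1,79,4282],[1,97,116],[1,92,4147],[1,74,4117],[1,66,180],[1,70,4216],[1,39,10],[1,154,4311],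
  [1,93,218],[1,30,4222],[1,0,133],[1,0,4160],[1,0,4116],[1,0,25],[1,0,5223],[1,0,3],[1,0,7],
  [1,0,34],[1,0,58],[1,0,4113],[1,0,4145],[1,0,4135],[1,0,38],[1,0,4308],[1,0,9],[1,0,4462],
  [1,0,48],[1,0,4107],[1,0,15],[1,0,4670],[1,0,163],[1,0,4526],[1,0,23],[1,0,5331],[0,0,113],
  [1,0,4402],[1,0,85],[0,0,45],[1,0,4114],[1,0,4117],[0,0,171],[1,0,4215],[0,0,173],[1,0,4207],
  [0,0,4200],[1,0,53],[0,0,4166],[1,0,4562],[0,0,44],[1,0,32,59],[0,0,4385],[0,0,761],[1,0,4541,20],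
  [0,0,1428],[0,0,4159],[1,0,64],[0,0,27],[0,0,4239],[0,0,246],[1,0,1],[0,0,2],[0,0,4],[0,0,8],
  [1,0]] = true) := ⟨by decide +kernel⟩
theorem d82 : Dead [true, true, true, true, false, false] := leaf _ t82 (by decide) rfl rfl
def t83 : PLift (check 4096 [1,1,0,0,0,0] [0,0,1,1,1,1] [[0,0,1],[0,0,2],[0,0,4],[0,0,8],[0,0,16],
  [0,0,32],[0,0,64],[0,0,128],[0,0,256],[0,0,512],[0,0,1024],[1,0,1],[0,0,2],[0,0,4],[0,0,8],
  [1,0,220],[0,0,440],[0,0,880],[0,0,5856],[1,0,549],[0,0,4312],[1,0,68],[1,50,31],[1,144,7],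
  [1,96,112],[1,92,4153],[1,92,9],[1,52,42],[1,91,4112],[1,123,4133],[1,155,72],[1,105,30],
  [1,89,4125],[1,112,26],[1,155,4130],[1,112,85],[1,88,4145],[1,102,33],[1,105,50],[1,78,4098],
  [1,124,4140],[1,96,135],[1,57,3],[1,64,4171],[1,71,4110],[1,85,4],[1,50,16],[1,0,4097],[1,0,140],
  [1,0,4208],[1,0,79],[1,0,4150],[1,0,6],[1,0,385],[1,0,41],[1,0,4129],[1,0,20],[1,0,4141],
  [1,0,108],[1,0,37],[1,0,4433],[1,0,101],[1,0,4170],[1,0,65],[1,0,4117],[1,0,4324],[1,0,4442],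
  [0,0,56],[1,0,49],[1,0,4215],[0,0,43],[1,0,12],[0,0,4149],[1,0,142],[0,0,4751],[1,0,71],[0,0,107],
  [1,0,478],[0,0,40],[0,0,5225],[1,0,103],[0,0,70],[0,0,149],[1,0,4177,25],[0,0,89],[0,0,4258],
  [1,0,431],[0,0,218,4505],[0,0,323],[0,0,4958],[1,0,53],[0,0,4,258],[0,0,145],[0,0,4293],[1,0,2],
  [0,0,13],[0,0,4],[0,0,44,4108],[1,0]] = true) := ⟨by decide +kernel⟩
theorem d83 : Dead [false, false, false, false, true, true] := leaf _ t83 (by decide) rfl rfl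
def t84 : PLift (check 4096 [1,1,0,0,1,1,0,0,0] [0,0,1,1,0,0,1,1,1] [[0,0,1],[0,0,2],[0,0,4],
  [0,0,8],[0,0,16],[0,0,32],[0,0,64],[0,0,128],[0,0,256],[0,0,512],[0,0,1024],[1,0]] = true) := ⟨by decide +kernel⟩
theorem d84 : Dead [false, false, false, true, true, false, false, true, true] := leaf _ t84 (by decide) rfl rfl
def t85 : PLift (check 4096 [1,1,0,0,1,1,0,0,1,0] [0,0,1,1,0,0,1,1,0,1] [[0,0,1],[0,0,2],[0,0,4],
  [0,0,8],[0,0,16],[0,0,32],[0,0,64],[0,0,128],[0,0,256],[0,0,512],[0,0,1024],[1,0]] = true) := ⟨by decide +kernel⟩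
theorem d85 : Dead [false, true, false, false, true, true, false, false, true, true] := leaf _ t85 (by decide) rfl rfl
def t86 : PLift (check 4096 [1,1,0,0,1,1,0,0,1,1,0,0,0] [0,0,1,1,0,0,1,1,0,0,1,1,1] [[0,0,1],
  [0,0,2],[0,0,4],[0,0,8],[0,0,16],[0,0,32],[0,0,64],[0,0,128],[0,0,256],[0,0,512],[0,0,1024],
  [1,0,1],[0,0,2],[0,0,12],[0,0,212],[1,0,285],[0,0,1572],[0,0,786,219],[0,0,4418],[1,0,4312],
  [1,0,181],[1,34,50],[1,107,83],[1,153,4149],[1,184,7],[1,51,11],[1,94,4120],[1,181,163],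
  [1,97,4140],[1,117,4155],[1,166,4099],[1,127,272],[1,131,4131],[1,51,183],[1,124,16],[1,166,5],
  [1,97,4133],[1,92,7],[1,53,5514],[1,188,104],[1,128,4143],[1,71,4312],[1,116,4],[1,127,92],
  [1,104,4106],[1,153,28],[1,133,1],[1,129,4115],[1,165,4154],[1,127,4442],[1,183,4104],[1,80,89],
  [1,220,4109],[1,214,4205],[1,86,87],[1,106,4114],[1,87,4119],[1,102,9],[1,164,26],[1,156,155],
  [1,188,56],[1,156,31],[1,128,97],[1,99,14],[1,98,4159],[1,188,354],[1,92,12],[1,117,81],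
  [1,0,4142],[1,0,75],[1,0,650],[1,0,4429],[1,0,325],[1,0,59],[1,0,4115],[1,0,149],[1,0,4135],
  [1,0,4140],[1,0,2],[1,0,138],[1,0,222],[1,0,4186],[1,0,62],[1,0,702],[1,0,8],[1,0,4183],[1,0,299],
  [1,0,4126],[1,0,181],[1,0,4145],[1,0,11],[1,0,4118],[1,0,4121],[0,0,12],[1,0,80],[0,0,1023],
  [1,0,6],[0,0,4241],[0,0,4369],[1,0,57],[0,0,4118],[0,0,4158],[0,0,130],[1,0,19],[0,0,4181],
  [0,0,65],[0,0,4365],[1,0]] = true) := ⟨by decide +kernel⟩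
theorem d86 : Dead [false, false, false, true, true, false, false, true, true, false, false, true, true] := leaf _ t86 (by decide) rfl rfl
def t87 : PLift (check 4096 [1,1,0,0,1,1,0,0,1,1,0,0,1] [0,0,1,1,0,0,1,1,0,0,1,1,0] [[0,0,1],
  [0,0,2],[0,0,4],[0,0,8],[0,0,16],[0,0,32],[0,0,64],[0,0,128],[0,0,256],[0,0,512],[0,0,1024],
  [1,0,2],[0,0,36],[0,0,1671],[0,0,225],[1,0,432],[0,0,5118],[1,0,150],[1,0,4127],[1,97,4136],
  [1,178,268],[1,134,29],[1,220,20],[1,197,47],[1,223,19],[1,182,92],[1,189,113],[1,118,4114],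
  [1,217,15],[1,146,4137],[1,153,4189],[1,116,85],[1,116,4099],[1,148,4153],[1,207,437],[1,107,42],
  [1,219,4237],[1,93,20],[1,171,4110],[1,187,4172],[1,131,740],[1,118,89],[1,82,4128],[1,124,4125],
  [1,126,4123],[1,129,49],[1,130,4211],[1,111,120],[1,111,47],[1,129,4204],[1,92,4115],[1,75,17],
  [1,57,264],[1,0,4328],[1,49,16],[1,0,152],[1,0,4129],[1,0,3],[1,0,4193],[1,0,614],[1,0,4202],
  [1,0,25],[1,0,32],[1,0,4149],[1,0,37],[1,0,145],[1,0,4252],[1,0,96],[0,0,4142],[1,0,76],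
  [1,0,4217],[0,0,8],[1,0,115],[0,0,4190],[1,0,4146],[0,0,4136],[1,0,47],[0,0,4588],[1,0,102],
  [0,0,24],[0,0,1466],[1,0,107],[0,0,30],[0,0,800],[1,0,78,4206],[0,0,4288],[0,0,267],[1,0,59],
  [0,0,4275],[0,0,4455],[0,0,5378],[1,0,6],[0,0,39],[0,0,4111,71],[0,0,12],[1,0,1],[0,0,2],[0,0,4],
  [0,0,50],[1,0]] = true) := ⟨by decide +kernel⟩
theorem d87 : Dead [true, false, false, true, true, false, false, true, true, false, false, true, true] := leaf _ t87 (by decide) rfl rfl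
def t88 : PLift (check 4096 [1,1,0,0,1,1,0,0,1,1,0,1] [0,0,1,1,0,0,1,1,0,0,1,0] [[0,0,1],[0,0,2],
  [0,0,4],[0,0,8],[0,0,16],[0,0,32],[0,0,64],[0,0,128],[0,0,256],[0,0,512],[0,0,1024],[1,0,6],
  [0,0,1096],[0,0,829],[0,0,433],[1,0,86],[0,0,229],[1,0,4107],[1,0,4279],[1,99,4176],[1,158,4103],
  [1,216,4198],[1,217,51],[1,186,4108],[1,141,4],[1,216,14],[1,158,53],[1,157,4300],[1,137,7],
  [1,170,4136],[1,222,79],[1,153,4208],[1,145,124],[1,220,4116],[1,158,4104],[1,220,50],[1,216,9],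
  [1,117,792],[1,186,4553],[1,222,4192],[1,171,891],[1,178,39],[1,175,56],[1,167,4099],[1,170,40],
  [1,175,4097],[1,187,4164],[1,170,4131],[1,136,4378],[1,84,4155],[1,82,131],[1,124,13],[1,85,57],
  [1,141,31],[1,123,4118],[1,79,197],[1,113,4228],[1,183,3],[1,161,6],[1,125,4239],[1,130,4138],
  [1,113,881],[1,161,4187],[1,98,4107],[1,61,29],[1,183,164],[1,113,4123],[1,113,4842],[1,126,17],
  [1,125,8],[1,113,67],[1,72,4102],[1,56,545],[1,63,71],[1,105,62],[1,48,4200],[1,0,12],[1,0,4],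
  [1,0,4127],[1,0,20],[1,0,4113],[1,0,4266],[1,0,22],[1,0,1269],[1,0,5025],[1,0,24],[1,0,101],
  [1,0,4150],[1,0,56],[1,0,8],[1,0,126],[1,0,4139],[1,0,4194],[1,0,32],[1,0,61],[1,0,59],[1,0,238],
  [0,0,4146],[1,0,4127],[1,0,94],[0,0,4457],[1,0,42],[1,0,150],[0,0,4241],[1,0,4139],[0,0,385],
  [1,0,208],[0,0,4160],[1,0,4115],[0,0,4262],[1,0,61],[0,0,682],[0,0,4245],[1,0,89,4327],[0,0,30],
  [0,0,29],[1,0,4150],[0,0,4173,4122],[0,0,5153],[0,0,5395],[1,0,2],[0,0,82],[0,0,549],[0,0,4364],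
  [1,0,1],[0,0,4],[0,0,8],[0,0,16],[1,0]] = true) := ⟨by decide +kernel⟩
theorem d88 : Dead [true, false, true, true, false, false, true, true, false, false, true, true] := leaf _ t88 (by decide) rfl rfl
def t89 : PLift (check 4096 [1,1,0,0,1,1,0,0,1,1,1] [0,0,1,1,0,0,1,1,0,0,0] [[0,0,1],[0,0,2],
  [0,0,4],[0,0,8],[0,0,16],[0,0,32],[0,0,64],[0,0,128],[0,0,256],[0,0,512],[0,0,1024],[1,0,1],
  [0,0,2],[0,0,4],[0,0,120],[1,0,344],[0,0,1585],[0,0,304],[0,0,4491],[1,0,4614],[0,0,144],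
  [1,0,4102],[1,0,4201],[1,0,86],[1,0,27],[1,0,4144],[1,0,9],[1,0,4165],[1,0,154],[1,0,4148],
  [1,0,4320],[0,0,4102],[1,0,50],[1,0,51],[0,0,4119],[1,0,108],[0,0,4517],[1,0,201],[0,0,626],
  [0,0,5597],[1,0,183],[0,0,8],[0,0,70],[1,0,488],[0,0,4454],[0,0,69],[1,0,2],[0,0,145],[0,0,4185],
  [0,0,64],[1,0,1],[0,0,4],[0,0,259],[0,0,803],[1,0]] = true) := ⟨by decide +kernel⟩
theorem d89 : Dead [true, true, true, false, false, true, true, false, false, true, true] := leaf _ t89 (by decide) rfl rfl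
def t90 : PLift (check 4096 [1,1,0,0,1,1,0,1] [0,0,1,1,0,0,1,0] [[0,0,1],[0,0,2],[0,0,4],[0,0,8],
  [0,0,16],[0,0,32],[0,0,64],[0,0,128],[0,0,256],[0,0,512],[0,0,1024],[1,0,1],[0,0,2],[0,0,24],
  [0,0,240],[1,0,1331],[0,0,482],[0,0,4155],[1,0,4172],[1,0,4190],[1,64,4246],[1,111,1108],
  [1,91,4179],[1,79,4129],[1,233,4430],[1,73,1],[1,118,194],[1,195,4302],[1,154,126],[1,98,4135],
  [1,121,4118],[1,187,4223],[1,221,4256],[1,137,155],[1,158,4193],[1,153,4168],[1,145,66],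
  [1,171,4137],[1,108,75],[1,245,4241],[1,231,4097],[1,167,4368],[1,158,4143],[1,89,102],[1,170,98],
  [1,182,59],[1,222,4180],[1,171,4134],[1,231,93],[1,182,236],[1,118,4178],[1,110,22],[1,112,25],
  [1,184,104],[1,76,4144],[1,72,4752],[1,154,34],[1,120,49],[1,97,4247],[1,73,3],[1,129,7],
  [1,73,4138],[1,131,4166],[1,74,478],[1,106,1],[1,185,4497],[1,185,4125],[1,66,27],[1,69,4194],
  [1,101,137],[1,128,4181],[1,66,64],[1,54,1],[1,62,4162],[1,45,3],[1,45,35],[1,0,183],[1,0,59],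
  [1,0,6],[1,0,4323],[1,0,871],[1,0,4828],[1,0,4143],[1,0,36],[1,0,14],[1,0,116],[1,0,8],[1,0,4159],
  [1,0,526],[1,0,36],[1,0,4279],[1,0,37],[1,0,4127],[1,0,9],[1,0,4166],[1,0,57],[1,0,21],[1,0,22],
  [1,0,4162],[0,0,107],[1,0,11],[1,0,4245],[0,0,293],[1,0,4159],[0,0,31],[1,0,540],[0,0,4653],
  [1,0,45],[0,0,647],[1,0,4298],[0,0,20],[0,0,260],[1,0,4218,28],[0,0,3],[0,0,6],[1,0,332],
  [0,0,4525],[0,0,573],[0,0,4757],[1,0,132],[0,0,68,17],[0,0,280],[0,0,4110],[1,0,2],[0,0,5],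
  [0,0,663],[0,0,926],[1,0,1],[0,0,9],[0,0,18],[0,0,36],[1,0]] = true) := ⟨by decide +kernel⟩
theorem d90 : Dead [true, false, true, true, false, false, true, true] := leaf _ t90 (by decide) rfl rfl
def t91 : PLift (check 4096 [1,1,0,0,1,1,1,0] [0,0,1,1,0,0,0,1] [[0,0,1],[0,0,2],[0,0,4],[0,0,8],
  [0,0,16],[0,0,32],[0,0,64],[0,0,128],[0,0,256],[0,0,512],[0,0,1024],[1,0,1],[0,0,2],[0,0,4],
  [0,0,80],[1,0,1119],[0,0,571],[0,0,121],[0,0,5265],[1,0,154],[1,0,111],[1,50,36],[1,194,4386],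
  [1,103,495],[1,213,28],[1,88,4232],[1,91,35],[1,183,9],[1,167,4365],[1,217,4148],[1,185,4144],
  [1,188,18],[1,134,114],[1,121,4205],[1,132,4098],[1,134,4141],[1,139,4104],[1,171,4110],
  [1,155,4263],[1,83,65],[1,116,4140],[1,157,4128],[1,76,6],[1,111,5],[1,75,4216],[1,177,218],
  [1,112,4173],[1,65,35],[1,219,1],[1,105,10],[1,77,91],[1,100,4204],[1,77,4170],[1,128,224],
  [1,78,60],[1,92,4098],[1,66,4100],[1,101,4163],[1,100,42],[1,79,20],[1,68,4153],[1,69,210],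
  [1,62,4126],[1,52,4293],[1,62,32],[1,64,206],[1,96,150],[1,52,4097],[1,45,4320],[1,48,29],
  [1,42,4507],[1,53,105],[1,53,12],[1,0,4303],[1,40,145],[1,71,34],[1,0,4137],[1,0,640],[1,0,5042],
  [1,0,320],[1,0,4102],[1,69,4140],[1,55,4208],[1,0,4],[1,0,124],[1,0,35],[1,0,17],[1,0,4156],
  [1,0,780],[1,0,4138],[1,0,4293],[1,0,8],[1,0,13],[1,0,4237],[1,0,7],[1,0,19],[1,0,15],[1,0,4431],
  [1,0,592],[1,0,4195],[0,0,364],[1,0,4259],[0,0,4247],[1,0,4143],[0,0,239],[1,0,4104],[0,0,4253],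
  [1,0,112,383],[0,0,4],[0,0,1],[1,0,4226],[0,0,75],[0,0,23],[1,0,4334],[0,0,4138],[0,0,4402],
  [1,0,34],[0,0,4232],[0,0,86],[0,0,4926],[1,0,1],[0,0,4],[0,0,10],[0,0,68],[1,0,2],[0,0,17],
  [0,0,34],[0,0,69],[1,0]] = true) := ⟨by decide +kernel⟩
theorem d91 : Dead [false, true, true, true, false, false, true, true] := leaf _ t91 (by decide) rfl rfl
def t92 : PLift (check 4096 [1,1,0,0,1,1,1,1] [0,0,1,1,0,0,0,0] [[0,0,1],[0,0,2],[0,0,4],[0,0,8],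
  [0,0,16],[0,0,32],[0,0,64],[0,0,128],[0,0,256],[0,0,512],[0,0,1024],[1,0,1],[0,0,2],[0,0,4],
  [0,0,24],[1,0,104],[0,0,208],[0,0,1713],[0,0,4519,36],[1,0,4465],[0,0,4731],[1,0,337],[1,0,4161],
  [1,196,53],[1,173,33],[1,107,4164],[1,125,4118],[1,93,84],[1,189,4187],[1,91,4120],[1,128,9],
  [1,107,28],[1,120,3],[1,100,49],[1,53,4472],[1,97,4237],[1,45,13],[1,132,86],[1,117,4149],
  [1,100,4374],[1,52,4139],[1,73,4135],[1,0,187],[1,0,4492],[1,0,31],[1,0,86],[1,0,4205],[1,0,38],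
  [1,0,291],[1,0,4602],[1,0,2],[1,0,4363],[1,0,47],[1,0,4122],[1,0,5138],[1,0,283],[1,0,4111],
  [1,0,4216],[1,0,27],[1,0,4319],[1,0,7],[1,0,29],[1,0,45],[1,0,4799],[1,0,21],[1,0,4143],
  [1,0,4148],[1,0,4270],[0,0,296],[1,0,4578],[0,0,547],[1,0,4139],[0,0,4],[1,0,657],[0,0,4537],
  [0,0,112],[1,0,40],[0,0,208],[1,0,4297,492],[0,0,349],[0,0,5433],[1,0,124],[0,0,56],[0,0,248],
  [1,0,92],[0,0,144],[0,0,4160],[1,0,239],[0,0,362],[0,0,11],[1,0,15],[0,0,281],[0,0,4831,4122],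
  [0,0,44],[1,0]] = true) := ⟨by decide +kernel⟩
theorem d92 : Dead [true, true, true, true, false, false, true, true] := leaf _ t92 (by decide) rfl rfl
def t93 : PLift (check 4096 [1,1,1,1,0,0] [0,0,0,0,1,1] [[0,0,1],[0,0,2],[0,0,4],[0,0,8],[0,0,16],
  [0,0,32],[0,0,64],[0,0,128],[0,0,256],[0,0,512],[0,0,1024],[1,0]] = true) := ⟨by decide +kernel⟩
theorem d93 : Dead [false, false, true, true, true, true] := leaf _ t93 (by decide) rfl rfl
def t94 : PLift (check 4096 [1,1,1,1,1,1] [0,0,0,0,0,0] [[0,0,1],[0,0,2],[0,0,4],[0,0,8],[0,0,16],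
  [0,0,32],[0,0,64],[0,0,128],[0,0,256],[0,0,512],[0,0,1024],[1,0]] = true) := ⟨by decide +kernel⟩
theorem d94 : Dead [true, true, true, true, true, true] := leaf _ t94 (by decide) rfl rfl
theorem deadAll : Dead [] :=
  br (br (br (br (br (br d71 (sy3 d64)) (br d64 d72)) (sy2 d62)) (br d62 (br (br (br (br d73 d74)
  (br d75 (br (br (br d76 (br d77 (br d78 d79))) d80) d81))) (sy3 (br (br d65 d66) d67))) (br (br
  (br d65 d66) d67) d82)))) (sy1 (br (br (br d0 (br d1 (br (br (br d2 (br d3 d4)) d5) d6))) (br (br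
  (br d7 (br d8 (br d9 (br (br d10 (br d11 (br d12 d13))) d14)))) d15) (br (br (br (br d16 (br d17
  d18)) (br d19 (br (br d20 (br d21 (br (br d22 d23) d24))) (br (br d25 d26) d27)))) (br d28 (br d29
  (br d30 d31)))) (br (br (br d32 (br (br d33 d34) d35)) d36) (br (br d37 d38) d39))))) (br (br (br
  d40 (br d41 (br d42 d43))) d44) (br (br (br (br d45 d46) (br d47 (br (br (br d48 (br d49 (br (br
  d50 (br (br d51 d52) d53)) d54))) d55) d56))) (br d57 (br (br d58 d59) d60))) d61))))) (br (br (br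
  (br d0 (br d1 (br (br (br d2 (br d3 d4)) d5) d6))) (br (br (br d7 (br d8 (br d9 (br (br d10 (br
  d11 (br d12 d13))) d14)))) d15) (br (br (br (br d16 (br d17 d18)) (br d19 (br (br d20 (br d21 (br
  (br d22 d23) d24))) (br (br d25 d26) d27)))) (br d28 (br d29 (br d30 d31)))) (br (br (br d32 (br
  (br d33 d34) d35)) d36) (br (br d37 d38) d39))))) (br (br (br d40 (br d41 (br d42 d43))) d44) (br
  (br (br (br d45 d46) (br d47 (br (br (br d48 (br d49 (br (br d50 (br (br d51 d52) d53)) d54)))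
  d55) d56))) (br d57 (br (br d58 d59) d60))) d61))) (br (br (br (br d83 (sy3 (br d68 d69))) (br (br
  d68 d69) (br (br (br d84 (br d85 (br (br (br d86 d87) d88) d89))) d90) (br d91 d92)))) (sy2 d63))
  (br d63 (br (br d93 (sy3 d70)) (br d70 d94)))))
end K6

/-- Erdős–Szekeres: every set of 17 points in the plane in general position
contains a 6-gon, i.e. six points in convex position. -/
theorem every_17_point_set_has_6gon (S : Set (ℝ × ℝ))
    (hfin : S.Finite) (hcard : S.ncard = 17) (hgp : InGenPos S) :
    ∃ P : Set (ℝ × ℝ), IsGon 6 S P := by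
  by_contra hno
  obtain ⟨p, f, F⟩ := K6.exists_fan S hfin hcard hgp
  exact K6.deadAll (K6.tri3 f) (K6.cls F hno) (fun i x h => by simp at h)
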